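/- (Closedness in the method of continuity.) Let ᾱ ∈ (0,1) be the universal Hölder exponent for the two-dimensional C^{2,ᾱ} theory. Let F be of class C², uniformly elliptic with constants λ, Λ, with F(0) = 0, and let g ∈ C^{2,ᾱ}(∂B₁), B₁ ⊂ ℝ². Define A := { t ∈ [0,1] : there exists u ∈ C^{2,ᾱ}(B̄₁) with t·F(D²u) + (1−t)·Δu = 0 in B₁ and u = g on ∂B₁ }. Then A is closed in [0,1]: if t_m ∈ A and t_m → t̄ ∈ [0,1], then t̄ ∈ A. -/

import Mathlib

open Metric Set Real
open scoped Classical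

noncomputable section

abbrev E2 : Type := EuclideanSpace ℝ (Fin 2)
abbrev Mat2 : Type := Matrix (Fin 2) (Fin 2) ℝ

/-- `‖A⁺‖`: the sum of the positive parts of the eigenvalues of a symmetric matrix `A`. -/
noncomputable def posNorm (A : Mat2) : ℝ :=
  if h : A.IsHermitian then ∑ i, max (h.eigenvalues i) 0 else 0

/-- `‖A⁻‖`: the sum of the negative parts of the eigenvalues of a symmetric matrix `A`. -/
noncomputable def negNorm (A : Mat2) : ℝ :=
  if h : A.IsHermitian then ∑ i, max (-(h.eigenvalues i)) 0 else 0

/-- A norm on 2×2 matrices: sum of absolute values of entries. -/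
noncomputable def matNorm (A : Mat2) : ℝ := ∑ i, ∑ j, |A i j|

/-- `F` is uniformly elliptic with constants `0 < lam ≤ Lam`:
`F M - F N ≤ Lam ‖(M-N)⁺‖ - lam ‖(M-N)⁻‖` for all symmetric `M, N`. -/
def UniformlyElliptic (lam Lam : ℝ) (F : Mat2 → ℝ) : Prop :=
  ∀ M N : Mat2, M.IsHermitian → N.IsHermitian →
    F M - F N ≤ Lam * posNorm (M - N) - lam * negNorm (M - N)

/-- The Hessian matrix `D²u(x)` of `u : ℝ² → ℝ` at `x`. -/
noncomputable def hess (u : E2 → ℝ) (x : E2) : Mat2 :=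
  Matrix.of fun i j =>
    fderiv ℝ (fun y => fderiv ℝ u y (EuclideanSpace.single j 1)) x (EuclideanSpace.single i 1)

/-- `sup_s |u|`, the `L^∞` norm of `u` on `s`. -/
noncomputable def supAbs (u : E2 → ℝ) (s : Set E2) : ℝ := ⨆ x ∈ s, |u x|

/-- The point `(cos t, sin t)` on the unit circle `∂B₁`. -/
noncomputable def circPt (t : ℝ) : E2 :=
  (EuclideanSpace.equiv (Fin 2) ℝ).symm ![Real.cos t, Real.sin t]

/-- The trace of `g` on the unit circle, as a `2π`-periodic function on `ℝ`. -/
noncomputable def onCircle (g : E2 → ℝ) : ℝ → ℝ := fun t => g (circPt t)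

/-- `g ∈ C^{2,α}(∂B₁)`, via the arclength parametrization `t ↦ (cos t, sin t)`. -/
def MemHolderCircle (α : ℝ) (g : E2 → ℝ) : Prop :=
  ContDiff ℝ 2 (onCircle g) ∧
    ∃ H : ℝ, ∀ s t : ℝ,
      |deriv (deriv (onCircle g)) s - deriv (deriv (onCircle g)) t| ≤ H * |s - t| ^ α

/-- The `C^{2,α}` norm of `g` on the unit circle `∂B₁`. -/
noncomputable def holderNormCircle (α : ℝ) (g : E2 → ℝ) : ℝ :=
  (⨆ t : ℝ, |onCircle g t|) + (⨆ t : ℝ, |deriv (onCircle g) t|) +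
    (⨆ t : ℝ, |deriv (deriv (onCircle g)) t|) +
    ⨆ p : ℝ × ℝ,
      if p.1 ≠ p.2 then
        |deriv (deriv (onCircle g)) p.1 - deriv (deriv (onCircle g)) p.2| / |p.1 - p.2| ^ α
      else 0

/-- The Laplacian of `u`, the trace of the Hessian. -/
noncomputable def lapl (u : E2 → ℝ) (x : E2) : ℝ := ∑ i, hess u x i i

/-- `t` belongs to the set `A` of the method of continuity: the Dirichlet problem
`t·F(D²u) + (1−t)·Δu = 0` in `B₁`, `u = g` on `∂B₁` has a solution `u ∈ C^{2,α}(B̄₁)`. -/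
def SolvesAt (α : ℝ) (F : Mat2 → ℝ) (g : E2 → ℝ) (t : ℝ) : Prop :=
  ∃ u : E2 → ℝ,
    ContDiffOn ℝ 2 u (closedBall (0 : E2) 1) ∧
    (∃ H : ℝ, ∀ x ∈ ball (0 : E2) 1, ∀ y ∈ ball (0 : E2) 1,
      matNorm (hess u x - hess u y) ≤ H * ‖x - y‖ ^ α) ∧
    (∀ x ∈ ball (0 : E2) 1, t * F (hess u x) + (1 - t) * lapl u x = 0) ∧
    (∀ x ∈ sphere (0 : E2) 1, u x = g x)

namespace MC
open intervalIntegral MeasureTheory Filter Topology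

lemma green (P Pr Pt Q Qr Qt : ℝ → ℝ → ℝ) (R L T : ℝ) (hR : 0 ≤ R) (hL : 0 ≤ L) (hT : L < T)
    (cP : Continuous (Function.uncurry P)) (cPr : Continuous (Function.uncurry Pr))
    (cPt : Continuous (Function.uncurry Pt)) (cQ : Continuous (Function.uncurry Q))
    (cQr : Continuous (Function.uncurry Qr)) (cQt : Continuous (Function.uncurry Qt))
    (hPr : ∀ t, ∀ r ∈ Ioo 0 R, HasDerivAt (fun r => P r t) (Pr r t) r)
    (hPt : ∀ r, ∀ t ∈ Ioo 0 T, HasDerivAt (fun t => P r t) (Pt r t) t)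
    (hQr : ∀ t, ∀ r ∈ Ioo 0 R, HasDerivAt (fun r => Q r t) (Qr r t) r)
    (hQt : ∀ r, ∀ t ∈ Ioo 0 T, HasDerivAt (fun t => Q r t) (Qt r t) t) :
    ∫ r in (0:ℝ)..R, ∫ t in (0:ℝ)..L, (Qr r t * Pt r t - Qt r t * Pr r t) =
      (∫ t in (0:ℝ)..L, (Q R t * Pt R t - Q 0 t * Pt 0 t)) -
      ∫ r in (0:ℝ)..R, (Q r L * Pr r L - Q r 0 * Pr r 0) := by
  have cP' : ∀ {α : Type} [TopologicalSpace α] {f g : α → ℝ}, Continuous f → Continuous g →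
    Continuous (fun x => P (f x) (g x)) := fun hf hg => cP.comp (hf.prodMk hg)
  have cQ' : ∀ {α : Type} [TopologicalSpace α] {f g : α → ℝ}, Continuous f → Continuous g →
    Continuous (fun x => Q (f x) (g x)) := fun hf hg => cQ.comp (hf.prodMk hg)
  have cPr' : ∀ {α : Type} [TopologicalSpace α] {f g : α → ℝ}, Continuous f → Continuous g →
    Continuous (fun x => Pr (f x) (g x)) := fun hf hg => cPr.comp (hf.prodMk hg)
  have cPt' : ∀ {α : Type} [TopologicalSpace α] {f g : α → ℝ}, Continuous f → Continuous g →
    Continuous (fun x => Pt (f x) (g x)) := fun hf hg => cPt.comp (hf.prodMk hg)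
  have cQr' : ∀ {α : Type} [TopologicalSpace α] {f g : α → ℝ}, Continuous f → Continuous g →
    Continuous (fun x => Qr (f x) (g x)) := fun hf hg => cQr.comp (hf.prodMk hg)
  have cQt' : ∀ {α : Type} [TopologicalSpace α] {f g : α → ℝ}, Continuous f → Continuous g →
    Continuous (fun x => Qt (f x) (g x)) := fun hf hg => cQt.comp (hf.prodMk hg)
  set a : ℝ → ℝ → ℝ → ℝ := fun δ r t => ∫ σ in (0:ℝ)..1, Pt r (t + σ * δ) with ha
  set b : ℝ → ℝ → ℝ → ℝ := fun δ r t => ∫ σ in (0:ℝ)..1, Pr r (t + σ * δ) with hb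
  have ca : ∀ {α : Type} [TopologicalSpace α] {e f g : α → ℝ}, Continuous e → Continuous f →
      Continuous g → Continuous (fun x => a (e x) (f x) (g x)) := by
    intro α _ e f g he hf hg
    have : Continuous (fun x : ℝ × ℝ × ℝ => a x.1 x.2.1 x.2.2) :=
      continuous_parametric_intervalIntegral_of_continuous'
        (f := fun (x : ℝ × ℝ × ℝ) σ => Pt x.2.1 (x.2.2 + σ * x.1)) (cPt' (by fun_prop) (by fun_prop)) 0 1
    exact this.comp (he.prodMk (hf.prodMk hg))
  have cb : ∀ {α : Type} [TopologicalSpace α] {e f g : α → ℝ}, Continuous e → Continuous f →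
      Continuous g → Continuous (fun x => b (e x) (f x) (g x)) := by
    intro α _ e f g he hf hg
    have : Continuous (fun x : ℝ × ℝ × ℝ => b x.1 x.2.1 x.2.2) :=
      continuous_parametric_intervalIntegral_of_continuous'
        (f := fun (x : ℝ × ℝ × ℝ) σ => Pr x.2.1 (x.2.2 + σ * x.1)) (cPr' (by fun_prop) (by fun_prop)) 0 1
    exact this.comp (he.prodMk (hf.prodMk hg))
  -- the identity for positive step
  set lhs : ℝ → ℝ := fun δ => ∫ r in (0:ℝ)..R, ∫ t in (0:ℝ)..L, (Qr r t * a δ r t - Qt r t * b δ r t)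
    with hlhs
  set rhs : ℝ → ℝ := fun δ => (∫ t in (0:ℝ)..L, (Q R t * a δ R t - Q 0 t * a δ 0 t)) -
      ∫ r in (0:ℝ)..R, (Q r L * b δ r L - Q r 0 * b δ r 0) with hrhs
  have clhs : Continuous lhs := by
    refine continuous_parametric_intervalIntegral_of_continuous'
      (f := fun δ r => ∫ t in (0:ℝ)..L, (Qr r t * a δ r t - Qt r t * b δ r t)) ?_ 0 R
    refine continuous_parametric_intervalIntegral_of_continuous'
      (f := fun (x : ℝ × ℝ) t => (Qr x.2 t * a x.1 x.2 t - Qt x.2 t * b x.1 x.2 t)) ?_ 0 L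
    refine ((cQr' ?_ ?_).mul (ca ?_ ?_ ?_)).sub ((cQt' ?_ ?_).mul (cb ?_ ?_ ?_)) <;> fun_prop
  have crhs : Continuous rhs := by
    refine Continuous.sub ?_ ?_
    · refine continuous_parametric_intervalIntegral_of_continuous'
        (f := fun δ t => (Q R t * a δ R t - Q 0 t * a δ 0 t)) ?_ 0 L
      refine ((cQ' ?_ ?_).mul (ca ?_ ?_ ?_)).sub ((cQ' ?_ ?_).mul (ca ?_ ?_ ?_)) <;> fun_prop
    · refine continuous_parametric_intervalIntegral_of_continuous'
        (f := fun δ r => (Q r L * b δ r L - Q r 0 * b δ r 0)) ?_ 0 R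
      refine ((cQ' ?_ ?_).mul (cb ?_ ?_ ?_)).sub ((cQ' ?_ ?_).mul (cb ?_ ?_ ?_)) <;> fun_prop
  have key : ∀ δ ∈ Ioo 0 (T - L), lhs δ = rhs δ := by
    intro δ hδ
    have hδ0 : δ ≠ 0 := hδ.1.ne'
    set c : ℝ → ℝ → ℝ := fun r t => (Pr r (t + δ) - Pr r t) / δ with hc
    have cc : Continuous (Function.uncurry c) := by
      refine ((cPr' ?_ ?_).sub (cPr' ?_ ?_)).div_const _ <;> fun_prop
    have cc' : ∀ {α : Type} [TopologicalSpace α] {f g : α → ℝ}, Continuous f → Continuous g →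
      Continuous (fun x => c (f x) (g x)) := fun hf hg => cc.comp (hf.prodMk hg)
    have eqa : ∀ r, ∀ t ∈ Icc 0 L, a δ r t = (P r (t + δ) - P r t) / δ := by
      intro r t ht
      have h1 : ∫ y in t..(t+δ), Pt r y = P r (t+δ) - P r t := by
        apply integral_eq_sub_of_hasDerivAt_of_le (by linarith [hδ.1])
        · exact (cP' continuous_const continuous_id).continuousOn
        · intro y hy
          exact hPt r y ⟨by linarith [ht.1, hy.1], by linarith [ht.2, hy.2, hδ.2]⟩
        · exact (cPt' continuous_const continuous_id).intervalIntegrable _ _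
      have h2 := intervalIntegral.integral_comp_add_mul (fun y => Pt r y) (a := 0) (b := 1) hδ0 t
      simp only [ha]
      have h3 : ∀ σ : ℝ, t + σ * δ = t + δ * σ := fun σ => by ring
      simp only [h3, h2, mul_zero, add_zero, mul_one, h1, smul_eq_mul]
      field_simp
    have hbt : ∀ r t, HasDerivAt (fun t => b δ r t) (c r t) t := by
      intro r t
      have h2 : (fun t => b δ r t) = fun t => ((∫ y in (0:ℝ)..(t+δ), Pr r y) - ∫ y in (0:ℝ)..t, Pr r y) / δ := by
        funext t
        have h2 := intervalIntegral.integral_comp_add_mul (fun y => Pr r y) (a := 0) (b := 1) hδ0 t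
        simp only [hb]
        have h3 : ∀ σ : ℝ, t + σ * δ = t + δ * σ := fun σ => by ring
        simp only [h3, h2, mul_zero, add_zero, mul_one, smul_eq_mul]
        have cont : Continuous (fun y => Pr r y) := cPr' continuous_const continuous_id
        rw [← integral_interval_sub_left (cont.intervalIntegrable 0 (t+δ)) (cont.intervalIntegrable 0 t)]
        field_simp
      rw [h2]
      have cont : Continuous (fun y => Pr r y) := cPr' continuous_const continuous_id
      have d1 : ∀ x, HasDerivAt (fun x => ∫ y in (0:ℝ)..x, Pr r y) (Pr r x) x := fun x =>
        integral_hasDerivAt_right (cont.intervalIntegrable _ _)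
          cont.stronglyMeasurable.stronglyMeasurableAtFilter cont.continuousAt
      have d2 : HasDerivAt (fun x => ∫ y in (0:ℝ)..(x+δ), Pr r y) (Pr r (t+δ)) t := by
        have := (d1 (t+δ)).comp_add_const t δ
        simpa using this
      exact (d2.sub (d1 t)).div_const δ
    have I1 : ∀ t ∈ Icc 0 L, ∫ r in (0:ℝ)..R, (Qr r t * a δ r t + Q r t * c r t) =
        Q R t * a δ R t - Q 0 t * a δ 0 t := by
      intro t ht
      apply integral_eq_sub_of_hasDerivAt_of_le (f := fun r => Q r t * a δ r t) hR
      · refine Continuous.continuousOn ((cQ' ?_ ?_).mul (ca ?_ ?_ ?_)) <;> fun_prop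
      · intro r hr
        have e : (fun r => Q r t * a δ r t) = fun r => Q r t * ((P r (t + δ) - P r t) / δ) := by
          funext r; rw [eqa r t ht]
        rw [e, eqa r t ht]
        have := (hQr t r hr).mul (((hPr (t+δ) r hr).sub (hPr t r hr)).div_const δ)
        exact this
      · refine Continuous.intervalIntegrable (((cQr' ?_ ?_).mul (ca ?_ ?_ ?_)).add
          ((cQ' ?_ ?_).mul (cc' ?_ ?_))) _ _ <;> fun_prop
    have I2 : ∀ r, ∫ t in (0:ℝ)..L, (Qt r t * b δ r t + Q r t * c r t) =
        Q r L * b δ r L - Q r 0 * b δ r 0 := by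
      intro r
      apply integral_eq_sub_of_hasDerivAt_of_le (f := fun t => Q r t * b δ r t) hL
      · refine Continuous.continuousOn ((cQ' ?_ ?_).mul (cb ?_ ?_ ?_)) <;> fun_prop
      · intro t ht
        exact (hQt r t ⟨ht.1, ht.2.trans hT⟩).mul (hbt r t)
      · refine Continuous.intervalIntegrable (((cQt' ?_ ?_).mul (cb ?_ ?_ ?_)).add
          ((cQ' ?_ ?_).mul (cc' ?_ ?_))) _ _ <;> fun_prop
    have e1 : ∫ t in (0:ℝ)..L, (Q R t * a δ R t - Q 0 t * a δ 0 t) =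
        ∫ r in (0:ℝ)..R, ∫ t in (0:ℝ)..L, (Qr r t * a δ r t + Q r t * c r t) := by
      rw [MeasureTheory.intervalIntegral_intervalIntegral_swap]
      · apply intervalIntegral.integral_congr
        intro t ht
        rw [uIcc_of_le hL] at ht
        exact (I1 t ht).symm
      · have : Continuous (Function.uncurry fun r t => (Qr r t * a δ r t + Q r t * c r t)) := by
          refine (((cQr' ?_ ?_).mul (ca ?_ ?_ ?_)).add
            ((cQ' ?_ ?_).mul (cc' ?_ ?_))) <;> fun_prop
        refine IntegrableOn.mono_set (t := (uIcc 0 R) ×ˢ (uIcc 0 L)) ?_ (prod_mono uIoc_subset_uIcc uIoc_subset_uIcc)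
        exact this.continuousOn.integrableOn_compact (isCompact_uIcc.prod isCompact_uIcc)
    have e2 : ∫ r in (0:ℝ)..R, (Q r L * b δ r L - Q r 0 * b δ r 0) =
        ∫ r in (0:ℝ)..R, ∫ t in (0:ℝ)..L, (Qt r t * b δ r t + Q r t * c r t) := by
      apply intervalIntegral.integral_congr
      intro r _
      exact (I2 r).symm
    simp only [hlhs, hrhs]
    rw [e1, e2, ← intervalIntegral.integral_sub]
    · apply intervalIntegral.integral_congr
      intro r _
      simp only []
      rw [← intervalIntegral.integral_sub]
      · apply intervalIntegral.integral_congr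
        intro t _
        simp only []
        ring
      · refine Continuous.intervalIntegrable (((cQr' ?_ ?_).mul (ca ?_ ?_ ?_)).add
          ((cQ' ?_ ?_).mul (cc' ?_ ?_))) _ _ <;> fun_prop
      · refine Continuous.intervalIntegrable (((cQt' ?_ ?_).mul (cb ?_ ?_ ?_)).add
          ((cQ' ?_ ?_).mul (cc' ?_ ?_))) _ _ <;> fun_prop
    · refine Continuous.intervalIntegrable ?_ _ _
      refine continuous_parametric_intervalIntegral_of_continuous'
        (f := fun r t => (Qr r t * a δ r t + Q r t * c r t)) ?_ 0 L
      refine (((cQr' ?_ ?_).mul (ca ?_ ?_ ?_)).add ((cQ' ?_ ?_).mul (cc' ?_ ?_))) <;> fun_prop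
    · refine Continuous.intervalIntegrable ?_ _ _
      refine continuous_parametric_intervalIntegral_of_continuous'
        (f := fun r t => (Qt r t * b δ r t + Q r t * c r t)) ?_ 0 L
      refine (((cQt' ?_ ?_).mul (cb ?_ ?_ ?_)).add ((cQ' ?_ ?_).mul (cc' ?_ ?_))) <;> fun_prop
  have lim1 : Tendsto lhs (𝓝[>] 0) (𝓝 (lhs 0)) := clhs.continuousAt.tendsto.mono_left nhdsWithin_le_nhds
  have lim2 : Tendsto rhs (𝓝[>] 0) (𝓝 (rhs 0)) := crhs.continuousAt.tendsto.mono_left nhdsWithin_le_nhds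
  have ev : lhs =ᶠ[𝓝[>] 0] rhs := by
    filter_upwards [Ioo_mem_nhdsGT (show (0:ℝ) < T - L by linarith)] with δ hδ using key δ hδ
  have fin := tendsto_nhds_unique (lim1.congr' ev) lim2
  simpa [hlhs, hrhs, ha, hb] using fin

end MC

namespace MC
open intervalIntegral MeasureTheory Filter Topology

lemma decay (f : ℝ → ℝ) (hf : Continuous f) (hf0 : ∀ r, 0 ≤ r → 0 ≤ f r) (R A B e : ℝ) (hR : 0 < R)
    (hA : 0 < A) (hB : 0 < B) (he : 0 ≤ e)
    (h1 : ∀ r ∈ Ioc 0 R, ∫ ρ in (0:ℝ)..r, f ρ ≤ A * (r * f r) + e)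
    (h2 : ∀ r ∈ Ioc 0 R, ∫ ρ in (0:ℝ)..r, f ρ ≤ B * √(r * f r) + e)
    (r : ℝ) (hr : 0 < r) (hrR : r ≤ R / 2) :
    ∫ ρ in (0:ℝ)..r, f ρ ≤ e + (2 * r / R) ^ (1 / A) * (B ^ 2 / Real.log 2) := by
  set G : ℝ → ℝ := fun x => (∫ ρ in (0:ℝ)..x, f ρ) - e with hG
  have dG : ∀ x, HasDerivAt G (f x) x := fun x =>
    (integral_hasDerivAt_right (hf.intervalIntegrable _ _)
          hf.stronglyMeasurable.stronglyMeasurableAtFilter hf.continuousAt).sub_const e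
  have hlog2 : 0 < Real.log 2 := Real.log_pos (by norm_num)
  have hnn : 0 ≤ (2 * r / R) ^ (1 / A) * (B ^ 2 / Real.log 2) := by positivity
  by_contra hcon
  push Not at hcon
  have hGr : 0 < G r := by simp only [hG]; linarith
  have mono : ∀ x y, 0 ≤ x → x ≤ y → G x ≤ G y := by
    intro x y hx hxy
    have : ∫ ρ in x..y, f ρ = G y - G x := by
      simp only [hG]
      rw [← integral_interval_sub_left (hf.intervalIntegrable 0 y) (hf.intervalIntegrable 0 x)]
      ring
    have h3 : 0 ≤ ∫ ρ in x..y, f ρ :=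
      intervalIntegral.integral_nonneg hxy (fun u hu => hf0 u (hx.trans hu.1))
    linarith
  have pos : ∀ x, r ≤ x → 0 < G x := fun x hx => hGr.trans_le (mono r x hr.le hx)
  -- first monotone quantity
  have m1 : MonotoneOn (fun x => Real.log (G x) - 1 / A * Real.log x) (Icc r (R/2)) := by
    apply monotoneOn_of_deriv_nonneg (convex_Icc _ _)
    · apply ContinuousOn.sub
      · exact ContinuousOn.log (fun x hx => (dG x).continuousAt.continuousWithinAt)
          (fun x hx => (pos x hx.1).ne')
      · exact continuousOn_const.mul (ContinuousOn.log continuousOn_id (fun x hx => (hr.trans_le hx.1).ne'))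
    · intro x hx
      rw [interior_Icc] at hx
      have hx0 : 0 < x := hr.trans hx.1
      exact (((dG x).log (pos x hx.1.le).ne').sub ((Real.hasDerivAt_log hx0.ne').const_mul (1/A))).differentiableAt.differentiableWithinAt
    · intro x hx
      rw [interior_Icc] at hx
      have hx0 : 0 < x := hr.trans hx.1
      have hd : deriv (fun x => Real.log (G x) - 1 / A * Real.log x) x = f x / G x - 1 / A * x⁻¹ :=
        (((dG x).log (pos x hx.1.le).ne').sub ((Real.hasDerivAt_log hx0.ne').const_mul (1/A))).deriv
      rw [hd]
      have hp := pos x hx.1.le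
      have := h1 x ⟨hx0, by linarith [hx.2]⟩
      have h3 : G x ≤ A * (x * f x) := by simp only [hG]; linarith
      rw [sub_nonneg, le_div_iff₀ hp, one_div, ← mul_inv, inv_mul_le_iff₀ (by positivity)]
      linarith
  have m2 : MonotoneOn (fun x => - (G x)⁻¹ - 1 / B^2 * Real.log x) (Icc (R/2) R) := by
    apply monotoneOn_of_deriv_nonneg (convex_Icc _ _)
    · apply ContinuousOn.sub
      · exact (ContinuousOn.inv₀ (fun x hx => (dG x).continuousAt.continuousWithinAt)
          (fun x hx => (pos x (hrR.trans hx.1)).ne')).neg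
      · exact continuousOn_const.mul (ContinuousOn.log continuousOn_id (fun x hx => (hr.trans_le (hrR.trans hx.1)).ne'))
    · intro x hx
      rw [interior_Icc] at hx
      have hx0 : 0 < x := hr.trans_le (hrR.trans hx.1.le)
      exact (((dG x).inv (pos x (hrR.trans hx.1.le)).ne').neg.sub ((Real.hasDerivAt_log hx0.ne').const_mul (1/B^2))).differentiableAt.differentiableWithinAt
    · intro x hx
      rw [interior_Icc] at hx
      have hx0 : 0 < x := hr.trans_le (hrR.trans hx.1.le)
      have hd := (((dG x).inv (pos x (hrR.trans hx.1.le)).ne').neg.sub ((Real.hasDerivAt_log hx0.ne').const_mul (1/B^2))).deriv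
      have hd' : deriv (fun x => - (G x)⁻¹ - 1 / B^2 * Real.log x) x = -(-f x / G x ^ 2) - 1 / B ^ 2 * x⁻¹ := hd
      rw [hd']
      have hp := pos x (hrR.trans hx.1.le)
      have := h2 x ⟨hx0, by linarith [hx.2]⟩
      have h3 : G x ≤ B * √(x * f x) := by simp only [hG]; linarith
      have h4 : G x ^ 2 ≤ B ^ 2 * (x * f x) := by
        have := pow_le_pow_left₀ hp.le h3 2
        rwa [mul_pow, Real.sq_sqrt (mul_nonneg hx0.le (hf0 x hx0.le))] at this
      rw [neg_div, neg_neg, sub_nonneg, le_div_iff₀ (by positivity), one_div, ← mul_inv, inv_mul_le_iff₀ (by positivity)]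
      linarith
  have a2 := m2 (left_mem_Icc.2 (by linarith)) (right_mem_Icc.2 (by linarith)) (by linarith : R/2 ≤ R)
  have a1 := m1 (left_mem_Icc.2 hrR) (right_mem_Icc.2 hrR) hrR
  simp only [] at a1 a2
  have hGR := pos R (by linarith)
  have hGR2 := pos (R/2) hrR
  have b2 : G (R/2) ≤ B^2 / Real.log 2 := by
    rw [Real.log_div hR.ne' (by norm_num)] at a2
    have h5 : 0 < (G R)⁻¹ := inv_pos.2 hGR
    have h6 : 1 / B^2 * Real.log 2 ≤ (G (R/2))⁻¹ := by nlinarith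
    have h7 := inv_anti₀ (by positivity) h6
    rw [inv_inv] at h7
    refine h7.trans (le_of_eq ?_)
    field_simp
  have b1 : G r ≤ (2 * r / R) ^ (1 / A) * G (R/2) := by
    have h8 : Real.log (G r) ≤ Real.log ((2 * r / R) ^ (1 / A) * G (R/2)) := by
      rw [Real.log_mul (by positivity) hGR2.ne', Real.log_rpow (by positivity)]
      have : 2 * r / R = r / (R/2) := by field_simp
      rw [this, Real.log_div hr.ne' (by positivity)]
      linarith
    exact (Real.log_le_log_iff hGr (by positivity)).1 h8
  have : G r ≤ (2 * r / R) ^ (1 / A) * (B^2 / Real.log 2) :=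
    b1.trans (mul_le_mul_of_nonneg_left b2 (by positivity))
  simp only [hG] at this
  linarith

lemma cs_interval (g : ℝ → ℝ) (hg : Continuous g) (L : ℝ) (hL : 0 ≤ L) :
    (∫ t in (0:ℝ)..L, g t) ^ 2 ≤ L * ∫ t in (0:ℝ)..L, g t ^ 2 := by
  rcases hL.eq_or_lt with h | h
  · subst h; simp
  set m := (∫ t in (0:ℝ)..L, g t) / L with hm
  have h0 : 0 ≤ ∫ t in (0:ℝ)..L, (g t - m) ^ 2 :=
    intervalIntegral.integral_nonneg hL (fun _ _ => sq_nonneg _)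
  have h1 : ∫ t in (0:ℝ)..L, (g t - m) ^ 2 = (∫ t in (0:ℝ)..L, g t ^ 2) - 2 * m * (∫ t in (0:ℝ)..L, g t) + m ^ 2 * L := by
    have : ∀ t, (g t - m)^2 = g t ^ 2 - 2 * m * g t + m ^ 2 := fun t => by ring
    simp only [this]
    rw [intervalIntegral.integral_add, intervalIntegral.integral_sub, intervalIntegral.integral_const_mul,
      intervalIntegral.integral_const]
    · simp [mul_comm]
    all_goals exact Continuous.intervalIntegrable (by fun_prop) _ _
  have h2 : (∫ t in (0:ℝ)..L, g t) = m * L := by rw [hm]; field_simp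
  rw [h1, h2] at h0
  rw [h2]
  nlinarith

end MC

namespace MC
open intervalIntegral MeasureTheory Filter Topology

lemma energy (P Pr Pt Q Qr Qt G : ℝ → ℝ → ℝ) (R L T K E S η : ℝ) (hR : 0 < R) (hL : 0 < L) (hL7 : L ≤ 7)
    (hT : L < T) (hK : 0 < K) (hE : 0 ≤ E) (hS : 0 < S) (hη : 0 ≤ η)
    (cP : Continuous (Function.uncurry P)) (cPr : Continuous (Function.uncurry Pr))
    (cPt : Continuous (Function.uncurry Pt)) (cQ : Continuous (Function.uncurry Q))
    (cQr : Continuous (Function.uncurry Qr)) (cQt : Continuous (Function.uncurry Qt))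
    (cG : Continuous (Function.uncurry G)) (hG0 : ∀ r t, 0 ≤ G r t)
    (hPr : ∀ t, ∀ r ∈ Ioo 0 R, HasDerivAt (fun r => P r t) (Pr r t) r)
    (hPt : ∀ r, ∀ t ∈ Ioo 0 T, HasDerivAt (fun t => P r t) (Pt r t) t)
    (hQr : ∀ t, ∀ r ∈ Ioo 0 R, HasDerivAt (fun r => Q r t) (Qr r t) r)
    (hQt : ∀ r, ∀ t ∈ Ioo 0 T, HasDerivAt (fun t => Q r t) (Qt r t) t)
    (hGJ : ∀ r ∈ Icc 0 R, ∀ t ∈ Icc 0 L, r * G r t ≤ - K * (Qr r t * Pt r t - Qt r t * Pr r t) + E * R)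
    (hGt : ∀ r ∈ Icc 0 R, ∀ t ∈ Icc 0 L, Pt r t ^ 2 + Qt r t ^ 2 ≤ r ^ 2 * G r t)
    (hQS : ∀ r ∈ Icc 0 R, ∀ t ∈ Icc 0 L, |Q r t| ≤ S)
    (hP0 : ∀ t, Pt 0 t = 0)
    (hed1 : ∀ r ∈ Icc 0 R, |Q r 0 * (P r L - P r 0)| ≤ η)
    (hed2 : ∀ r ∈ Icc 0 R, |Q r L * Pr r L - Q r 0 * Pr r 0| * R ≤ η)
    (r : ℝ) (hr : 0 < r) (hrR : r ≤ R / 2) :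
    ∫ ρ in (0:ℝ)..r, ρ * ∫ t in (0:ℝ)..L, G ρ t ≤
      (2 * K * η + 7 * E * R ^ 2) + (2 * r / R) ^ (1 / (4 * K)) * (12 * K ^ 2 * S ^ 2) := by
  have cG' : ∀ {α : Type} [TopologicalSpace α] {f g : α → ℝ}, Continuous f → Continuous g →
    Continuous (fun x => G (f x) (g x)) := fun hf hg => cG.comp (hf.prodMk hg)
  have cQ' : ∀ {α : Type} [TopologicalSpace α] {f g : α → ℝ}, Continuous f → Continuous g →
    Continuous (fun x => Q (f x) (g x)) := fun hf hg => cQ.comp (hf.prodMk hg)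
  have cPr' : ∀ {α : Type} [TopologicalSpace α] {f g : α → ℝ}, Continuous f → Continuous g →
    Continuous (fun x => Pr (f x) (g x)) := fun hf hg => cPr.comp (hf.prodMk hg)
  have cP' : ∀ {α : Type} [TopologicalSpace α] {f g : α → ℝ}, Continuous f → Continuous g →
    Continuous (fun x => P (f x) (g x)) := fun hf hg => cP.comp (hf.prodMk hg)
  have cPt' : ∀ {α : Type} [TopologicalSpace α] {f g : α → ℝ}, Continuous f → Continuous g →
    Continuous (fun x => Pt (f x) (g x)) := fun hf hg => cPt.comp (hf.prodMk hg)
  have cQr' : ∀ {α : Type} [TopologicalSpace α] {f g : α → ℝ}, Continuous f → Continuous g →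
    Continuous (fun x => Qr (f x) (g x)) := fun hf hg => cQr.comp (hf.prodMk hg)
  have cQt' : ∀ {α : Type} [TopologicalSpace α] {f g : α → ℝ}, Continuous f → Continuous g →
    Continuous (fun x => Qt (f x) (g x)) := fun hf hg => cQt.comp (hf.prodMk hg)
  set f : ℝ → ℝ := fun ρ => ρ * ∫ t in (0:ℝ)..L, G ρ t with hf
  have cI : ∀ H : ℝ → ℝ → ℝ, Continuous (Function.uncurry H) → Continuous (fun ρ => ∫ t in (0:ℝ)..L, H ρ t) :=
    fun H hH => continuous_parametric_intervalIntegral_of_continuous' hH 0 L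
  have cf : Continuous f := continuous_id.mul (cI G cG)
  have hIG : ∀ ρ, 0 ≤ ∫ t in (0:ℝ)..L, G ρ t := fun ρ =>
    intervalIntegral.integral_nonneg hL.le (fun t _ => hG0 ρ t)
  have hf0 : ∀ ρ, 0 ≤ ρ → 0 ≤ f ρ := fun ρ h => mul_nonneg h (hIG ρ)
  set e := 2 * K * η + 7 * E * R ^ 2 with he
  -- basic estimate
  have base : ∀ r ∈ Ioc 0 R, ∫ ρ in (0:ℝ)..r, f ρ ≤ K * |∫ t in (0:ℝ)..L, Q r t * Pt r t| + K * η + 7 * E * R^2 := by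
    intro r hr
    have hg := green P Pr Pt Q Qr Qt r L T hr.1.le hL.le hT cP cPr cPt cQ cQr cQt
      (fun t ρ hρ => hPr t ρ ⟨hρ.1, hρ.2.trans_le hr.2⟩) hPt
      (fun t ρ hρ => hQr t ρ ⟨hρ.1, hρ.2.trans_le hr.2⟩) hQt
    have cJ : Continuous (Function.uncurry fun r t => (Qr r t * Pt r t - Qt r t * Pr r t)) := by
      refine ((cQr' ?_ ?_).mul (cPt' ?_ ?_)).sub ((cQt' ?_ ?_).mul (cPr' ?_ ?_)) <;> fun_prop
    have s1 : ∀ ρ ∈ Icc 0 r, f ρ ≤ -K * (∫ t in (0:ℝ)..L, (Qr ρ t * Pt ρ t - Qt ρ t * Pr ρ t)) + 7 * E * R := by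
      intro ρ hρ
      have cJρ : Continuous (fun t => (Qr ρ t * Pt ρ t - Qt ρ t * Pr ρ t)) :=
        cJ.comp (continuous_const.prodMk continuous_id)
      have : ∫ t in (0:ℝ)..L, ρ * G ρ t ≤ ∫ t in (0:ℝ)..L, (-K * (Qr ρ t * Pt ρ t - Qt ρ t * Pr ρ t) + E * R) := by
        apply intervalIntegral.integral_mono_on hL.le
        · exact Continuous.intervalIntegrable (continuous_const.mul (cG' continuous_const continuous_id)) _ _
        · exact Continuous.intervalIntegrable (by fun_prop) _ _
        · intro t ht
          exact hGJ ρ ⟨hρ.1, hρ.2.trans hr.2⟩ t ht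
      rw [intervalIntegral.integral_const_mul, intervalIntegral.integral_add
        (Continuous.intervalIntegrable (by fun_prop) _ _) (Continuous.intervalIntegrable (by fun_prop) _ _), intervalIntegral.integral_const_mul, intervalIntegral.integral_const] at this
      have h7 : (L - 0) • (E * R) ≤ 7 * E * R := by
        rw [smul_eq_mul]; have : 0 ≤ E * R := by positivity
        nlinarith
      simp only [hf]; linarith
    have s2 : ∫ ρ in (0:ℝ)..r, f ρ ≤ ∫ ρ in (0:ℝ)..r, (-K * (∫ t in (0:ℝ)..L, (Qr ρ t * Pt ρ t - Qt ρ t * Pr ρ t)) + 7 * E * R) := by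
      apply intervalIntegral.integral_mono_on hr.1.le (cf.intervalIntegrable _ _) _ s1
      exact Continuous.intervalIntegrable ((continuous_const.mul (cI _ cJ)).add continuous_const) _ _
    have hi : IntervalIntegrable (fun ρ => -K * ∫ t in (0:ℝ)..L, (Qr ρ t * Pt ρ t - Qt ρ t * Pr ρ t)) volume 0 r :=
      Continuous.intervalIntegrable (continuous_const.mul (cI _ cJ)) _ _
    have hc : IntervalIntegrable (fun _ => 7 * E * R) volume 0 r :=
      Continuous.intervalIntegrable continuous_const _ _
    rw [intervalIntegral.integral_add hi hc, intervalIntegral.integral_const_mul, intervalIntegral.integral_const, hg] at s2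
    simp only [hP0, mul_zero, sub_zero] at s2
    have s3 : |∫ ρ in (0:ℝ)..r, (Q ρ L * Pr ρ L - Q ρ 0 * Pr ρ 0)| ≤ η := by
      have h := intervalIntegral.norm_integral_le_of_norm_le_const (a := 0) (b := r) (C := η / R)
        (f := fun ρ => (Q ρ L * Pr ρ L - Q ρ 0 * Pr ρ 0)) (by
          intro ρ hρ
          rw [uIoc_of_le hr.1.le] at hρ
          rw [Real.norm_eq_abs, le_div_iff₀ hR]
          exact hed2 ρ ⟨hρ.1.le, hρ.2.trans hr.2⟩)
      rw [Real.norm_eq_abs, sub_zero, abs_of_pos hr.1] at h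
      refine h.trans ?_
      rw [div_mul_eq_mul_div, div_le_iff₀ hR]
      nlinarith [hr.2]
    have h7 : r • (7 * E * R) ≤ 7 * E * R ^ 2 := by
      rw [smul_eq_mul]; have : 0 ≤ 7 * E * R := by positivity
      nlinarith [hr.2]
    have h8 := neg_abs_le (∫ t in (0:ℝ)..L, Q r t * Pt r t)
    have h9 := le_abs_self (∫ ρ in (0:ℝ)..r, (Q ρ L * Pr ρ L - Q ρ 0 * Pr ρ 0))
    nlinarith
  have intPt : ∀ r ∈ Icc 0 R, ∫ t in (0:ℝ)..L, (Pt r t ^2 + Qt r t ^ 2) ≤ r * f r := by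
    intro r hr
    have : ∫ t in (0:ℝ)..L, (Pt r t ^2 + Qt r t ^ 2) ≤ ∫ t in (0:ℝ)..L, r ^ 2 * G r t := by
      apply intervalIntegral.integral_mono_on hL.le
      · refine Continuous.intervalIntegrable (((cPt' ?_ ?_).pow 2).add ((cQt' ?_ ?_).pow 2)) _ _ <;> fun_prop
      · exact Continuous.intervalIntegrable (continuous_const.mul (cG' continuous_const continuous_id)) _ _
      · exact hGt r hr
    rw [intervalIntegral.integral_const_mul] at this
    simp only [hf]
    linarith [this]
  have cPt1 : ∀ r, Continuous (fun t => Pt r t) := fun r => cPt' continuous_const continuous_id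
  have cQt1 : ∀ r, Continuous (fun t => Qt r t) := fun r => cQt' continuous_const continuous_id
  have cQ1 : ∀ r, Continuous (fun t => Q r t) := fun r => cQ' continuous_const continuous_id
  have intsplit : ∀ r, ∫ t in (0:ℝ)..L, (Pt r t ^2 + Qt r t ^ 2) =
      (∫ t in (0:ℝ)..L, Pt r t ^2) + ∫ t in (0:ℝ)..L, Qt r t ^ 2 := fun r =>
    intervalIntegral.integral_add (((cPt1 r).pow 2).intervalIntegrable _ _) (((cQt1 r).pow 2).intervalIntegrable _ _)
  have csP : ∀ r, (∫ t in (0:ℝ)..L, |Pt r t|) ^ 2 ≤ L * ∫ t in (0:ℝ)..L, Pt r t ^ 2 := by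
    intro r
    have := cs_interval (fun t => |Pt r t|) (cPt1 r).abs L hL.le
    simpa only [sq_abs] using this
  have csQ : ∀ r, (∫ t in (0:ℝ)..L, |Qt r t|) ^ 2 ≤ L * ∫ t in (0:ℝ)..L, Qt r t ^ 2 := by
    intro r
    have := cs_interval (fun t => |Qt r t|) (cQt1 r).abs L hL.le
    simpa only [sq_abs] using this
  have nnP : ∀ r, 0 ≤ ∫ t in (0:ℝ)..L, Pt r t ^ 2 := fun r =>
    intervalIntegral.integral_nonneg hL.le (fun t _ => sq_nonneg _)
  have nnQ : ∀ r, 0 ≤ ∫ t in (0:ℝ)..L, Qt r t ^ 2 := fun r =>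
    intervalIntegral.integral_nonneg hL.le (fun t _ => sq_nonneg _)
  have absP0 : ∀ r, 0 ≤ ∫ t in (0:ℝ)..L, |Pt r t| := fun r =>
    intervalIntegral.integral_nonneg hL.le (fun t _ => abs_nonneg _)
  have absmul : ∀ r c : ℝ, ∀ H : ℝ → ℝ, Continuous H → (∀ t ∈ Icc 0 L, |H t| ≤ c) →
      |∫ t in (0:ℝ)..L, H t * Pt r t| ≤ c * ∫ t in (0:ℝ)..L, |Pt r t| := by
    intro r c H hH hc
    refine (intervalIntegral.abs_integral_le_integral_abs hL.le).trans ?_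
    rw [← intervalIntegral.integral_const_mul]
    apply intervalIntegral.integral_mono_on hL.le
    · exact ((hH.mul (cPt1 r)).abs).intervalIntegrable _ _
    · exact (continuous_const.mul (cPt1 r).abs).intervalIntegrable _ _
    · intro t ht
      rw [abs_mul]
      exact mul_le_mul_of_nonneg_right (hc t ht) (abs_nonneg _)
  have H1 : ∀ r ∈ Ioc 0 R, ∫ ρ in (0:ℝ)..r, f ρ ≤ (4 * K) * (r * f r) + e := by
    intro r hr
    have hr' : r ∈ Icc 0 R := ⟨hr.1.le, hr.2⟩
    have hb := base r hr
    have osc : ∀ t ∈ Icc 0 L, |Q r t - Q r 0| ≤ ∫ t in (0:ℝ)..L, |Qt r t| := by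
      intro t ht
      have h1 : ∫ y in (0:ℝ)..t, Qt r y = Q r t - Q r 0 := by
        apply integral_eq_sub_of_hasDerivAt_of_le ht.1 (cQ1 r).continuousOn
        · intro y hy
          exact hQt r y ⟨hy.1, by linarith [hy.2, ht.2]⟩
        · exact (cQt1 r).intervalIntegrable _ _
      rw [← h1]
      refine (intervalIntegral.abs_integral_le_integral_abs ht.1).trans ?_
      have h2 := integral_add_adjacent_intervals ((cQt1 r).abs.intervalIntegrable 0 t) ((cQt1 r).abs.intervalIntegrable t L) (μ := volume)
      have h3 : 0 ≤ ∫ y in t..L, |Qt r y| :=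
        intervalIntegral.integral_nonneg ht.2 (fun t _ => abs_nonneg _)
      linarith
    have h2 := absmul r _ (fun t => Q r t - Q r 0) ((cQ1 r).sub continuous_const) osc
    have h3 : ∫ t in (0:ℝ)..L, Q r t * Pt r t = (∫ t in (0:ℝ)..L, (Q r t - Q r 0) * Pt r t) + Q r 0 * (P r L - P r 0) := by
      have h4 : ∫ t in (0:ℝ)..L, Pt r t = P r L - P r 0 := by
        apply integral_eq_sub_of_hasDerivAt_of_le hL.le (cP' continuous_const continuous_id).continuousOn
        · intro y hy
          exact hPt r y ⟨hy.1, hy.2.trans hT⟩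
        · exact (cPt1 r).intervalIntegrable _ _
      rw [← h4, ← intervalIntegral.integral_const_mul, ← intervalIntegral.integral_add]
      · apply intervalIntegral.integral_congr
        intro t _
        simp only []
        ring
      · exact (((cQ1 r).sub continuous_const).mul (cPt1 r)).intervalIntegrable _ _
      · exact (continuous_const.mul (cPt1 r)).intervalIntegrable _ _
    have h5 := abs_add_le (∫ t in (0:ℝ)..L, (Q r t - Q r 0) * Pt r t) (Q r 0 * (P r L - P r 0))
    rw [← h3] at h5
    have h6 := hed1 r hr'
    have h7 := intPt r hr'
    rw [intsplit] at h7
    have h8 := csP r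
    have h9 := csQ r
    have h10 : (∫ t in (0:ℝ)..L, |Qt r t|) * ∫ t in (0:ℝ)..L, |Pt r t| ≤ 4 * (r * f r) := by
      have := nnP r
      have := nnQ r
      nlinarith [sq_nonneg ((∫ t in (0:ℝ)..L, |Qt r t|) - ∫ t in (0:ℝ)..L, |Pt r t|)]
    have h11 : |∫ t in (0:ℝ)..L, Q r t * Pt r t| ≤ 4 * (r * f r) + η := by linarith
    have := mul_le_mul_of_nonneg_left h11 hK.le
    rw [he]
    linarith
  have H2 : ∀ r ∈ Ioc 0 R, ∫ ρ in (0:ℝ)..r, f ρ ≤ (K * S * √7) * √(r * f r) + e := by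
    intro r hr
    have hr' : r ∈ Icc 0 R := ⟨hr.1.le, hr.2⟩
    have hb := base r hr
    have h2 := absmul r S (fun t => Q r t) (cQ1 r) (hQS r hr')
    have h7 := intPt r hr'
    rw [intsplit] at h7
    have h8 : (∫ t in (0:ℝ)..L, |Pt r t|) ≤ √7 * √(r * f r) := by
      rw [← Real.sqrt_mul (by norm_num)]
      apply Real.le_sqrt_of_sq_le
      have := nnP r
      have := nnQ r
      nlinarith [csP r]
    have h9 := mul_le_mul_of_nonneg_left (h2.trans (mul_le_mul_of_nonneg_left h8 hS.le)) hK.le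
    have : 0 ≤ K * η := by positivity
    rw [he]
    linarith
  have fin := decay f cf hf0 R (4 * K) (K * S * √7) e hR (by positivity) (by positivity) (by positivity) H1 H2 r hr hrR
  refine fin.trans ?_
  gcongr
  rw [mul_pow, mul_pow, Real.sq_sqrt (by norm_num), div_le_iff₀ (Real.log_pos (by norm_num))]
  have := Real.log_two_gt_d9
  have h0 : 0 ≤ K^2 * S^2 := by positivity
  nlinarith

/-- lower bound of the polar energy by a polar box -/
lemma box (G : ℝ → ℝ → ℝ) (L m s ρ₁ t₁ : ℝ) (hL : 1 ≤ L) (hm : 0 ≤ m) (hs : 0 < s) (hρ : 0 ≤ ρ₁)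
    (ht : t₁ ∈ Icc 0 L) (cG : Continuous (Function.uncurry G)) (hG0 : ∀ r t, 0 ≤ G r t)
    (hG : ∀ r, 0 ≤ r → ∀ t ∈ Icc 0 L, |r - ρ₁| + ρ₁ * |t - t₁| ≤ s → m ≤ G r t) :
    m * s ^ 2 / 32 ≤ ∫ ρ in (0:ℝ)..(ρ₁ + s), ρ * ∫ t in (0:ℝ)..L, G ρ t := by
  set w := s / (2 * (ρ₁ + s)) with hw
  have hw0 : 0 < w := by positivity
  have hw1 : w ≤ 1/2 := by
    rw [hw, div_le_div_iff₀ (by positivity) (by norm_num)]; nlinarith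
  have hwρ : ρ₁ * w ≤ s / 2 := by
    rw [hw, mul_div_assoc', div_le_div_iff₀ (by positivity) (by norm_num)]; nlinarith
  obtain ⟨a, ha0, haL, hat⟩ : ∃ a, 0 ≤ a ∧ a + w ≤ L ∧ ∀ t ∈ Icc a (a+w), |t - t₁| ≤ w := by
    rcases le_total t₁ (L/2) with h | h
    · refine ⟨t₁, ht.1, by linarith, fun t h' => ?_⟩
      rw [abs_le]; constructor <;> linarith [h'.1, h'.2]
    · refine ⟨t₁ - w, by linarith, by linarith [ht.2], fun t h' => ?_⟩
      rw [abs_le]; constructor <;> linarith [h'.1, h'.2]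
  have c1 : ∀ ρ, Continuous (fun t => G ρ t) := fun ρ => cG.comp (continuous_const.prodMk continuous_id)
  have cI : Continuous (fun ρ => ∫ t in (0:ℝ)..L, G ρ t) :=
    continuous_parametric_intervalIntegral_of_continuous' cG 0 L
  have hIG : ∀ ρ, 0 ≤ ∫ t in (0:ℝ)..L, G ρ t := fun ρ =>
    intervalIntegral.integral_nonneg (by linarith) (fun t _ => hG0 ρ t)
  have inner : ∀ ρ ∈ Icc (ρ₁ + s/4) (ρ₁ + s/2), m * w ≤ ∫ t in (0:ℝ)..L, G ρ t := by
    intro ρ hρ'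
    have h1 : ∫ t in a..(a+w), m ≤ ∫ t in a..(a+w), G ρ t := by
      apply intervalIntegral.integral_mono_on (by linarith) (by simp) ((c1 ρ).intervalIntegrable _ _)
      intro t ht'
      apply hG ρ (by linarith [hρ'.1]) t ⟨by linarith [ht'.1], by linarith [ht'.2]⟩
      have : |ρ - ρ₁| ≤ s/2 := by rw [abs_le]; constructor <;> linarith [hρ'.1, hρ'.2]
      have := mul_le_mul_of_nonneg_left (hat t ht') hρ
      linarith
    have h2 : ∫ t in a..(a+w), G ρ t ≤ ∫ t in (0:ℝ)..L, G ρ t := by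
      apply intervalIntegral.integral_mono_interval ha0 (by linarith) haL
      · exact Filter.Eventually.of_forall (fun t => hG0 ρ t)
      · exact (c1 ρ).intervalIntegrable _ _
    simp only [intervalIntegral.integral_const, smul_eq_mul, add_sub_cancel_left] at h1
    linarith
  have o1 : ∫ ρ in (ρ₁ + s/4)..(ρ₁ + s/2), (ρ₁ + s/4) * (m * w) ≤ ∫ ρ in (ρ₁ + s/4)..(ρ₁ + s/2), ρ * ∫ t in (0:ℝ)..L, G ρ t := by
    apply intervalIntegral.integral_mono_on (by linarith) (by simp) ((continuous_id.mul cI).intervalIntegrable _ _)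
    intro ρ hρ'
    exact mul_le_mul hρ'.1 (inner ρ hρ') (by positivity) (by have h1 := hρ'.1; show (0:ℝ) ≤ ρ; linarith)
  have o2 : ∫ ρ in (ρ₁ + s/4)..(ρ₁ + s/2), ρ * ∫ t in (0:ℝ)..L, G ρ t ≤ ∫ ρ in (0:ℝ)..(ρ₁ + s), ρ * ∫ t in (0:ℝ)..L, G ρ t := by
    apply intervalIntegral.integral_mono_interval (by linarith) (by linarith) (by linarith)
    · rw [Filter.EventuallyLE, ae_restrict_iff' measurableSet_Ioc]
      refine Filter.Eventually.of_forall (fun ρ h => mul_nonneg h.1.le (hIG ρ))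
    · exact (continuous_id.mul cI).intervalIntegrable _ _
  refine le_trans ?_ (o1.trans o2)
  simp only [intervalIntegral.integral_const, smul_eq_mul]
  have h4 : s / 8 ≤ (ρ₁ + s/4) * w := by
    rw [hw, mul_div_assoc', div_le_div_iff₀ (by norm_num) (by positivity)]; nlinarith
  have : (ρ₁ + s / 2 - (ρ₁ + s / 4)) = s/4 := by ring
  rw [this]
  have := mul_le_mul_of_nonneg_left h4 (by positivity : 0 ≤ m * s / 4)
  nlinarith

end MC

namespace MC
open intervalIntegral MeasureTheory Filter Topology

/-- `f` is differentiable at `z` with partial derivatives `a`, `b`. -/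
def HasG (f : ℝ × ℝ → ℝ) (a b : ℝ) (z : ℝ × ℝ) : Prop :=
  HasFDerivAt f (a • ContinuousLinearMap.fst ℝ ℝ ℝ + b • ContinuousLinearMap.snd ℝ ℝ ℝ) z

lemma HasG.curve {f : ℝ × ℝ → ℝ} {a b : ℝ} {z : ℝ × ℝ} (h : HasG f a b z) {c d : ℝ → ℝ} {c' d' t : ℝ}
    (hc : HasDerivAt c c' t) (hd : HasDerivAt d d' t) (hz : (c t, d t) = z) :
    HasDerivAt (fun s => f (c s, d s)) (a * c' + b * d') t := by
  subst hz
  unfold HasG at h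
  have h2 : HasDerivAt (fun s => (c s, d s)) (c', d') t := hc.prodMk hd
  have := HasFDerivAt.comp_hasDerivAt (f := fun s => (c s, d s)) t h h2
  simpa [Function.comp_def] using this

lemma HasG.contAt {f : ℝ × ℝ → ℝ} {a b : ℝ} {z : ℝ × ℝ} (h : HasG f a b z) : ContinuousAt f z :=
  HasFDerivAt.continuousAt h

lemma HasG.sub {f g : ℝ × ℝ → ℝ} {a b c d : ℝ} {z : ℝ × ℝ} (h : HasG f a b z) (h' : HasG g c d z) :
    HasG (fun w => f w - g w) (a - c) (b - d) z := by
  unfold HasG at *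
  exact (HasFDerivAt.fun_sub h h').congr_fderiv (by ext <;> simp)

lemma HasG.add {f g : ℝ × ℝ → ℝ} {a b c d : ℝ} {z : ℝ × ℝ} (h : HasG f a b z) (h' : HasG g c d z) :
    HasG (fun w => f w + g w) (a + c) (b + d) z := by
  unfold HasG at *
  exact (HasFDerivAt.fun_add h h').congr_fderiv (by ext <;> simp)

lemma HasG.mul {f g : ℝ × ℝ → ℝ} {a b c d : ℝ} {z : ℝ × ℝ} (h : HasG f a b z) (h' : HasG g c d z) :
    HasG (fun w => f w * g w) (a * g z + f z * c) (b * g z + f z * d) z := by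
  unfold HasG at *
  exact (HasFDerivAt.fun_mul h h').congr_fderiv (by ext <;> simp <;> ring)

lemma HasG.const (c : ℝ) (z : ℝ × ℝ) : HasG (fun _ => c) 0 0 z := by
  unfold HasG
  exact (hasFDerivAt_const c z).congr_fderiv (by ext <;> simp)

lemma HasG.smul {f : ℝ × ℝ → ℝ} {a b : ℝ} {z : ℝ × ℝ} (k : ℝ) (h : HasG f a b z) :
    HasG (fun w => k * f w) (k * a) (k * b) z := by
  have := (HasG.const k z).mul h
  simpa using this

lemma HasG.shift {f : ℝ × ℝ → ℝ} {a b s t : ℝ} {z : ℝ × ℝ} (h : HasG f a b (z.1 + s, z.2 + t)) :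
    HasG (fun w => f (w.1 + s, w.2 + t)) a b z := by
  unfold HasG at *
  have h2 : HasFDerivAt (fun w : ℝ × ℝ => (w.1 + s, w.2 + t)) (ContinuousLinearMap.id ℝ (ℝ × ℝ)) z := by
    exact (hasFDerivAt_id (𝕜 := ℝ) z).add_const (s, t)
  have := HasFDerivAt.comp z h h2
  simpa [Function.comp_def] using this

lemma HasG.ofFst {f : ℝ → ℝ} {f' : ℝ} {z : ℝ × ℝ} (h : HasDerivAt f f' z.1) :
    HasG (fun w => f w.1) f' 0 z := by
  unfold HasG
  have := HasFDerivAt.comp z h.hasFDerivAt (hasFDerivAt_fst (𝕜 := ℝ) (p := z))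
  exact this.congr_fderiv (by ext <;> simp)

lemma HasG.compMap {f : ℝ × ℝ → ℝ} {a b : ℝ} {A B : ℝ × ℝ → ℝ} {A1 A2 B1 B2 : ℝ} {z : ℝ × ℝ}
    (h : HasG f a b (A z, B z)) (hA : HasG A A1 A2 z) (hB : HasG B B1 B2 z) :
    HasG (fun w => f (A w, B w)) (a * A1 + b * B1) (a * A2 + b * B2) z := by
  unfold HasG at *
  have := HasFDerivAt.comp z h (hA.prodMk hB)
  exact this.congr_fderiv (by ext <;> simp)

def cl (R r : ℝ) : ℝ := max 0 (min r R)

lemma cl_cont (R : ℝ) : Continuous (cl R) := by unfold cl; fun_prop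

lemma cl_mem {R : ℝ} (hR : 0 ≤ R) (r : ℝ) : cl R r ∈ Icc 0 R := by
  unfold cl; exact ⟨le_max_left _ _, max_le hR (min_le_right _ _)⟩

lemma cl_eq {R r : ℝ} (h : r ∈ Icc 0 R) : cl R r = r := by
  unfold cl; rw [min_eq_left h.2, max_eq_right h.1]

lemma cl_deriv {R r : ℝ} (h : r ∈ Ioo 0 R) : HasDerivAt (cl R) 1 r := by
  refine (hasDerivAt_id r).congr_of_eventuallyEq ?_
  filter_upwards [Ioo_mem_nhds h.1 h.2] with s hs
  exact cl_eq ⟨hs.1.le, hs.2.le⟩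

def pl (z0 : ℝ × ℝ) (r t : ℝ) : ℝ × ℝ := (z0.1 + r * Real.cos t, z0.2 + r * Real.sin t)

lemma cos_lip (a b : ℝ) : |Real.cos a - Real.cos b| ≤ |a - b| := by
  have h := Real.lipschitzWith_cos.dist_le_mul a b
  simpa [Real.dist_eq] using h

lemma sin_lip (a b : ℝ) : |Real.sin a - Real.sin b| ≤ |a - b| := by
  have h := Real.lipschitzWith_sin.dist_le_mul a b
  simpa [Real.dist_eq] using h

/-- Main decay estimate for a pair `(p, q)` in a polar sector. -/
lemma polar (U : Set (ℝ × ℝ)) (p p1 p2 q q1 q2 : ℝ × ℝ → ℝ) (z0 : ℝ × ℝ) (R L T K E S η m s ρ₁ t₁ : ℝ)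
    (hR : 0 < R) (hL : 1 ≤ L) (hL7 : L ≤ 7)
    (hT : L < T) (hK : 0 < K) (hE : 0 ≤ E) (hS : 0 < S) (hη : 0 ≤ η)
    (hU : ∀ r ∈ Icc 0 R, ∀ t ∈ Icc 0 T, pl z0 r t ∈ U)
    (cp1 : ContinuousOn p1 U) (cp2 : ContinuousOn p2 U)
    (cq1 : ContinuousOn q1 U) (cq2 : ContinuousOn q2 U)
    (hp : ∀ z ∈ U, HasG p (p1 z) (p2 z) z) (hq : ∀ z ∈ U, HasG q (q1 z) (q2 z) z)
    (hJ : ∀ r ∈ Icc 0 R, ∀ t ∈ Icc 0 L, ∀ z, z = pl z0 r t → p1 z ^ 2 + p2 z ^ 2 + q1 z ^ 2 + q2 z ^ 2 ≤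
      -K * (q1 z * p2 z - q2 z * p1 z) + E)
    (hQS : ∀ r ∈ Icc 0 R, ∀ t ∈ Icc 0 L, |q (pl z0 r t)| ≤ S)
    (hed1 : ∀ r ∈ Icc 0 R, |q (pl z0 r 0) * (p (pl z0 r L) - p (pl z0 r 0))| ≤ η)
    (hed2 : ∀ r ∈ Icc 0 R, |q (pl z0 r L) * (p1 (pl z0 r L) * Real.cos L + p2 (pl z0 r L) * Real.sin L)
      - q (pl z0 r 0) * (p1 (pl z0 r 0) * Real.cos 0 + p2 (pl z0 r 0) * Real.sin 0)| * R ≤ η)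
    (hm : 0 ≤ m) (hs : 0 < s) (hρ : 0 ≤ ρ₁) (ht : t₁ ∈ Icc 0 L) (hρR : ρ₁ + s ≤ R / 2)
    (hG : ∀ r ∈ Icc 0 R, ∀ t ∈ Icc 0 L, ∀ z, z = pl z0 r t → |z.1 - (pl z0 ρ₁ t₁).1| ≤ s →
      |z.2 - (pl z0 ρ₁ t₁).2| ≤ s → m ≤ p1 z ^ 2 + p2 z ^ 2 + q1 z ^ 2 + q2 z ^ 2) :
    m * s ^ 2 / 32 ≤ (2 * K * η + 7 * E * R ^ 2) +
      (2 * (ρ₁ + s) / R) ^ (1 / (4 * K)) * (12 * K ^ 2 * S ^ 2) := by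
  have hT0 : 0 ≤ T := by linarith
  set Z : ℝ → ℝ → ℝ × ℝ := fun r t => pl z0 (cl R r) (cl T t) with hZ
  have ZU : ∀ r t, Z r t ∈ U := fun r t => hU _ (cl_mem hR.le r) _ (cl_mem hT0 t)
  have clR := cl_cont R
  have clT := cl_cont T
  have cZ : Continuous (Function.uncurry Z) := by
    simp only [hZ, pl, Function.uncurry_def]
    fun_prop
  have cc : Continuous (Function.uncurry (fun (r t : ℝ) => Real.cos (cl T t))) := by
    simp only [Function.uncurry_def]; fun_prop
  have cs : Continuous (Function.uncurry (fun (r t : ℝ) => Real.sin (cl T t))) := by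
    simp only [Function.uncurry_def]; fun_prop
  have cr : Continuous (Function.uncurry (fun (r t : ℝ) => cl R r)) := by
    simp only [Function.uncurry_def]; fun_prop
  have cz : ∀ f : ℝ × ℝ → ℝ, ContinuousOn f U → Continuous (Function.uncurry fun r t => f (Z r t)) :=
    fun f hf => hf.comp_continuous cZ (fun x => ZU x.1 x.2)
  have cp : ContinuousOn p U := fun z hz => (hp z hz).contAt.continuousWithinAt
  have cq : ContinuousOn q U := fun z hz => (hq z hz).contAt.continuousWithinAt
  have dr : ∀ f f1 f2 : ℝ × ℝ → ℝ, (∀ z ∈ U, HasG f (f1 z) (f2 z) z) → ∀ t, ∀ r ∈ Ioo 0 R,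
      HasDerivAt (fun r => f (Z r t)) (f1 (Z r t) * Real.cos (cl T t) + f2 (Z r t) * Real.sin (cl T t)) r := by
    intro f f1 f2 hf t r hr
    have h1 : HasDerivAt (fun r => z0.1 + cl R r * Real.cos (cl T t)) (Real.cos (cl T t)) r := by
      simpa using ((cl_deriv hr).mul_const (Real.cos (cl T t))).const_add z0.1
    have h2 : HasDerivAt (fun r => z0.2 + cl R r * Real.sin (cl T t)) (Real.sin (cl T t)) r := by
      simpa using ((cl_deriv hr).mul_const (Real.sin (cl T t))).const_add z0.2
    exact (hf _ (ZU r t)).curve h1 h2 rfl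
  have dt : ∀ f f1 f2 : ℝ × ℝ → ℝ, (∀ z ∈ U, HasG f (f1 z) (f2 z) z) → ∀ r, ∀ t ∈ Ioo 0 T,
      HasDerivAt (fun t => f (Z r t)) (cl R r * (-f1 (Z r t) * Real.sin (cl T t) + f2 (Z r t) * Real.cos (cl T t))) t := by
    intro f f1 f2 hf r t ht
    have hc := cl_deriv ht
    have h1 : HasDerivAt (fun t => z0.1 + cl R r * Real.cos (cl T t)) (cl R r * (-Real.sin (cl T t))) t := by
      simpa using (hc.cos.const_mul (cl R r)).const_add z0.1
    have h2 : HasDerivAt (fun t => z0.2 + cl R r * Real.sin (cl T t)) (cl R r * (Real.cos (cl T t))) t := by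
      simpa using (hc.sin.const_mul (cl R r)).const_add z0.2
    have h3 := (hf _ (ZU r t)).curve h1 h2 rfl
    have e3 : f1 (Z r t) * (cl R r * -Real.sin (cl T t)) + f2 (Z r t) * (cl R r * Real.cos (cl T t)) =
      cl R r * (-f1 (Z r t) * Real.sin (cl T t) + f2 (Z r t) * Real.cos (cl T t)) := by ring
    rw [e3] at h3
    exact h3
  set G : ℝ → ℝ → ℝ := fun r t => p1 (Z r t) ^ 2 + p2 (Z r t) ^ 2 + q1 (Z r t) ^ 2 + q2 (Z r t) ^ 2 with hGd
  have cG : Continuous (Function.uncurry G) :=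
    ((((cz p1 cp1).pow 2).add ((cz p2 cp2).pow 2)).add ((cz q1 cq1).pow 2)).add ((cz q2 cq2).pow 2)
  have hG0 : ∀ r t, 0 ≤ G r t := fun r t => by simp only [hGd]; positivity
  have hLT : ∀ t ∈ Icc 0 L, t ∈ Icc 0 T := fun t ht => ⟨ht.1, ht.2.trans hT.le⟩
  have Zeq : ∀ r ∈ Icc 0 R, ∀ t ∈ Icc 0 L, Z r t = pl z0 r t := fun r hr t ht => by
    simp only [hZ, cl_eq hr, cl_eq (hLT t ht)]
  have L0 : (0:ℝ) ∈ Icc 0 L := ⟨le_rfl, by linarith⟩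
  have LL : L ∈ Icc 0 L := ⟨by linarith, le_rfl⟩
  have e := energy (fun r t => p (Z r t))
    (fun r t => p1 (Z r t) * Real.cos (cl T t) + p2 (Z r t) * Real.sin (cl T t))
    (fun r t => cl R r * (-p1 (Z r t) * Real.sin (cl T t) + p2 (Z r t) * Real.cos (cl T t)))
    (fun r t => q (Z r t))
    (fun r t => q1 (Z r t) * Real.cos (cl T t) + q2 (Z r t) * Real.sin (cl T t))
    (fun r t => cl R r * (-q1 (Z r t) * Real.sin (cl T t) + q2 (Z r t) * Real.cos (cl T t)))
    G R L T K E S η hR (by linarith) hL7 hT hK hE hS hη (cz p cp)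
    (((cz p1 cp1).mul cc).add ((cz p2 cp2).mul cs))
    (cr.mul (((cz p1 cp1).neg.mul cs).add ((cz p2 cp2).mul cc)))
    (cz q cq)
    (((cz q1 cq1).mul cc).add ((cz q2 cq2).mul cs))
    (cr.mul (((cz q1 cq1).neg.mul cs).add ((cz q2 cq2).mul cc)))
    cG hG0 (dr p p1 p2 hp) (dt p p1 p2 hp) (dr q q1 q2 hq) (dt q q1 q2 hq)
    ?_ ?_ ?_ ?_ ?_ ?_ (ρ₁ + s) (by linarith) hρR
  · refine le_trans ?_ e
    refine box G L m s ρ₁ t₁ hL hm hs hρ ht cG hG0 ?_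
    intro r hr t ht' hd
    have h1 := le_abs_self (r - ρ₁)
    have h2 : 0 ≤ ρ₁ * |t - t₁| := by positivity
    have hrR : r ∈ Icc 0 R := ⟨hr, by linarith⟩
    apply hG r hrR t ht' _ (Zeq r hrR t ht')
    · rw [Zeq r hrR t ht']
      simp only [pl]
      have : z0.1 + r * Real.cos t - (z0.1 + ρ₁ * Real.cos t₁) = (r - ρ₁) * Real.cos t + ρ₁ * (Real.cos t - Real.cos t₁) := by ring
      rw [this]
      refine (abs_add_le _ _).trans ?_
      rw [abs_mul, abs_mul, abs_of_nonneg hρ]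
      have h3 := mul_le_mul_of_nonneg_left (Real.abs_cos_le_one t) (abs_nonneg (r - ρ₁))
      have h4 := mul_le_mul_of_nonneg_left (cos_lip t t₁) hρ
      linarith
    · rw [Zeq r hrR t ht']
      simp only [pl]
      have : z0.2 + r * Real.sin t - (z0.2 + ρ₁ * Real.sin t₁) = (r - ρ₁) * Real.sin t + ρ₁ * (Real.sin t - Real.sin t₁) := by ring
      rw [this]
      refine (abs_add_le _ _).trans ?_
      rw [abs_mul, abs_mul, abs_of_nonneg hρ]
      have h3 := mul_le_mul_of_nonneg_left (Real.abs_sin_le_one t) (abs_nonneg (r - ρ₁))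
      have h4 := mul_le_mul_of_nonneg_left (sin_lip t t₁) hρ
      linarith
  · intro r hr t ht
    have h := hJ r hr t ht _ (Zeq r hr t ht)
    simp only [hGd, cl_eq hr]
    set z := Z r t
    set c := Real.cos (cl T t)
    set d := Real.sin (cl T t)
    have hcd : d ^ 2 + c ^ 2 = 1 := Real.sin_sq_add_cos_sq _
    have e1 : (q1 z * c + q2 z * d) * (r * (-p1 z * d + p2 z * c)) - r * (-q1 z * d + q2 z * c) * (p1 z * c + p2 z * d)
      = r * (q1 z * p2 z - q2 z * p1 z) * (d ^ 2 + c ^ 2) := by ring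
    rw [e1, hcd]
    have := mul_le_mul_of_nonneg_left h hr.1
    have := mul_le_mul_of_nonneg_left hr.2 hE
    linarith
  · intro r hr t ht
    simp only [hGd, cl_eq hr]
    set z := Z r t
    set c := Real.cos (cl T t)
    set d := Real.sin (cl T t)
    have hcd : d ^ 2 + c ^ 2 = 1 := Real.sin_sq_add_cos_sq _
    have e1 : (r * (-p1 z * d + p2 z * c)) ^ 2 + (r * (-q1 z * d + q2 z * c)) ^ 2 =
       r ^ 2 * ((p1 z ^ 2 + p2 z ^ 2 + q1 z ^ 2 + q2 z ^ 2) * (d ^ 2 + c ^ 2) - (p1 z * c + p2 z * d)^2 - (q1 z * c + q2 z * d)^2) := by ring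
    rw [e1, hcd, mul_one]
    apply mul_le_mul_of_nonneg_left _ (sq_nonneg r)
    have := sq_nonneg (p1 z * c + p2 z * d)
    have := sq_nonneg (q1 z * c + q2 z * d)
    linarith
  · intro r hr t ht
    show |q (Z r t)| ≤ S
    rw [Zeq r hr t ht]; exact hQS r hr t ht
  · intro t
    show cl R 0 * _ = 0
    rw [cl_eq ⟨le_rfl, hR.le⟩, zero_mul]
  · intro r hr
    show |q (Z r 0) * (p (Z r L) - p (Z r 0))| ≤ η
    rw [Zeq r hr 0 L0, Zeq r hr L LL]; exact hed1 r hr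
  · intro r hr
    have := hed2 r hr
    simp only [Zeq r hr 0 L0, Zeq r hr L LL, cl_eq (hLT 0 L0), cl_eq (hLT L LL)]
    exact this

end MC

namespace MC
open intervalIntegral MeasureTheory Filter Topology

/-- a 2-jet of functions on the plane -/
structure Jet where
  f : ℝ × ℝ → ℝ
  f1 : ℝ × ℝ → ℝ
  f2 : ℝ × ℝ → ℝ
  f11 : ℝ × ℝ → ℝ
  f12 : ℝ × ℝ → ℝ
  f22 : ℝ × ℝ → ℝ

structure Jet.On (J : Jet) (Ω : Set (ℝ × ℝ)) : Prop where
  d : ∀ z ∈ Ω, HasG J.f (J.f1 z) (J.f2 z) z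
  d1 : ∀ z ∈ Ω, HasG J.f1 (J.f11 z) (J.f12 z) z
  d2 : ∀ z ∈ Ω, HasG J.f2 (J.f12 z) (J.f22 z) z

structure Jet.Hold (J : Jet) (Ω : Set (ℝ × ℝ)) (C α d : ℝ) : Prop where
  h11 : ∀ z ∈ Ω, ∀ w ∈ Ω, ‖z - w‖ ≤ d → |J.f11 z - J.f11 w| ≤ C * ‖z - w‖ ^ α
  h12 : ∀ z ∈ Ω, ∀ w ∈ Ω, ‖z - w‖ ≤ d → |J.f12 z - J.f12 w| ≤ C * ‖z - w‖ ^ α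
  h22 : ∀ z ∈ Ω, ∀ w ∈ Ω, ‖z - w‖ ≤ d → |J.f22 z - J.f22 w| ≤ C * ‖z - w‖ ^ α

def cone (K E a b c : ℝ) : Prop := a ^ 2 + 2 * b ^ 2 + c ^ 2 ≤ -K * (a * c - b ^ 2) + E

lemma mvt (f f' : ℝ → ℝ) (k c : ℝ) (hk : 0 ≤ k) (hf : ∀ s ∈ Icc 0 k, HasDerivAt f (f' s) s)
    (hc : ∀ s ∈ Icc 0 k, |f' s| ≤ c) : |f k - f 0| ≤ c * k := by
  have := Convex.norm_image_sub_le_of_norm_hasDerivWithin_le (f := f) (f' := f') (s := Icc 0 k) (x := 0) (y := k)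
    (C := c) (fun s hs => (hf s hs).hasDerivWithinAt) (fun s hs => by simpa using hc s hs) (convex_Icc 0 k)
    ⟨le_rfl, hk⟩ ⟨hk, le_rfl⟩
  simpa [abs_of_nonneg hk] using this

lemma mvt2 (f f' : ℝ → ℝ) (a b c : ℝ) (hf : ∀ s ∈ uIcc a b, HasDerivAt f (f' s) s)
    (hc : ∀ s ∈ uIcc a b, |f' s| ≤ c) : |f b - f a| ≤ c * |b - a| := by
  have := Convex.norm_image_sub_le_of_norm_hasDerivWithin_le (f := f) (f' := f') (s := uIcc a b) (x := a) (y := b)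
    (C := c) (fun s hs => (hf s hs).hasDerivWithinAt) (fun s hs => by simpa using hc s hs) (convex_uIcc a b)
    left_mem_uIcc right_mem_uIcc
  simpa using this

/-- second difference -/
lemma sd1 (φ φ1 φ2 : ℝ → ℝ) (k c : ℝ) (hk : 0 ≤ k) 
    (h1 : ∀ s ∈ Icc (-k) k, HasDerivAt φ (φ1 s) s) (h2 : ∀ s ∈ Icc (-k) k, HasDerivAt φ1 (φ2 s) s)
    (hc : ∀ s ∈ Icc (-k) k, |φ2 s - φ2 0| ≤ c) :
    |φ k + φ (-k) - 2 * φ 0 - k ^ 2 * φ2 0| ≤ 2 * c * k ^ 2 := by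
  have m1 : ∀ s ∈ Icc 0 k, s ∈ Icc (-k) k := fun s hs => ⟨by linarith [hs.1], hs.2⟩
  have m2 : ∀ s ∈ Icc 0 k, -s ∈ Icc (-k) k := fun s hs => ⟨by linarith [hs.2], by linarith [hs.1]⟩
  have hψ : ∀ s ∈ Icc 0 k, HasDerivAt (fun s => φ s + φ (-s) - s ^ 2 * φ2 0) (φ1 s - φ1 (-s) - 2 * s * φ2 0) s := by
    intro s hs
    have a := (h1 s (m1 s hs))
    have b := (h1 (-s) (m2 s hs)).comp s (hasDerivAt_neg s)
    have c := (hasDerivAt_pow 2 s).mul_const (φ2 0)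
    refine ((a.add b).sub c).congr_deriv ?_
    simp; ring
  have hψ1 : ∀ s ∈ Icc 0 k, HasDerivAt (fun s => φ1 s - φ1 (-s) - 2 * s * φ2 0) (φ2 s + φ2 (-s) - 2 * φ2 0) s := by
    intro s hs
    have a := (h2 s (m1 s hs))
    have b := (h2 (-s) (m2 s hs)).comp s (hasDerivAt_neg s)
    have c := (((hasDerivAt_id s).const_mul 2)).mul_const (φ2 0)
    refine ((a.sub b).sub c).congr_deriv ?_
    simp
  have b1 : ∀ s ∈ Icc 0 k, |φ1 s - φ1 (-s) - 2 * s * φ2 0| ≤ 2 * c * k := by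
    intro s hs
    have := mvt _ _ s (2 * c) hs.1 (fun t ht => hψ1 t ⟨ht.1, ht.2.trans hs.2⟩) (by
      intro t ht
      have ht' : t ∈ Icc 0 k := ⟨ht.1, ht.2.trans hs.2⟩
      have e : φ2 t + φ2 (-t) - 2 * φ2 0 = (φ2 t - φ2 0) + (φ2 (-t) - φ2 0) := by ring
      rw [e]
      refine (abs_add_le _ _).trans ?_
      linarith [hc t (m1 t ht'), hc (-t) (m2 t ht')])
    simp only [neg_zero, sub_self, mul_zero, zero_mul, sub_zero] at this
    have c0 : 0 ≤ c := (abs_nonneg _).trans (hc 0 ⟨by linarith, hk⟩)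
    refine this.trans ?_
    exact mul_le_mul_of_nonneg_left hs.2 (by linarith)
  have := mvt _ _ k (2 * c * k) hk hψ b1
  simp only [neg_zero] at this
  have e : φ k + φ (-k) - 2 * φ 0 - k ^ 2 * φ2 0 = φ k + φ (-k) - k ^ 2 * φ2 0 - (φ 0 + φ 0 - 0 ^ 2 * φ2 0) := by ring
  rw [e]
  refine this.trans (le_of_eq (by ring))

lemma HasG.line {f : ℝ × ℝ → ℝ} {a b : ℝ} {z w : ℝ × ℝ} {s : ℝ} (h : HasG f a b (z.1 + s * w.1, z.2 + s * w.2)) :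
    HasDerivAt (fun s => f (z.1 + s * w.1, z.2 + s * w.2)) (a * w.1 + b * w.2) s := by
  refine h.curve ?_ ?_ rfl
  · simpa using ((hasDerivAt_id s).mul_const w.1).const_add z.1
  · simpa using ((hasDerivAt_id s).mul_const w.2).const_add z.2

def Jet.qd (J : Jet) (w z : ℝ × ℝ) : ℝ := w.1 ^ 2 * J.f11 z + 2 * w.1 * w.2 * J.f12 z + w.2 ^ 2 * J.f22 z

lemma Jet.On.line1 {J : Jet} {Ω : Set (ℝ × ℝ)} (hJ : J.On Ω) (z w : ℝ × ℝ) (s : ℝ)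
    (h : (z.1 + s * w.1, z.2 + s * w.2) ∈ Ω) :
    HasDerivAt (fun s => J.f1 (z.1 + s * w.1, z.2 + s * w.2) * w.1 + J.f2 (z.1 + s * w.1, z.2 + s * w.2) * w.2)
      (J.qd w (z.1 + s * w.1, z.2 + s * w.2)) s := by
  have a := ((hJ.d1 _ h).line).mul_const w.1
  have b := ((hJ.d2 _ h).line).mul_const w.2
  refine (a.add b).congr_deriv ?_
  unfold Jet.qd; ring

lemma Jet.On.sd {J : Jet} {Ω : Set (ℝ × ℝ)} (hJ : J.On Ω) (z w : ℝ × ℝ) (k c : ℝ) (hk : 0 ≤ k)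
    (hΩ : ∀ s ∈ Icc (-k) k, (z.1 + s * w.1, z.2 + s * w.2) ∈ Ω)
    (hc : ∀ s ∈ Icc (-k) k, |J.qd w (z.1 + s * w.1, z.2 + s * w.2) - J.qd w z| ≤ c) :
    |J.f (z.1 + k * w.1, z.2 + k * w.2) + J.f (z.1 - k * w.1, z.2 - k * w.2) - 2 * J.f z - k ^ 2 * J.qd w z| ≤ 2 * c * k ^ 2 := by
  have := sd1 (fun s => J.f (z.1 + s * w.1, z.2 + s * w.2)) _ _ k c hk
    (fun s hs => (hJ.d _ (hΩ s hs)).line) (fun s hs => hJ.line1 z w s (hΩ s hs)) (by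
      intro s hs; simpa using hc s hs)
  simpa [← sub_eq_add_neg] using this

lemma Jet.On.cont {J : Jet} {Ω : Set (ℝ × ℝ)} (hJ : J.On Ω) : ContinuousOn J.f Ω :=
  fun z hz => (hJ.d z hz).contAt.continuousWithinAt

lemma hold_cont (f : ℝ × ℝ → ℝ) (Ω : Set (ℝ × ℝ)) (C α d : ℝ) (hα : 0 < α) (hd : 0 < d)
    (h : ∀ z ∈ Ω, ∀ w ∈ Ω, ‖z - w‖ ≤ d → |f z - f w| ≤ C * ‖z - w‖ ^ α) : ContinuousOn f Ω := by
  intro z hz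
  rw [ContinuousWithinAt, tendsto_iff_norm_sub_tendsto_zero]
  have h1 : Tendsto (fun w => C * ‖w - z‖ ^ α) (𝓝[Ω] z) (𝓝 0) := by
    have : Continuous (fun w : ℝ × ℝ => C * ‖w - z‖ ^ α) := by
      refine continuous_const.mul (Continuous.rpow_const (by fun_prop) (fun _ => Or.inr hα.le))
    have h2 := this.tendsto z
    simp only [sub_self, norm_zero, Real.zero_rpow hα.ne', mul_zero] at h2
    exact h2.mono_left nhdsWithin_le_nhds
  refine squeeze_zero' (Eventually.of_forall fun _ => norm_nonneg _) ?_ h1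
  have h3 : ∀ᶠ w in 𝓝[Ω] z, ‖w - z‖ ≤ d := by
    have := Metric.closedBall_mem_nhds z hd
    filter_upwards [mem_nhdsWithin_of_mem_nhds this] with w hw
    rwa [mem_closedBall, dist_eq_norm] at hw
  filter_upwards [h3, self_mem_nhdsWithin] with w hw hw'
  exact h w hw' z hz hw

lemma conePert (K E a0 b0 c0 a b c n : ℝ) (hK : 1 ≤ K) (h0 : cone K E a0 b0 c0)
    (ha : |a - a0| ≤ n) (hb : |b - b0| ≤ n) (hc : |c - c0| ≤ n) :
    cone (4 * K) (4 * E + 100 * K ^ 2 * n ^ 2) a b c := by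
  unfold cone at *
  have hn : 0 ≤ n := (abs_nonneg _).trans ha
  set x := a - a0 with hx
  set y := b - b0 with hy
  set z := c - c0 with hz
  have hx2 : x ^ 2 ≤ n ^ 2 := sq_le_sq' (by linarith [neg_abs_le x]) (by linarith [le_abs_self x])
  have hy2 : y ^ 2 ≤ n ^ 2 := sq_le_sq' (by linarith [neg_abs_le y]) (by linarith [le_abs_self y])
  have hz2 : z ^ 2 ≤ n ^ 2 := sq_le_sq' (by linarith [neg_abs_le z]) (by linarith [le_abs_self z])
  have ea : a0 = a - x := by ring
  have eb : b0 = b - y := by ring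
  have ec : c0 = c - z := by ring
  rw [ea, eb, ec] at h0
  have f1 : a ^ 2 ≤ 2 * (a - x) ^ 2 + 2 * x ^ 2 := by nlinarith only [sq_nonneg (a - 2 * x)]
  have f2 : b ^ 2 ≤ 2 * (b - y) ^ 2 + 2 * y ^ 2 := by nlinarith only [sq_nonneg (b - 2 * y)]
  have f3 : c ^ 2 ≤ 2 * (c - z) ^ 2 + 2 * z ^ 2 := by nlinarith only [sq_nonneg (c - 2 * z)]
  have g1 : 2 * K * (a * z) ≤ a ^ 2 / 2 + 2 * K ^ 2 * z ^ 2 := by nlinarith only [sq_nonneg (a - 2 * K * z)]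
  have g2 : 2 * K * (c * x) ≤ c ^ 2 / 2 + 2 * K ^ 2 * x ^ 2 := by nlinarith only [sq_nonneg (c - 2 * K * x)]
  have g3 : - (4 * K * (b * y)) ≤ b ^ 2 + 4 * K ^ 2 * y ^ 2 := by nlinarith only [sq_nonneg (b + 2 * K * y)]
  have g4 : - (2 * K * (x * z)) ≤ K * x ^ 2 + K * z ^ 2 := by nlinarith only [mul_nonneg (by linarith : (0:ℝ) ≤ K) (sq_nonneg (x + z))]
  have k1 : K ≤ K ^ 2 := by nlinarith
  have k2 : K * x ^ 2 ≤ K ^ 2 * n ^ 2 := mul_le_mul k1 hx2 (sq_nonneg _) (sq_nonneg _)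
  have k3 : K * z ^ 2 ≤ K ^ 2 * n ^ 2 := mul_le_mul k1 hz2 (sq_nonneg _) (sq_nonneg _)
  have k4 : K * y ^ 2 ≤ K ^ 2 * n ^ 2 := mul_le_mul k1 hy2 (sq_nonneg _) (sq_nonneg _)
  have k5 : K ^ 2 * x ^ 2 ≤ K ^ 2 * n ^ 2 := mul_le_mul_of_nonneg_left hx2 (sq_nonneg _)
  have k6 : K ^ 2 * y ^ 2 ≤ K ^ 2 * n ^ 2 := mul_le_mul_of_nonneg_left hy2 (sq_nonneg _)
  have k7 : K ^ 2 * z ^ 2 ≤ K ^ 2 * n ^ 2 := mul_le_mul_of_nonneg_left hz2 (sq_nonneg _)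
  have k8 : n ^ 2 ≤ K ^ 2 * n ^ 2 := le_mul_of_one_le_left (sq_nonneg _) (by linarith)
  have h0' := h0
  have e1 : -K * ((a - x) * (c - z) - (b - y) ^ 2) = -K * (a * c - b ^ 2) + K * (a * z) + K * (c * x) - K * (x * z)
    - 2 * K * (b * y) + K * y ^ 2 := by ring
  rw [e1] at h0'
  have hK2 : 0 ≤ K ^ 2 * n ^ 2 := by positivity
  linarith

end MC

namespace MC
open intervalIntegral MeasureTheory Filter Topology

/-- Euclidean norm on the plane -/
def en (z : ℝ × ℝ) : ℝ := √(z.1 ^ 2 + z.2 ^ 2)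

def disc : Set (ℝ × ℝ) := {z | en z < 1}
def cdisc : Set (ℝ × ℝ) := {z | en z ≤ 1}

lemma dsub {z : ℝ × ℝ} (h : z ∈ disc) : z ∈ cdisc := le_of_lt (show en z < 1 from h)

lemma en_eq (z : ℝ × ℝ) : en z = ‖(⟨z.1, z.2⟩ : ℂ)‖ := by
  rw [en, Complex.norm_eq_sqrt_sq_add_sq]

lemma en_nonneg (z : ℝ × ℝ) : 0 ≤ en z := Real.sqrt_nonneg _

lemma en_add (z w : ℝ × ℝ) : en (z + w) ≤ en z + en w := by
  simp only [en_eq]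
  exact norm_add_le (⟨z.1, z.2⟩ : ℂ) ⟨w.1, w.2⟩

lemma en_smul (c : ℝ) (z : ℝ × ℝ) : en (c * z.1, c * z.2) = |c| * en z := by
  have : (c * z.1) ^ 2 + (c * z.2) ^ 2 = c ^ 2 * (z.1 ^ 2 + z.2 ^ 2) := by ring
  rw [en, en]; simp only [this]
  rw [Real.sqrt_mul (sq_nonneg c), Real.sqrt_sq_eq_abs]

lemma fst_le (z : ℝ × ℝ) : |z.1| ≤ ‖z‖ := norm_fst_le z
lemma snd_le (z : ℝ × ℝ) : |z.2| ≤ ‖z‖ := norm_snd_le z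
lemma nrm_le {z : ℝ × ℝ} {c : ℝ} (h1 : |z.1| ≤ c) (h2 : |z.2| ≤ c) : ‖z‖ ≤ c := by
  rw [Prod.norm_def]; exact max_le h1 h2

lemma en_le (z : ℝ × ℝ) : en z ≤ 2 * ‖z‖ := by
  rw [en]
  apply Real.sqrt_le_iff.2 ⟨by positivity, ?_⟩
  have h1 := sq_le_sq' (by linarith [neg_abs_le z.1, fst_le z]) ((le_abs_self z.1).trans (fst_le z))
  have h2 := sq_le_sq' (by linarith [neg_abs_le z.2, snd_le z]) ((le_abs_self z.2).trans (snd_le z))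
  nlinarith [sq_nonneg ‖z‖]

lemma norm_le_en (z : ℝ × ℝ) : ‖z‖ ≤ en z := by
  apply nrm_le
  · exact Real.abs_le_sqrt (by nlinarith [sq_nonneg z.2])
  · exact Real.abs_le_sqrt (by nlinarith [sq_nonneg z.1])

lemma en_cont : Continuous en := by unfold en; fun_prop

lemma disc_open : IsOpen disc := isOpen_lt en_cont continuous_const

lemma cdisc_compact : IsCompact cdisc := by
  refine Metric.isCompact_of_isClosed_isBounded (isClosed_le en_cont continuous_const) ?_
  rw [isBounded_iff_forall_norm_le]
  exact ⟨1, fun z hz => (norm_le_en z).trans hz⟩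

lemma en_sub_le (z w : ℝ × ℝ) : en z ≤ en w + 2 * ‖z - w‖ := by
  have := en_add w (z - w)
  rw [add_sub_cancel] at this
  linarith [en_le (z - w)]

lemma disc_norm {z w : ℝ × ℝ} (hz : z ∈ disc) (hw : w ∈ disc) : ‖z - w‖ ≤ 2 := by
  have h1 : en z < 1 := hz
  have h2 : en w < 1 := hw
  linarith [norm_sub_le z w, norm_le_en z, norm_le_en w]

lemma circle_param (z : ℝ × ℝ) (hz : en z = 1) : ∃ θ : ℝ, z = (Real.cos θ, Real.sin θ) := by
  rw [en_eq] at hz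
  refine ⟨Complex.arg ⟨z.1, z.2⟩, ?_⟩
  have h0 : (⟨z.1, z.2⟩ : ℂ) ≠ 0 := by intro h; rw [h] at hz; simp at hz
  rw [Complex.cos_arg h0, Complex.sin_arg, hz]
  simp

/-- one sided maximum principle -/
lemma maxp (J : Jet) (hJ : J.On disc) (K M : ℝ) (hK : 0 < K) (hc : ContinuousOn J.f cdisc)
    (hcone : ∀ z ∈ disc, cone K 0 (J.f11 z) (J.f12 z) (J.f22 z))
    (c11 : ContinuousOn J.f11 disc) (c12 : ContinuousOn J.f12 disc) (c22 : ContinuousOn J.f22 disc)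
    (hM : ∀ z, en z = 1 → J.f z ≤ M) : ∀ z ∈ disc, J.f z ≤ M := by
  intro x hx
  by_contra hcon
  push Not at hcon
  set ε := (J.f x - M) / 2 with hε
  have hε0 : 0 < ε := by rw [hε]; linarith
  have cw : ContinuousOn (fun z => J.f z + ε * (z.1 ^ 2 + z.2 ^ 2)) cdisc := hc.add (by fun_prop)
  obtain ⟨y, hy, hmax⟩ := cdisc_compact.exists_isMaxOn ⟨x, dsub hx⟩ cw
  have hyx := hmax (dsub hx)
  simp only [mem_ofPred_eq] at hyx
  have hyd : y ∈ disc := by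
    rcases lt_or_eq_of_le (show en y ≤ 1 from hy) with h | h
    · exact h
    · exfalso
      have h1 := hM y h
      have h2 : y.1 ^ 2 + y.2 ^ 2 = 1 := by
        rw [en, Real.sqrt_eq_one] at h; exact h
      rw [h2] at hyx
      have h3 : 0 ≤ ε * (x.1 ^ 2 + x.2 ^ 2) := by positivity
      linarith
  -- second order condition
  have key : ∀ w : ℝ × ℝ, J.qd w y + 2 * ε * (w.1 ^ 2 + w.2 ^ 2) ≤ 0 := by
    intro w
    apply le_of_forall_pos_le_add
    intro c hc0
    have cq : ContinuousOn (J.qd w) disc := by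
      unfold Jet.qd; fun_prop
    have cl1 : Continuous (fun s : ℝ => ((y.1 + s * w.1, y.2 + s * w.2) : ℝ × ℝ)) := by fun_prop
    have y0 : ((y.1 + 0 * w.1, y.2 + 0 * w.2) : ℝ × ℝ) = y := by simp
    have e1 : ∀ᶠ s in 𝓝 (0:ℝ), (y.1 + s * w.1, y.2 + s * w.2) ∈ disc := by
      apply cl1.continuousAt.eventually_mem
      apply disc_open.mem_nhds; rw [y0]; exact hyd
    have e2 : ∀ᶠ s in 𝓝 (0:ℝ), |J.qd w (y.1 + s * w.1, y.2 + s * w.2) - J.qd w y| < c / 2 := by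
      have h1 : ContinuousAt (J.qd w) y := cq.continuousAt (disc_open.mem_nhds hyd)
      have h2 : Tendsto (fun s : ℝ => ((y.1 + s * w.1, y.2 + s * w.2) : ℝ × ℝ)) (𝓝 0) (𝓝 y) := by
        have := cl1.tendsto 0; rwa [y0] at this
      have := (Metric.tendsto_nhds.1 (h1.tendsto.comp h2)) (c / 2) (by linarith)
      simpa [Real.dist_eq] using this
    obtain ⟨k, hk, hball⟩ := Metric.eventually_nhds_iff_ball.1 (e1.and e2)
    have hk2 : ∀ s ∈ Icc (-(k/2)) (k/2), s ∈ Metric.ball (0:ℝ) k := by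
      intro s hs
      rw [Metric.mem_ball, Real.dist_eq, sub_zero, abs_lt]
      constructor <;> linarith [hs.1, hs.2]
    have h := hJ.sd y w (k/2) (c/2) (by linarith) (fun s hs => (hball s (hk2 s hs)).1)
      (fun s hs => (hball s (hk2 s hs)).2.le)
    have m1 := hmax (show (y.1 + (k/2) * w.1, y.2 + (k/2) * w.2) ∈ cdisc from
      dsub (hball (k/2) (hk2 _ ⟨by linarith, le_rfl⟩)).1)
    have m2 := hmax (show (y.1 + (-(k/2)) * w.1, y.2 + (-(k/2)) * w.2) ∈ cdisc from
      dsub (hball (-(k/2)) (hk2 _ ⟨le_rfl, by linarith⟩)).1)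
    simp only [mem_ofPred_eq] at m1 m2
    have q1 : y.1 + (-(k/2)) * w.1 = y.1 - k/2 * w.1 := by ring
    have q2 : y.2 + (-(k/2)) * w.2 = y.2 - k/2 * w.2 := by ring
    rw [q1, q2] at m2
    have h' := (abs_le.1 h).1
    have hkk : 0 < (k/2) ^ 2 := by positivity
    have fin : (k/2) ^ 2 * (J.qd w y + 2 * ε * (w.1 ^ 2 + w.2 ^ 2)) ≤ (k/2) ^ 2 * (0 + c) := by
      nlinarith only [h', m1, m2]
    exact le_of_mul_le_mul_left fin hkk
  have k1 := key (1, 0)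
  have k2 := key (0, 1)
  have k3 := key (-J.f12 y, J.f11 y)
  have hcy := hcone y hyd
  simp only [Jet.qd, cone] at k1 k2 k3 hcy
  set a := J.f11 y
  set b := J.f12 y
  set c := J.f22 y
  have ha : a < 0 := by linarith
  have hdet : a * (a * c - b ^ 2) < 0 := by nlinarith [sq_nonneg b, mul_pos hε0 (mul_pos_of_neg_of_neg ha ha)]
  have hdet' : 0 < a * c - b ^ 2 := by
    by_contra h
    push Not at h
    nlinarith
  nlinarith [sq_nonneg b, sq_nonneg c, mul_pos_of_neg_of_neg ha ha]

end MC

namespace MC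
open intervalIntegral MeasureTheory Filter Topology

lemma interp0 (J : Jet) (α ε k : ℝ) (hα : 0 < α) (hα1 : α < 1) (hJ : J.On disc) (hH : J.Hold disc 1 α 2)
    (hε : 0 ≤ ε) (hf : ∀ z ∈ disc, |J.f z| ≤ ε) (hk : 0 < k) (hk8 : k ≤ 1/8) (x : ℝ × ℝ) (hx : x ∈ disc) :
    |J.f11 x| ≤ 8 * ε / k ^ 2 + 10 * k ^ α ∧ |J.f12 x| ≤ 8 * ε / k ^ 2 + 10 * k ^ α ∧
     |J.f22 x| ≤ 8 * ε / k ^ 2 + 10 * k ^ α := by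
  have hx' : en x < 1 := hx
  set z : ℝ × ℝ := ((1 - 4 * k) * x.1, (1 - 4 * k) * x.2) with hz
  have hzn : en z ≤ 1 - 4 * k := by
    rw [hz, en_smul, abs_of_nonneg (by linarith)]
    nlinarith
  have hzd : z ∈ disc := by show en z < 1; linarith
  have hxz : ‖x - z‖ ≤ 4 * k := by
    have : x - z = (4 * k * x.1, 4 * k * x.2) := by
      rw [hz]; ext <;> simp <;> ring
    rw [this]
    refine (norm_le_en _).trans ?_
    rw [en_smul, abs_of_nonneg (by linarith)]
    nlinarith
  have h4 : ‖x - z‖ ^ α ≤ 4 * k ^ α := by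
    calc ‖x - z‖ ^ α ≤ (4 * k) ^ α := Real.rpow_le_rpow (norm_nonneg _) hxz hα.le
      _ = 4 ^ α * k ^ α := Real.mul_rpow (by norm_num) hk.le
      _ ≤ 4 * k ^ α := by
        gcongr
        calc (4:ℝ) ^ α ≤ 4 ^ (1:ℝ) := Real.rpow_le_rpow_of_exponent_le (by norm_num) hα1.le
          _ = 4 := Real.rpow_one _
  have hin : ∀ w : ℝ × ℝ, ‖w‖ ≤ 1 → ∀ s ∈ Icc (-k) k, (z.1 + s * w.1, z.2 + s * w.2) ∈ disc ∧
      ‖((z.1 + s * w.1, z.2 + s * w.2) : ℝ × ℝ) - z‖ ^ α ≤ k ^ α ∧ ‖((z.1 + s * w.1, z.2 + s * w.2) : ℝ × ℝ) - z‖ ≤ 2 := by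
    intro w hw s hs
    have hs' : |s| ≤ k := abs_le.2 hs
    have h1 : ‖((z.1 + s * w.1, z.2 + s * w.2) : ℝ × ℝ) - z‖ ≤ k := by
      apply nrm_le
      · simp only [Prod.fst_sub, add_sub_cancel_left, abs_mul]
        nlinarith [fst_le w, abs_nonneg s, abs_nonneg w.1]
      · simp only [Prod.snd_sub, add_sub_cancel_left, abs_mul]
        nlinarith [snd_le w, abs_nonneg s, abs_nonneg w.2]
    refine ⟨?_, Real.rpow_le_rpow (norm_nonneg _) h1 hα.le, by linarith⟩
    have := en_sub_le (z.1 + s * w.1, z.2 + s * w.2) z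
    show en _ < 1
    linarith
  set κ := k ^ α with hκ
  have hκ0 : 0 < κ := Real.rpow_pos_of_pos hk _
  have sdw : ∀ w : ℝ × ℝ, ‖w‖ ≤ 1 → |w.1| ≤ 1 → |w.2| ≤ 1 → ∀ c, (∀ y ∈ disc, ‖y - z‖ ^ α ≤ κ → ‖y - z‖ ≤ 2 → |J.qd w y - J.qd w z| ≤ c) →
      |J.qd w z| ≤ 4 * ε / k ^ 2 + 2 * c := by
    intro w hw hw1 hw2 c hc
    have h := hJ.sd z w k c hk.le (fun s hs => (hin w hw s hs).1)
      (fun s hs => hc _ (hin w hw s hs).1 (hin w hw s hs).2.1 (hin w hw s hs).2.2)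
    have f1 := abs_le.1 (hf _ (hin w hw k ⟨by linarith, le_rfl⟩).1)
    have f2 := abs_le.1 (hf _ (hin w hw (-k) ⟨le_rfl, by linarith⟩).1)
    have f3 := abs_le.1 (hf z hzd)
    have q1 : z.1 + (-k) * w.1 = z.1 - k * w.1 := by ring
    have q2 : z.2 + (-k) * w.2 = z.2 - k * w.2 := by ring
    rw [q1, q2] at f2
    have h' := abs_le.1 h
    have hk2 : 0 < k ^ 2 := by positivity
    have e : 4 * ε / k ^ 2 + 2 * c = (4 * ε + 2 * c * k ^ 2) / k ^ 2 := by field_simp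
    rw [e, le_div_iff₀ hk2, ← abs_of_pos hk2, ← abs_mul, abs_of_pos hk2, abs_le]
    constructor <;> linarith [h'.1, h'.2, f1.1, f1.2, f2.1, f2.2, f3.1, f3.2]
  have b1 := sdw (1, 0) (by simp) (by simp) (by simp) κ (by
    intro y hy h1 h2
    have := hH.h11 y hy z hzd h2
    simp only [Jet.qd]; norm_num; linarith)
  have b2 := sdw (0, 1) (by simp) (by simp) (by simp) κ (by
    intro y hy h1 h2
    have := hH.h22 y hy z hzd h2
    simp only [Jet.qd]; norm_num; linarith)
  have b3 := sdw (1, 1) (by simp) (by simp) (by simp) (4 * κ) (by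
    intro y hy h1 h2
    have a1 := abs_le.1 (hH.h11 y hy z hzd h2)
    have a2 := abs_le.1 (hH.h22 y hy z hzd h2)
    have a3 := abs_le.1 (hH.h12 y hy z hzd h2)
    simp only [Jet.qd]; rw [abs_le]; constructor <;> linarith [a1.1, a1.2, a2.1, a2.2, a3.1, a3.2])
  simp only [Jet.qd] at b1 b2 b3
  norm_num at b1 b2 b3
  have c1 := abs_le.1 (hH.h11 x hx z hzd (by linarith))
  have c2 := abs_le.1 (hH.h22 x hx z hzd (by linarith))
  have c3 := abs_le.1 (hH.h12 x hx z hzd (by linarith))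
  have A0 : 0 ≤ 4 * ε / k ^ 2 := by positivity
  have A1 : 8 * ε / k ^ 2 = 2 * (4 * ε / k ^ 2) := by ring
  rw [A1]
  rw [abs_le] at b1 b2 b3
  refine ⟨abs_le.2 ⟨?_, ?_⟩, abs_le.2 ⟨?_, ?_⟩, abs_le.2 ⟨?_, ?_⟩⟩ <;> linarith [b1.1, b1.2, b2.1, b2.2, b3.1, b3.2, c1.1, c1.2, c2.1, c2.2, c3.1, c3.2]

lemma grad0 (J : Jet) (ε D : ℝ) (hJ : J.On disc) 
    (hf : ∀ z ∈ disc, |J.f z| ≤ ε) 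
    (h11 : ∀ z ∈ disc, |J.f11 z| ≤ D) (h12 : ∀ z ∈ disc, |J.f12 z| ≤ D) (h22 : ∀ z ∈ disc, |J.f22 z| ≤ D)
     (x : ℝ × ℝ) (hx : x ∈ disc) :
    |J.f1 x| ≤ 4 * ε + 6 * D ∧ |J.f2 x| ≤ 4 * ε + 6 * D := by
  have z0 : ((0, 0) : ℝ × ℝ) ∈ disc := by show en _ < 1; simp [en]
  have D0 : 0 ≤ D := (abs_nonneg _).trans (h11 _ z0)
  have hseg : ∀ y ∈ disc, ∀ s ∈ Icc (0:ℝ) 1, (((0,0) : ℝ × ℝ).1 + s * y.1, ((0,0) : ℝ × ℝ).2 + s * y.2) ∈ disc := by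
    intro y hy s hs
    have hy' : en y < 1 := hy
    show en _ < 1
    simp only [zero_add]
    rw [en_smul, abs_of_nonneg hs.1]
    nlinarith [en_nonneg y, hs.2]
  have hb : ∀ y ∈ disc, |y.1| ≤ 1 ∧ |y.2| ≤ 1 := fun y hy => by
    have hy' : en y < 1 := hy
    have := norm_le_en y
    exact ⟨by linarith [fst_le y], by linarith [snd_le y]⟩
  have bd : ∀ a b c d : ℝ, |a| ≤ D → |b| ≤ D → |c| ≤ 1 → |d| ≤ 1 → |a * c + b * d| ≤ 2 * D := by
    intro a b c d ha hb hc hd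
    refine (abs_add_le _ _).trans ?_
    rw [abs_mul, abs_mul]
    nlinarith [abs_nonneg a, abs_nonneg b, abs_nonneg c, abs_nonneg d]
  have g1 : ∀ y ∈ disc, |J.f1 y - J.f1 (0,0)| ≤ 2 * D := by
    intro y hy
    have := mvt (fun s => J.f1 (((0,0) : ℝ × ℝ).1 + s * y.1, ((0,0) : ℝ × ℝ).2 + s * y.2)) _ 1 (2 * D) zero_le_one
      (fun s hs => (hJ.d1 _ (hseg y hy s hs)).line) (fun s hs => by
        exact bd _ _ _ _ (h11 _ (hseg y hy s hs)) (h12 _ (hseg y hy s hs)) (hb y hy).1 (hb y hy).2)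
    simpa using this
  have g2 : ∀ y ∈ disc, |J.f2 y - J.f2 (0,0)| ≤ 2 * D := by
    intro y hy
    have := mvt (fun s => J.f2 (((0,0) : ℝ × ℝ).1 + s * y.1, ((0,0) : ℝ × ℝ).2 + s * y.2)) _ 1 (2 * D) zero_le_one
      (fun s hs => (hJ.d2 _ (hseg y hy s hs)).line) (fun s hs => by
        exact bd _ _ _ _ (h12 _ (hseg y hy s hs)) (h22 _ (hseg y hy s hs)) (hb y hy).1 (hb y hy).2)
    simpa using this
  have e1 : ((1/2, 0) : ℝ × ℝ) ∈ disc := by show en _ < 1; simp [en]; norm_num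
  have e2 : ((0, 1/2) : ℝ × ℝ) ∈ disc := by show en _ < 1; simp [en]; norm_num
  have k1 : |J.f1 (0,0)| ≤ 4 * ε + 4 * D := by
    have := mvt (fun s => J.f (((0,0) : ℝ × ℝ).1 + s * (1/2, (0:ℝ)).1, ((0,0) : ℝ × ℝ).2 + s * ((1/2 : ℝ), (0:ℝ)).2) - s * (J.f1 (0,0) * (1/2))) _ 1 D zero_le_one
      (fun s hs => ((hJ.d _ (hseg _ e1 s hs)).line).sub ((hasDerivAt_id s).mul_const _)) (fun s hs => by
        have := abs_le.1 (g1 _ (hseg _ e1 s hs))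
        simp only [mul_zero, add_zero, one_mul, zero_add] at this ⊢
        rw [abs_le]; constructor <;> linarith [this.1, this.2])
    simp only [zero_add, one_mul, zero_mul, mul_zero, sub_zero, mul_one] at this
    have a1 := abs_le.1 (hf _ e1)
    have a2 := abs_le.1 (hf _ z0)
    have this := abs_le.1 this
    rw [abs_le]; constructor <;> linarith [this.1, this.2, a1.1, a1.2, a2.1, a2.2]
  have k2 : |J.f2 (0,0)| ≤ 4 * ε + 4 * D := by
    have := mvt (fun s => J.f (((0,0) : ℝ × ℝ).1 + s * ((0:ℝ), (1/2:ℝ)).1, ((0,0) : ℝ × ℝ).2 + s * ((0 : ℝ), (1/2:ℝ)).2) - s * (J.f2 (0,0) * (1/2))) _ 1 D zero_le_one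
      (fun s hs => ((hJ.d _ (hseg _ e2 s hs)).line).sub ((hasDerivAt_id s).mul_const _)) (fun s hs => by
        have := abs_le.1 (g2 _ (hseg _ e2 s hs))
        simp only [mul_zero, add_zero, one_mul, zero_add] at this ⊢
        rw [abs_le]; constructor <;> linarith [this.1, this.2])
    simp only [zero_add, one_mul, zero_mul, mul_zero, sub_zero, mul_one] at this
    have a1 := abs_le.1 (hf _ e2)
    have a2 := abs_le.1 (hf _ z0)
    have this := abs_le.1 this
    rw [abs_le]; constructor <;> linarith [this.1, this.2, a1.1, a1.2, a2.1, a2.2]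
  have l1 := abs_le.1 (g1 x hx)
  have l2 := abs_le.1 (g2 x hx)
  rw [abs_le] at k1 k2
  refine ⟨abs_le.2 ⟨?_, ?_⟩, abs_le.2 ⟨?_, ?_⟩⟩ <;> linarith [k1.1, k1.2, k2.1, k2.2, l1.1, l1.2, l2.1, l2.2]

/-- existence of small parameters -/
lemma small_pow (α c : ℝ) (hα : 0 < α) (hc : 0 < c) (b : ℝ) (hb : 0 < b) : ∃ k, 0 < k ∧ k ≤ b ∧ k ^ α ≤ c := by
  refine ⟨min b (c ^ (1 / α)), lt_min hb (Real.rpow_pos_of_pos hc _), min_le_left _ _, ?_⟩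
  calc (min b (c ^ (1 / α))) ^ α ≤ (c ^ (1/α)) ^ α :=
        Real.rpow_le_rpow (lt_min hb (Real.rpow_pos_of_pos hc _)).le (min_le_right _ _) hα.le
    _ = c := by rw [← Real.rpow_mul hc.le]; field_simp; exact Real.rpow_one c

lemma interp (α δ : ℝ) (hα : 0 < α) (hα1 : α < 1) (hδ : 0 < δ) : ∃ ε0, 0 < ε0 ∧ ∀ J : Jet, J.On disc →
    J.Hold disc 1 α 2 → (∀ z ∈ disc, |J.f z| ≤ ε0) → ∀ x ∈ disc, |J.f11 x| ≤ δ ∧ |J.f12 x| ≤ δ ∧ |J.f22 x| ≤ δ ∧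
      |J.f1 x| ≤ δ ∧ |J.f2 x| ≤ δ := by
  obtain ⟨k, hk, hk8, hkα⟩ := small_pow α (δ / 200) hα (by positivity) (1/8) (by norm_num)
  refine ⟨δ / 200 * k ^ 2, by positivity, fun J hJ hH hf => ?_⟩
  have e : 8 * (δ / 200 * k ^ 2) / k ^ 2 = δ / 25 := by field_simp; norm_num
  have h := interp0 J α (δ / 200 * k ^ 2) k hα hα1 hJ hH (by positivity) hf hk hk8
  rw [e] at h
  have hk2 : k ^ 2 ≤ 1 := by nlinarith
  have h2 := grad0 J (δ / 200 * k ^ 2) (δ / 10) hJ hf (fun z hz => (h z hz).1.trans (by linarith))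
    (fun z hz => (h z hz).2.1.trans (by linarith)) (fun z hz => (h z hz).2.2.trans (by linarith))
  intro x hx
  have h3 := h x hx
  have h4 := h2 x hx
  have h5 : δ / 200 * k ^ 2 ≤ δ / 200 := by nlinarith
  refine ⟨by linarith [h3.1], by linarith [h3.2.1], by linarith [h3.2.2], by linarith [h4.1], by linarith [h4.2]⟩

end MC

namespace MC
open intervalIntegral MeasureTheory Filter Topology

lemma big_pow (e c b : ℝ) (he : 0 < e) (hc : 0 < c) : ∃ Λ, b ≤ Λ ∧ 1 ≤ Λ ∧ Λ ^ (-e) ≤ c := by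
  have h := tendsto_rpow_neg_atTop he
  have h2 := (h.eventually (eventually_le_nhds hc)).and ((eventually_ge_atTop b).and (eventually_ge_atTop 1))
  obtain ⟨Λ, h1, h2, h3⟩ := h2.exists
  exact ⟨Λ, h2, h3, h1⟩

lemma pl_norm (x : ℝ × ℝ) (r t : ℝ) (hr : 0 ≤ r) : ‖pl x r t - x‖ ≤ r := by
  refine nrm_le ?_ ?_
  · simp only [pl, Prod.fst_sub, add_sub_cancel_left, abs_mul, abs_of_nonneg hr]
    exact mul_le_of_le_one_right hr (abs_cos_le_one t)
  · simp only [pl, Prod.snd_sub, add_sub_cancel_left, abs_mul, abs_of_nonneg hr]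
    exact mul_le_of_le_one_right hr (abs_sin_le_one t)

lemma abs_sq_le {a b : ℝ} (hb : 0 ≤ b) (h : b ≤ |a|) : b ^ 2 ≤ a ^ 2 := by
  rw [← sq_abs a]; exact pow_le_pow_left₀ hb h 2

/-- mean value for increments -/
lemma incr (g g1 g2 : ℝ × ℝ → ℝ) (Ω : Set (ℝ × ℝ)) (hg : ∀ z ∈ Ω, HasG g (g1 z) (g2 z) z) (x z w : ℝ × ℝ) (c : ℝ)
    (hx : ∀ s ∈ Icc (0:ℝ) 1, (x.1 + s * w.1, x.2 + s * w.2) ∈ Ω)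
    (hz : ∀ s ∈ Icc (0:ℝ) 1, (z.1 + s * w.1, z.2 + s * w.2) ∈ Ω)
    (hc1 : ∀ s ∈ Icc (0:ℝ) 1, |g1 (z.1 + s * w.1, z.2 + s * w.2) - g1 (x.1 + s * w.1, x.2 + s * w.2)| ≤ c)
    (hc2 : ∀ s ∈ Icc (0:ℝ) 1, |g2 (z.1 + s * w.1, z.2 + s * w.2) - g2 (x.1 + s * w.1, x.2 + s * w.2)| ≤ c) :
    |(g (z.1 + w.1, z.2 + w.2) - g z) - (g (x.1 + w.1, x.2 + w.2) - g x)| ≤ 2 * c * ‖w‖ := by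
  have := mvt (fun s => g (z.1 + s * w.1, z.2 + s * w.2) - g (x.1 + s * w.1, x.2 + s * w.2)) _ 1 (2 * c * ‖w‖) zero_le_one
    (fun s hs => ((hg _ (hz s hs)).line).sub ((hg _ (hx s hs)).line)) (by
      intro s hs
      have e1 := hc1 s hs
      have e2 := hc2 s hs
      have w1 := fst_le w
      have w2 := snd_le w
      set a := g1 (z.1 + s * w.1, z.2 + s * w.2) 
      set b := g1 (x.1 + s * w.1, x.2 + s * w.2)
      set a' := g2 (z.1 + s * w.1, z.2 + s * w.2) 
      set b' := g2 (x.1 + s * w.1, x.2 + s * w.2)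
      have : a * w.1 + a' * w.2 - (b * w.1 + b' * w.2) = (a - b) * w.1 + (a' - b') * w.2 := by ring
      rw [this]
      refine (abs_add_le _ _).trans ?_
      rw [abs_mul, abs_mul]
      have i1 := mul_le_mul e1 w1 (abs_nonneg _) ((abs_nonneg _).trans e1)
      have i2 := mul_le_mul e2 w2 (abs_nonneg _) ((abs_nonneg _).trans e2)
      linarith)
  simp only [one_mul, zero_mul, add_zero, mul_one] at this
  rw [show (g (z.1 + w.1, z.2 + w.2) - g z) - (g (x.1 + w.1, x.2 + w.2) - g x) = g (z.1 + w.1, z.2 + w.2) - g (x.1 + w.1, x.2 + w.2) - (g z - g x) by ring]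
  exact this

lemma entry_low (h δ α : ℝ) (a a' b b' : ℝ) (hh : 0 ≤ h) (hδ : 0 < δ) (hb : δ * h ^ α < |b' - b|)
    (h1 : |a - b| ≤ δ / 4 * h ^ α) (h2 : |a' - b'| ≤ δ / 4 * h ^ α) : δ ^ 2 * (h ^ α) ^ 2 / 4 ≤ (a' - a) ^ 2 := by
  have hp : 0 ≤ h ^ α := Real.rpow_nonneg hh α
  have : δ / 2 * h ^ α ≤ |a' - a| := by
    have e : b' - b = (a' - a) - (a' - b') + (a - b) := by ring
    have i1 : |b' - b| ≤ |a' - a| + |a' - b'| + |a - b| := by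
      rw [e]
      refine (abs_add_le _ _).trans ?_
      gcongr
      exact abs_sub _ _
    nlinarith
  have := abs_sq_le (by positivity) this
  nlinarith

lemma interior (K α δ : ℝ) (hK : 1 ≤ K) (hα : 0 < α) (hαK : 2 * α < 1 / (4 * K)) (hδ : 0 < δ) :
    ∃ Λ, 1 ≤ Λ ∧ ∀ J : Jet, J.On disc →
      (∀ z ∈ disc, ∀ w ∈ disc, cone K 0 (J.f11 z - J.f11 w) (J.f12 z - J.f12 w) (J.f22 z - J.f22 w)) →
      J.Hold disc 1 α 2 → ∀ x w : ℝ × ℝ, en x + 4 * Λ * ‖w‖ < 1 →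
      |J.f11 (x + w) - J.f11 x| ≤ δ * ‖w‖ ^ α ∧ |J.f12 (x + w) - J.f12 x| ≤ δ * ‖w‖ ^ α ∧
      |J.f22 (x + w) - J.f22 x| ≤ δ * ‖w‖ ^ α := by
  obtain ⟨ε, hε, hε1, hε2⟩ := small_pow α (δ / 4) hα (by linarith) (1 / 2) (by norm_num)
  set β := 1 / (4 * K) with hβ
  have hβ0 : 0 < β := by positivity
  obtain ⟨Λ, hΛ1, _, hΛ⟩ := big_pow (β - 2 * α) (δ ^ 2 * ε ^ 2 / (128 * 49 * K ^ 2)) 1 (by linarith) (by positivity)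
  have hΛ0 : 0 < Λ := by linarith
  refine ⟨Λ, hΛ1, ?_⟩
  intro J hJ hcone hH x w hxw
  rcases eq_or_ne w 0 with rfl | hw
  · simp [Real.zero_rpow hα.ne']
  set h := ‖w‖ with hh
  have hh0 : 0 < h := norm_pos_iff.2 hw
  have hp : 0 < h ^ α := Real.rpow_pos_of_pos hh0 α
  set R := Λ * h with hR
  have hR0 : 0 < R := by positivity
  -- membership
  have mem : ∀ z : ℝ × ℝ, en z ≤ en x + R → ∀ s ∈ Icc (0:ℝ) 1, (z.1 + s * w.1, z.2 + s * w.2) ∈ disc := by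
    intro z hz s hs
    show en _ < 1
    have e1 : en (z + (s * w.1, s * w.2)) ≤ _ := en_add _ _
    rw [en_smul, abs_of_nonneg hs.1] at e1
    have e2 := en_le w
    have e3 : s * en w ≤ 1 * (2 * h) := mul_le_mul hs.2 e2 (en_nonneg _) (by norm_num)
    have : (z + (s * w.1, s * w.2)) = (z.1 + s * w.1, z.2 + s * w.2) := rfl
    rw [this] at e1
    nlinarith
  have enpl : ∀ r ∈ Icc 0 R, ∀ t, en (pl x r t) ≤ en x + R := by
    intro r hr t
    have e1 : en (x + (r * Real.cos t, r * Real.sin t)) ≤ _ := en_add _ _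
    have e2 := en_smul r (Real.cos t, Real.sin t)
    have e3 : en (Real.cos t, Real.sin t) = 1 := by simp [en]
    simp only [e3, abs_of_nonneg hr.1, mul_one] at e2
    have : pl x r t = (x + (r * Real.cos t, r * Real.sin t)) := rfl
    rw [this]; linarith [hr.2]
  set U : Set (ℝ × ℝ) := {z | z ∈ disc ∧ (z.1 + w.1, z.2 + w.2) ∈ disc} with hUdef
  have hU0 : ∀ z, en z ≤ en x + R → z ∈ U := by
    intro z hz
    refine ⟨?_, ?_⟩
    · simpa using mem z hz 0 ⟨le_rfl, zero_le_one⟩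
    · simpa using mem z hz 1 ⟨zero_le_one, le_rfl⟩
  have xU : x ∈ U := hU0 x (by linarith)
  have hU : ∀ r ∈ Icc 0 R, ∀ t ∈ Icc (0:ℝ) 7, pl x r t ∈ U := fun r hr t _ => hU0 _ (enpl r hr t)
  have c11 := hold_cont J.f11 disc 1 α 2 hα (by norm_num) hH.h11
  have c12 := hold_cont J.f12 disc 1 α 2 hα (by norm_num) hH.h12
  have c22 := hold_cont J.f22 disc 1 α 2 hα (by norm_num) hH.h22
  have cc : ∀ g : ℝ × ℝ → ℝ, ContinuousOn g disc → ContinuousOn (fun z : ℝ × ℝ => g (z.1 + w.1, z.2 + w.2) - g z) U := by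
    intro g hg
    refine ContinuousOn.sub ?_ (hg.mono fun z hz => hz.1)
    exact hg.comp (by fun_prop) (fun z hz => hz.2)
  have key := fun (m s : ℝ) hm hs hρR hG => polar U (fun z => J.f2 (z.1 + w.1, z.2 + w.2) - J.f2 z)
    (fun z => J.f12 (z.1 + w.1, z.2 + w.2) - J.f12 z) (fun z => J.f22 (z.1 + w.1, z.2 + w.2) - J.f22 z)
    (fun z => (J.f1 (z.1 + w.1, z.2 + w.2) - J.f1 z) - (J.f1 (x.1 + w.1, x.2 + w.2) - J.f1 x))
    (fun z => J.f11 (z.1 + w.1, z.2 + w.2) - J.f11 z) (fun z => J.f12 (z.1 + w.1, z.2 + w.2) - J.f12 z)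
    x R (2 * π) 7 K 0 (2 * R ^ α * h) 0 m s 0 0 hR0 (by linarith [pi_gt_three]) (by linarith [pi_lt_d2]) (by linarith [pi_lt_d2])
    (by linarith) le_rfl (by positivity) le_rfl hU (cc _ c12) (cc _ c22) (cc _ c11) (cc _ c12)
    (fun z hz => ((hJ.d2 _ hz.2).shift).sub (hJ.d2 _ hz.1))
    (fun z hz => by
      have := (((hJ.d1 _ hz.2).shift).sub (hJ.d1 _ hz.1)).sub (HasG.const (J.f1 (x.1 + w.1, x.2 + w.2) - J.f1 x) z)
      simpa using this)
    (by
      intro r hr t ht z hz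
      have hzU := hU0 z (hz ▸ enpl r hr t)
      have := hcone _ hzU.2 _ hzU.1
      unfold cone at this
      nlinarith only [this])
    (by
      intro r hr t ht
      refine incr J.f1 J.f11 J.f12 disc hJ.d1 x _ w (R ^ α) (mem x (by linarith)) (mem _ (enpl r hr t)) ?_ ?_
      all_goals
        intro s hs
        have m1 := mem x (by linarith) s hs
        have m2 := mem _ (enpl r hr t) s hs
        have nn : ‖((pl x r t).1 + s * w.1, (pl x r t).2 + s * w.2) - (x.1 + s * w.1, x.2 + s * w.2)‖ ≤ R := by
          have : ((pl x r t).1 + s * w.1, (pl x r t).2 + s * w.2) - (x.1 + s * w.1, x.2 + s * w.2) = pl x r t - x := by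
            ext <;> simp
          rw [this]; exact (pl_norm x r t hr.1).trans hr.2
        have nn2 := Real.rpow_le_rpow (norm_nonneg _) nn hα.le
      · have := hH.h11 _ m2 _ m1 (disc_norm m2 m1)
        linarith
      · have := hH.h12 _ m2 _ m1 (disc_norm m2 m1)
        linarith)
    (by intro r hr; simp [pl])
    (by intro r hr; simp [pl])
    hm hs le_rfl ⟨le_rfl, by linarith [pi_pos]⟩ hρR hG
  by_contra hcon
  have hc : δ * h ^ α < |J.f11 (x + w) - J.f11 x| ∨ δ * h ^ α < |J.f12 (x + w) - J.f12 x| ∨ δ * h ^ α < |J.f22 (x + w) - J.f22 x| := by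
    by_contra h'
    push Not at h'
    exact hcon ⟨h'.1, h'.2.1, h'.2.2⟩
  have := key (δ ^ 2 * (h ^ α) ^ 2 / 4) (ε * h) (by positivity) (by positivity) (by nlinarith) (by
    intro r hr t ht z hz h1 h2
    have hzU := hU0 z (hz ▸ enpl r hr t)
    have px : pl x 0 0 = x := by simp [pl]
    rw [px] at h1 h2
    have n1 : ‖z - x‖ ≤ ε * h := nrm_le h1 h2
    have n2 : ‖(z.1 + w.1, z.2 + w.2) - (x.1 + w.1, x.2 + w.2)‖ ≤ ε * h := by
      have : (z.1 + w.1, z.2 + w.2) - (x.1 + w.1, x.2 + w.2) = z - x := by ext <;> simp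
      rwa [this]
    have bd : ∀ y : ℝ × ℝ, ‖y‖ ≤ ε * h → ‖y‖ ^ α ≤ δ / 4 * h ^ α := by
      intro y hy
      refine (Real.rpow_le_rpow (norm_nonneg _) hy hα.le).trans ?_
      rw [Real.mul_rpow hε.le hh0.le]
      gcongr
    have b1 := bd _ n1
    have b2 := bd _ n2
    have xw : x + w = (x.1 + w.1, x.2 + w.2) := rfl
    rw [xw] at hc
    have d1 := disc_norm hzU.1 xU.1
    have d2 := disc_norm hzU.2 xU.2
    show δ ^ 2 * (h ^ α) ^ 2 / 4 ≤ (J.f12 (z.1 + w.1, z.2 + w.2) - J.f12 z) ^ 2 + (J.f22 (z.1 + w.1, z.2 + w.2) - J.f22 z) ^ 2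
      + (J.f11 (z.1 + w.1, z.2 + w.2) - J.f11 z) ^ 2 + (J.f12 (z.1 + w.1, z.2 + w.2) - J.f12 z) ^ 2
    have s11 := sq_nonneg (J.f11 (z.1 + w.1, z.2 + w.2) - J.f11 z)
    have s12 := sq_nonneg (J.f12 (z.1 + w.1, z.2 + w.2) - J.f12 z)
    have s22 := sq_nonneg (J.f22 (z.1 + w.1, z.2 + w.2) - J.f22 z)
    rcases hc with hc | hc | hc
    · have := entry_low h δ α _ _ _ _ hh0.le hδ hc ((hH.h11 _ hzU.1 _ xU.1 d1).trans (by linarith)) ((hH.h11 _ hzU.2 _ xU.2 d2).trans (by linarith))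
      linarith
    · have := entry_low h δ α _ _ _ _ hh0.le hδ hc ((hH.h12 _ hzU.1 _ xU.1 d1).trans (by linarith)) ((hH.h12 _ hzU.2 _ xU.2 d2).trans (by linarith))
      linarith
    · have := entry_low h δ α _ _ _ _ hh0.le hδ hc ((hH.h22 _ hzU.1 _ xU.1 d1).trans (by linarith)) ((hH.h22 _ hzU.2 _ xU.2 d2).trans (by linarith))
      linarith)
  have e1 : (2 * (0 + ε * h) / R) ^ β ≤ Λ ^ (-β) := by
    rw [Real.rpow_neg hΛ0.le, ← Real.inv_rpow hΛ0.le]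
    refine Real.rpow_le_rpow (by positivity) ?_ hβ0.le
    rw [hR, div_le_iff₀ (by positivity)]
    have : Λ⁻¹ * (Λ * h) = h := by field_simp
    rw [this]; nlinarith
  have e2 : R ^ α = Λ ^ α * h ^ α := Real.mul_rpow hΛ0.le hh0.le
  have e3 : Λ ^ (-β) * (Λ ^ α) ^ 2 = Λ ^ (-(β - 2 * α)) := by
    rw [sq, ← Real.rpow_add hΛ0, ← Real.rpow_add hΛ0]; congr 1; ring
  have e4 : (2 * (0 + ε * h) / R) ^ β * (12 * K ^ 2 * (2 * R ^ α * h) ^ 2) ≤ Λ ^ (-β) * (12 * K ^ 2 * (2 * R ^ α * h) ^ 2) := by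
    gcongr
  have e5 : Λ ^ (-β) * (12 * K ^ 2 * (2 * R ^ α * h) ^ 2) = 48 * K ^ 2 * (h ^ α) ^ 2 * h ^ 2 * Λ ^ (-(β - 2 * α)) := by
    rw [e2, ← e3]; ring
  have e6 : 48 * K ^ 2 * (h ^ α) ^ 2 * h ^ 2 * Λ ^ (-(β - 2 * α)) ≤ 48 * K ^ 2 * (h ^ α) ^ 2 * h ^ 2 * (δ ^ 2 * ε ^ 2 / (128 * 49 * K ^ 2)) := by
    gcongr
  have e7 : 48 * K ^ 2 * (h ^ α) ^ 2 * h ^ 2 * (δ ^ 2 * ε ^ 2 / (128 * 49 * K ^ 2)) = (48 / 49) * (δ ^ 2 * (h ^ α) ^ 2 / 4 * (ε * h) ^ 2 / 32) := by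
    field_simp; ring
  have e8 : 0 < δ ^ 2 * (h ^ α) ^ 2 / 4 * (ε * h) ^ 2 / 32 := by positivity
  linarith

end MC

namespace MC
open intervalIntegral MeasureTheory Filter Topology

def up : Set (ℝ × ℝ) := {z | 0 < z.2}

structure HP (J : Jet) (γ γ1 γ2 : ℝ → ℝ) (K C α ε0 : ℝ) : Prop where
  on : J.On up
  hold : J.Hold up C α 1
  cone : ∀ z ∈ up, ∀ w ∈ up, ‖z - w‖ ≤ 1 →
    cone K (C ^ 2 * ‖z - w‖ ^ 2) (J.f11 z - J.f11 w) (J.f12 z - J.f12 w) (J.f22 z - J.f22 w)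
  bd : ∀ θ, Tendsto (fun y => J.f (θ, y)) (𝓝[>] 0) (𝓝 (γ θ))
  g1 : ∀ θ, HasDerivAt γ (γ1 θ) θ
  g2 : ∀ θ, HasDerivAt γ1 (γ2 θ) θ
  gh : ∀ s t, |γ2 s - γ2 t| ≤ ε0 * |s - t| ^ α

lemma nrm_h (a b y : ℝ) : ‖((a, y) : ℝ × ℝ) - (b, y)‖ = |a - b| := by
  simp [Prod.norm_def]

lemma nrm_v (x a b : ℝ) : ‖((x, a) : ℝ × ℝ) - (x, b)‖ = |a - b| := by
  simp [Prod.norm_def]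

lemma HP.f11_bd {J : Jet} {γ γ1 γ2 : ℝ → ℝ} {K C α ε0 : ℝ} (h : HP J γ γ1 γ2 K C α ε0) (hα : 0 < α)
    (hC : 0 ≤ C) (h0 : 0 ≤ ε0) (hε : ε0 ≤ C) (θ y : ℝ) (hy : 0 < y) (hy1 : y ≤ 1) : |J.f11 (θ, y) - γ2 θ| ≤ 5 * C * y ^ α := by
  have hp : 0 < y ^ α := Real.rpow_pos_of_pos hy α
  have A : ∀ y' ∈ Ioo 0 y, |J.f (θ + y, y') + J.f (θ - y, y') - 2 * J.f (θ, y') - y ^ 2 * J.f11 (θ, y)| ≤ 3 * C * y ^ α * y ^ 2 := by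
    intro y' hy'
    have i1 := h.on.sd (θ, y') (1, 0) y (C * y ^ α) hy.le (by
      intro s hs; simpa [up] using hy'.1) (by
      intro s hs
      simp only [Jet.qd, mul_one, mul_zero, add_zero]
      have := h.hold.h11 (θ + s, y') hy'.1 (θ, y') hy'.1 (by
        rw [nrm_h, add_sub_cancel_left, abs_le]; exact ⟨by linarith [hs.1], by linarith [hs.2]⟩)
      rw [nrm_h, add_sub_cancel_left] at this
      have i : |s| ^ α ≤ y ^ α := Real.rpow_le_rpow (abs_nonneg _) (abs_le.2 ⟨hs.1, hs.2⟩) hα.le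
      have j := mul_le_mul_of_nonneg_left i hC
      simp only [one_pow, one_mul, ne_eq, OfNat.ofNat_ne_zero, not_false_eq_true, zero_pow, zero_mul, add_zero]
      linarith)
    simp only [Jet.qd, mul_one, mul_zero, add_zero, sub_zero, one_pow, one_mul, ne_eq, OfNat.ofNat_ne_zero, not_false_eq_true, zero_pow, zero_mul] at i1
    have i2 := h.hold.h11 (θ, y') hy'.1 (θ, y) hy (by
      rw [nrm_v, abs_le]; exact ⟨by linarith [hy'.1], by linarith [hy'.2]⟩)
    rw [nrm_v] at i2
    have i : |y' - y| ^ α ≤ y ^ α := Real.rpow_le_rpow (abs_nonneg _) (abs_le.2 ⟨by linarith [hy'.1], by linarith [hy'.2]⟩) hα.le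
    have j := mul_le_mul_of_nonneg_left i hC
    have e : J.f (θ + y, y') + J.f (θ - y, y') - 2 * J.f (θ, y') - y ^ 2 * J.f11 (θ, y) =
      (J.f (θ + y, y') + J.f (θ - y, y') - 2 * J.f (θ, y') - y ^ 2 * J.f11 (θ, y')) + y ^ 2 * (J.f11 (θ, y') - J.f11 (θ, y)) := by ring
    rw [e]
    refine (abs_add_le _ _).trans ?_
    rw [abs_mul, abs_of_nonneg (sq_nonneg y)]
    have k := mul_le_mul_of_nonneg_left (i2.trans j) (sq_nonneg y)
    nlinarith only [k, i1]
  have B : |γ (θ + y) + γ (θ - y) - 2 * γ θ - y ^ 2 * J.f11 (θ, y)| ≤ 3 * C * y ^ α * y ^ 2 := by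
    have t := ((((h.bd (θ + y)).add (h.bd (θ - y))).sub ((h.bd θ).const_mul 2)).sub_const (y ^ 2 * J.f11 (θ, y))).abs
    refine le_of_tendsto t ?_
    filter_upwards [Ioo_mem_nhdsGT hy] with y' hy'
    exact A y' hy'
  have D := sd1 (fun s => γ (θ + s)) (fun s => γ1 (θ + s)) (fun s => γ2 (θ + s)) y (C * y ^ α) hy.le
    (fun s _ => (h.g1 (θ + s)).comp_const_add θ s) (fun s _ => (h.g2 (θ + s)).comp_const_add θ s) (by
      intro s hs
      have := h.gh (θ + s) (θ + 0)
      rw [add_sub_add_left_eq_sub, sub_zero] at this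
      have i : |s| ^ α ≤ y ^ α := Real.rpow_le_rpow (abs_nonneg _) (abs_le.2 ⟨hs.1, hs.2⟩) hα.le
      refine this.trans (mul_le_mul hε i (by positivity) hC))
  simp only [add_zero, ← sub_eq_add_neg] at D
  have e : y ^ 2 * (J.f11 (θ, y) - γ2 θ) = (γ (θ + y) + γ (θ - y) - 2 * γ θ - y ^ 2 * γ2 θ) - (γ (θ + y) + γ (θ - y) - 2 * γ θ - y ^ 2 * J.f11 (θ, y)) := by ring
  have f := abs_sub (γ (θ + y) + γ (θ - y) - 2 * γ θ - y ^ 2 * γ2 θ) (γ (θ + y) + γ (θ - y) - 2 * γ θ - y ^ 2 * J.f11 (θ, y))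
  rw [← e, abs_mul, abs_of_nonneg (sq_nonneg y)] at f
  have y2 : 0 < y ^ 2 := by positivity
  refine le_of_mul_le_mul_left ?_ y2
  nlinarith only [f, D, B]

lemma HP.q_bd {J : Jet} {γ γ1 γ2 : ℝ → ℝ} {K C α ε0 : ℝ} (h : HP J γ γ1 γ2 K C α ε0) (hα : 0 < α)
    (hC : 0 ≤ C) (h0 : 0 ≤ ε0) (hε : ε0 ≤ C) (τ : ℝ) (hτ : 0 ≤ τ) (θ y : ℝ) (hy : 0 < y) (hy1 : y ≤ 1) :
    |(J.f1 (θ + τ, y) - J.f1 (θ, y)) - (γ1 (θ + τ) - γ1 θ)| ≤ 5 * C * y ^ α * τ := by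
  have := mvt (fun s => J.f1 (θ + s, y) - γ1 (θ + s)) (fun s => J.f11 (θ + s, y) - γ2 (θ + s)) τ (5 * C * y ^ α) hτ (by
    intro s hs
    refine HasDerivAt.sub ?_ ((h.g2 (θ + s)).comp_const_add θ s)
    have := (h.on.d1 (θ + s, y) hy).curve (c := fun s => θ + s) (d := fun _ => y) ((hasDerivAt_id s).const_add θ) (hasDerivAt_const s y) rfl
    simpa using this) (fun s _ => h.f11_bd hα hC h0 hε (θ + s) y hy hy1)
  simp only [add_zero] at this
  rw [show (J.f1 (θ + τ, y) - J.f1 (θ, y)) - (γ1 (θ + τ) - γ1 θ) = J.f1 (θ + τ, y) - γ1 (θ + τ) - (J.f1 (θ, y) - γ1 θ) by ring]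
  exact this

end MC

namespace MC
open intervalIntegral MeasureTheory Filter Topology

lemma sin_low {t κ : ℝ} (h0 : 0 ≤ t) (ht : t ≤ π + κ) (hκ : 0 ≤ κ) : -κ ≤ Real.sin t := by
  rcases le_total t π with h | h
  · linarith [sin_nonneg_of_nonneg_of_le_pi h0 h]
  · have := sin_lip t π
    rw [sin_pi, sub_zero, abs_of_nonneg (by linarith : 0 ≤ t - π)] at this
    linarith [neg_abs_le (Real.sin t)]

set_option maxHeartbeats 2000000 in
lemma HP.core {J : Jet} {γ γ1 γ2 : ℝ → ℝ} {K C α ε0 : ℝ} (h : HP J γ γ1 γ2 K C α ε0) (hα : 0 < α)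
    (hK : 1 ≤ K) (hC : 1 ≤ C) (h0 : 0 < ε0) (hε : ε0 ≤ C) (δ L0 e Λ τ θ y : ℝ) (hδ : 0 < δ)
    (he : 0 < e) (he1 : e ≤ 1) (he2 : C * e ^ α ≤ δ / 8) (hεδ : ε0 ≤ δ / 4) (hL0 : 1 ≤ L0) (hΛ : 2 * (L0 + 1) ≤ Λ)
    (hτ : 0 < τ) (hτΛ : 2 * (Λ * τ) ≤ 1) (hy : 0 < y) (hy2 : y ≤ L0 * τ)
    (hcon : δ * τ ^ α < |J.f11 (θ + τ, y) - J.f11 (θ, y)| ∨ δ * τ ^ α < |J.f12 (θ + τ, y) - J.f12 (θ, y)| ∨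
      δ * τ ^ α < |J.f22 (θ + τ, y) - J.f22 (θ, y)|) :
    δ ^ 2 * (τ ^ α) ^ 2 / 4 * (e * τ) ^ 2 / 32 ≤ (1 / 4) * (δ ^ 2 * (τ ^ α) ^ 2 / 4 * (e * τ) ^ 2 / 32) +
      7 * (4 * (C ^ 2 * τ ^ 2) + 100 * K ^ 2 * (ε0 * τ ^ α) ^ 2) * (Λ * τ) ^ 2 +
      (2 * (L0 + 1) / Λ) ^ (1 / (4 * (4 * K))) * (12 * (4 * K) ^ 2 * (5 * C * (2 * (Λ * τ)) ^ α * τ) ^ 2) := by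
  have hp : 0 < τ ^ α := Real.rpow_pos_of_pos hτ α
  set R := Λ * τ with hR
  have hΛ0 : 4 ≤ Λ := by linarith
  have hR0 : 0 < R := by positivity
  have hRτ : 4 * τ ≤ R := by nlinarith
  have hτ1 : τ ≤ 1 := by linarith
  set X := δ ^ 2 * (τ ^ α) ^ 2 / 4 * (e * τ) ^ 2 / 32 with hX
  have hX0 : 0 < X := by positivity
  obtain ⟨ε, hε0, hεy, hεp⟩ := small_pow α (X / (320 * K * C ^ 2)) hα (by positivity) y hy
  have hyR : y ≤ R / 2 := by nlinarith
  have hCp : 0 < C := by linarith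
  set η := 10 * C ^ 2 * ε ^ α with hη
  have hεα : 0 < ε ^ α := Real.rpow_pos_of_pos hε0 α
  have hηX : 2 * (4 * K) * η ≤ (1 / 4) * X := by
    have : 2 * (4 * K) * η ≤ 2 * (4 * K) * (10 * C ^ 2 * (X / (320 * K * C ^ 2))) := by rw [hη]; gcongr
    refine this.trans (le_of_eq ?_)
    field_simp; ring
  set κ := ε / (2 * R) with hκ
  have hκ0 : 0 < κ := by positivity
  have hκR : κ * R = ε / 2 := by rw [hκ]; field_simp
  have hκ1 : κ ≤ 1 / 2 := by
    rw [hκ, div_le_iff₀ (by positivity)]; linarith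
  have memU : ∀ r ∈ Icc 0 R, ∀ t ∈ Icc 0 (π + κ), pl (θ, ε) r t ∈ up := by
    intro r hr t ht
    show 0 < ε + r * Real.sin t
    have := sin_low ht.1 ht.2 hκ0.le
    have h1 : r * (-κ) ≤ r * Real.sin t := mul_le_mul_of_nonneg_left this hr.1
    have h2 : r * κ ≤ R * κ := mul_le_mul_of_nonneg_right hr.2 hκ0.le
    nlinarith
  have sub : ∀ t ∈ Icc 0 π, t ∈ Icc 0 (π + κ) := fun t ht => ⟨ht.1, by linarith [ht.2]⟩
  have c11 := hold_cont J.f11 up C α 1 hα (by norm_num) h.hold.h11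
  have c12 := hold_cont J.f12 up C α 1 hα (by norm_num) h.hold.h12
  have c22 := hold_cont J.f22 up C α 1 hα (by norm_num) h.hold.h22
  have sh : ∀ z ∈ up, (z.1 + τ, z.2 + 0) ∈ up := by
    intro z hz
    have hz : 0 < z.2 := hz
    simpa [up] using hz
  have cc : ∀ g : ℝ × ℝ → ℝ, ContinuousOn g up → ContinuousOn (fun z : ℝ × ℝ => g (z.1 + τ, z.2 + 0) - g z) up := by
    intro g hg
    refine ContinuousOn.sub ?_ hg
    exact hg.comp (by fun_prop) sh
  have γc : Continuous γ2 := by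
    have := hold_cont (fun z => γ2 z.1) univ ε0 α 1 hα one_pos (by
      intro z _ w _ _
      refine (h.gh _ _).trans ?_
      have : |z.1 - w.1| ≤ ‖z - w‖ := fst_le (z - w)
      gcongr)
    rw [continuousOn_univ] at this
    exact this.comp (by fun_prop : Continuous (fun t : ℝ => (t, (0:ℝ))))
  have τn : ∀ z : ℝ × ℝ, ‖((z.1 + τ, z.2 + 0) : ℝ × ℝ) - z‖ = τ := by
    intro z
    have : ((z.1 + τ, z.2 + 0) : ℝ × ℝ) - z = (τ, 0) := by ext <;> simp
    rw [this]; simp [Prod.norm_def, hτ.le, abs_of_nonneg]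
  have qbd : ∀ z ∈ up, z.2 ≤ 1 → |(J.f1 (z.1 + τ, z.2 + 0) - J.f1 z) - (γ1 (z.1 + τ) - γ1 z.1)| ≤ 5 * C * z.2 ^ α * τ := by
    intro z hz hz1
    have := h.q_bd hα hCp.le h0.le hε τ hτ.le z.1 z.2 hz hz1
    simpa using this
  have p1bd : ∀ z ∈ up, |J.f12 (z.1 + τ, z.2 + 0) - J.f12 z| ≤ C := by
    intro z hz
    have := h.hold.h12 _ (sh z hz) z hz (by rw [τn]; exact hτ1)
    rw [τn] at this
    refine this.trans (mul_le_of_le_one_right hCp.le (Real.rpow_le_one hτ.le hτ1 hα.le))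
  have ed0 : ∀ r ∈ Icc 0 R, ∀ x, x = (θ + r, ε) ∨ x = (θ - r, ε) → |(J.f1 (x.1 + τ, x.2 + 0) - J.f1 x) - (γ1 (x.1 + τ) - γ1 x.1)| ≤ 5 * C * ε ^ α * τ := by
    intro r hr x hx
    rcases hx with rfl | rfl
    · exact qbd _ hε0 (by simp only; linarith)
    · exact qbd _ hε0 (by simp only; linarith)
  have pl0 : ∀ r, pl (θ, ε) r 0 = (θ + r, ε) := by intro r; simp [pl]
  have plπ : ∀ r, pl (θ, ε) r π = (θ - r, ε) := by intro r; simp [pl, sub_eq_add_neg]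
  have plp : pl (θ, ε) (y - ε) (π / 2) = (θ, y) := by simp [pl]
  have key := polar up (fun z => J.f2 (z.1 + τ, z.2 + 0) - J.f2 z)
    (fun z => J.f12 (z.1 + τ, z.2 + 0) - J.f12 z) (fun z => J.f22 (z.1 + τ, z.2 + 0) - J.f22 z)
    (fun z => (J.f1 (z.1 + τ, z.2 + 0) - J.f1 z) - (γ1 (z.1 + τ) - γ1 z.1))
    (fun z => (J.f11 (z.1 + τ, z.2 + 0) - J.f11 z) - (γ2 (z.1 + τ) - γ2 z.1)) (fun z => J.f12 (z.1 + τ, z.2 + 0) - J.f12 z)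
    (θ, ε) R π (π + κ) (4 * K) (4 * (C ^ 2 * τ ^ 2) + 100 * K ^ 2 * (ε0 * τ ^ α) ^ 2) (5 * C * (2 * R) ^ α * τ) η
    (δ ^ 2 * (τ ^ α) ^ 2 / 4) (e * τ) (y - ε) (π / 2)
    hR0 (by linarith [pi_gt_three]) (by linarith [pi_lt_d2]) (by linarith)
    (by linarith) (by positivity) (by positivity) (by positivity) memU (cc _ c12) (cc _ c22) 
    ((cc _ c11).sub (by fun_prop)) (cc _ c12)
    (fun z hz => ((h.on.d2 _ (sh z hz)).shift).sub (h.on.d2 _ hz))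
    (fun z hz => by
      have a1 := (((h.on.d1 _ (sh z hz)).shift).sub (h.on.d1 _ hz))
      have a2 := (HasG.ofFst (f := fun s => γ1 (s + τ)) (z := z) ((h.g2 (z.1 + τ)).comp_add_const z.1 τ)).sub (HasG.ofFst (z := z) (h.g2 z.1))
      simpa using a1.sub a2)
    (by
      intro r hr t ht z hz
      have hzU : z ∈ up := hz ▸ memU r hr t (sub t ht)
      have c0 := h.cone _ (sh z hzU) _ hzU (by rw [τn]; exact hτ1)
      rw [τn] at c0
      have gg := h.gh (z.1 + τ) z.1
      rw [add_sub_cancel_left, abs_of_nonneg hτ.le] at gg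
      have := conePert K _ _ _ _ ((J.f11 (z.1 + τ, z.2 + 0) - J.f11 z) - (γ2 (z.1 + τ) - γ2 z.1)) (J.f12 (z.1 + τ, z.2 + 0) - J.f12 z)
        (J.f22 (z.1 + τ, z.2 + 0) - J.f22 z) (ε0 * τ ^ α) hK c0 (by
          rw [sub_sub_cancel_left, abs_neg]; exact gg) (by simp; positivity) (by simp; positivity)
      unfold MC.cone at this
      nlinarith only [this])
    (by
      intro r hr t ht
      have hzU := memU r hr t (sub t ht)
      have b1 : (pl (θ, ε) r t).2 ≤ 2 * R := by
        show ε + r * Real.sin t ≤ 2 * R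
        have : r * Real.sin t ≤ R * 1 := mul_le_mul hr.2 (sin_le_one t) (sin_nonneg_of_nonneg_of_le_pi ht.1 ht.2) hR0.le
        linarith
      refine (qbd _ hzU (b1.trans hτΛ)).trans ?_
      have hzU' : 0 < (pl (θ, ε) r t).2 := hzU
      gcongr)
    (by
      intro r hr
      have q0 := ed0 r hr (θ + r, ε) (Or.inl rfl)
      rw [pl0, plπ, abs_mul]
      have m1 : (θ - r, ε) ∈ up := hε0
      have m2 : (θ + r, ε) ∈ up := hε0
      have i := incr J.f2 J.f12 J.f22 up h.on.d2 (θ + r, ε) (θ - r, ε) (τ, 0) C (by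
        intro s hs; simpa [up] using hε0) (by
        intro s hs; simpa [up] using hε0) (by
        intro s hs
        have nn : ‖((θ - r, ε).1 + s * (τ, (0:ℝ)).1, (θ - r, ε).2 + s * (τ, (0:ℝ)).2) - ((θ + r, ε).1 + s * (τ, (0:ℝ)).1, (θ + r, ε).2 + s * (τ, (0:ℝ)).2)‖ ≤ 1 := by
          rw [nrm_h]; simp only
          rw [abs_le]; constructor <;> linarith [hr.1, hr.2]
        refine (h.hold.h12 _ (by simpa [up] using hε0) _ (by simpa [up] using hε0) nn).trans ?_
        exact mul_le_of_le_one_right hCp.le (Real.rpow_le_one (norm_nonneg _) nn hα.le)) (by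
        intro s hs
        have nn : ‖((θ - r, ε).1 + s * (τ, (0:ℝ)).1, (θ - r, ε).2 + s * (τ, (0:ℝ)).2) - ((θ + r, ε).1 + s * (τ, (0:ℝ)).1, (θ + r, ε).2 + s * (τ, (0:ℝ)).2)‖ ≤ 1 := by
          rw [nrm_h]; simp only
          rw [abs_le]; constructor <;> linarith [hr.1, hr.2]
        refine (h.hold.h22 _ (by simpa [up] using hε0) _ (by simpa [up] using hε0) nn).trans ?_
        exact mul_le_of_le_one_right hCp.le (Real.rpow_le_one (norm_nonneg _) nn hα.le))
      have nτ : ‖((τ, 0) : ℝ × ℝ)‖ = τ := by simp [Prod.norm_def, abs_of_nonneg, hτ.le]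
      rw [nτ] at i
      have := mul_le_mul q0 i (abs_nonneg _) (by positivity)
      refine this.trans ?_
      have : 5 * C * ε ^ α * τ * (2 * C * τ) = η * (τ * τ) := by rw [hη]; ring
      rw [this]
      exact mul_le_of_le_one_right (by positivity) (by nlinarith))
    (by
      intro r hr
      have q0 := ed0 r hr (θ + r, ε) (Or.inl rfl)
      have q1 := ed0 r hr (θ - r, ε) (Or.inr rfl)
      rw [pl0, plπ]
      have m1 := p1bd (θ - r, ε) hε0
      have m2 := p1bd (θ + r, ε) hε0
      have a0 := mul_le_mul q0 m2 (abs_nonneg _) (by positivity)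
      have a1 := mul_le_mul q1 m1 (abs_nonneg _) (by positivity)
      rw [← abs_mul] at a0 a1
      simp only [cos_pi, sin_pi, cos_zero, sin_zero, mul_neg, mul_one, mul_zero, add_zero] at a0 a1 ⊢
      rw [← abs_neg] at a1
      refine (mul_le_mul ((abs_sub _ _).trans (add_le_add a1 a0)) (by linarith : R ≤ 1) hR0.le (by positivity)).trans ?_
      have : (5 * C * ε ^ α * τ * C + 5 * C * ε ^ α * τ * C) * 1 = η * τ := by rw [hη]; ring
      rw [this]
      exact mul_le_of_le_one_right (by positivity) hτ1)
    (by positivity) (by positivity) (by linarith) ⟨by linarith [pi_pos], by linarith [pi_pos]⟩ (by nlinarith)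
    (by
      intro r hr t ht z hz h1 h2
      have hzU : z ∈ up := hz ▸ memU r hr t (sub t ht)
      rw [plp] at h1 h2
      have yU : (θ, y) ∈ up := hy
      have n1 : ‖z - (θ, y)‖ ≤ e * τ := nrm_le h1 h2
      have n2 : ‖(z.1 + τ, z.2 + 0) - (θ + τ, y)‖ ≤ e * τ := by
        have : ((z.1 + τ, z.2 + 0) : ℝ × ℝ) - (θ + τ, y) = z - (θ, y) := by ext <;> simp
        rwa [this]
      have eτ : e * τ ≤ 1 := by nlinarith
      have bd : ∀ y : ℝ × ℝ, ‖y‖ ≤ e * τ → C * ‖y‖ ^ α ≤ δ / 8 * τ ^ α := by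
        intro y hy
        have := (Real.rpow_le_rpow (norm_nonneg _) hy hα.le)
        rw [Real.mul_rpow he.le hτ.le] at this
        have := mul_le_mul_of_nonneg_left this hCp.le
        have := mul_le_mul_of_nonneg_right he2 hp.le
        linarith
      have b1 := bd _ n1
      have b2 := bd _ n2
      have yU2 : (θ + τ, y) ∈ up := hy
      have s11 := sq_nonneg ((J.f11 (z.1 + τ, z.2 + 0) - J.f11 z) - (γ2 (z.1 + τ) - γ2 z.1))
      have s12 := sq_nonneg (J.f12 (z.1 + τ, z.2 + 0) - J.f12 z)
      have s22 := sq_nonneg (J.f22 (z.1 + τ, z.2 + 0) - J.f22 z)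
      have gg := h.gh (z.1 + τ) z.1
      rw [add_sub_cancel_left, abs_of_nonneg hτ.le] at gg
      have gg2 : ε0 * τ ^ α ≤ δ / 4 * τ ^ α := by gcongr
      have pos : 0 ≤ δ * τ ^ α := by positivity
      rcases hcon with hc | hc | hc
      · have i1 := (h.hold.h11 _ hzU _ yU (n1.trans eτ)).trans b1
        have i2 := (h.hold.h11 _ (sh z hzU) _ yU2 (n2.trans eτ)).trans b2
        have : δ ^ 2 * (τ ^ α) ^ 2 / 4 ≤ ((J.f11 (z.1 + τ, z.2 + 0) - J.f11 z) - (γ2 (z.1 + τ) - γ2 z.1)) ^ 2 := by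
          have lo : δ / 2 * τ ^ α ≤ |(J.f11 (z.1 + τ, z.2 + 0) - J.f11 z) - (γ2 (z.1 + τ) - γ2 z.1)| := by
            rw [abs_le] at i1 i2 gg
            rcases lt_abs.1 hc with hc | hc
            · refine le_trans ?_ (le_abs_self _); linarith
            · refine le_trans ?_ (neg_le_abs _); linarith
          have := abs_sq_le (by positivity) lo
          nlinarith only [this]
        linarith
      · have := entry_low τ δ α _ _ _ _ hτ.le hδ hc ((h.hold.h12 _ hzU _ yU (n1.trans eτ)).trans (by linarith)) ((h.hold.h12 _ (sh z hzU) _ yU2 (n2.trans eτ)).trans (by linarith))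
        linarith
      · have := entry_low τ δ α _ _ _ _ hτ.le hδ hc ((h.hold.h22 _ hzU _ yU (n1.trans eτ)).trans (by linarith)) ((h.hold.h22 _ (sh z hzU) _ yU2 (n2.trans eτ)).trans (by linarith))
        linarith)
  have e1 : (2 * (y - ε + e * τ) / R) ^ (1 / (4 * (4 * K))) ≤ (2 * (L0 + 1) / Λ) ^ (1 / (4 * (4 * K))) := by
    refine Real.rpow_le_rpow (div_nonneg (by nlinarith) hR0.le) ?_ (by positivity)
    rw [hR, div_le_div_iff₀ (by positivity) (by positivity)]
    have : y - ε + e * τ ≤ (L0 + 1) * τ := by nlinarith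
    have := mul_le_mul_of_nonneg_right this (by linarith : 0 ≤ Λ)
    linarith
  have e2 := mul_le_mul_of_nonneg_right e1 (by positivity : 0 ≤ 12 * (4 * K) ^ 2 * (5 * C * (2 * R) ^ α * τ) ^ 2)
  linarith

end MC

namespace MC
open intervalIntegral MeasureTheory Filter Topology

set_option maxHeartbeats 1000000 in
lemma HP.lemB (K C α δ L0 : ℝ) (hα : 0 < α) (hαK : 2 * α < 1 / (16 * K)) 
    (hK : 1 ≤ K) (hC : 1 ≤ C) (hδ : 0 < δ) (hL0 : 1 ≤ L0) : ∃ ρ0 ε1, 0 < ρ0 ∧ ρ0 ≤ 1 ∧ 0 < ε1 ∧ ∀ ε0, 0 < ε0 → ε0 ≤ ε1 → 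
      ∀ (J : Jet) (γ γ1 γ2 : ℝ → ℝ), HP J γ γ1 γ2 K C α ε0 → ∀ τ θ y : ℝ, 0 < τ → τ ≤ ρ0 → 0 < y → y ≤ L0 * τ →
      |J.f11 (θ + τ, y) - J.f11 (θ, y)| ≤ δ * τ ^ α ∧ |J.f12 (θ + τ, y) - J.f12 (θ, y)| ≤ δ * τ ^ α ∧
      |J.f22 (θ + τ, y) - J.f22 (θ, y)| ≤ δ * τ ^ α := by
  have hCp : 0 < C := by linarith
  have hKp : 0 < K := by linarith
  have hαh : α ≤ 1 / 2 := by
    have : 1 / (16 * K) ≤ 1 := by rw [div_le_iff₀ (by positivity)]; linarith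
    linarith
  obtain ⟨e, he, he1, he2⟩ := small_pow α (δ / (8 * C)) hα (by positivity) 1 (by norm_num)
  set β := 1 / (4 * (4 * K)) with hβ
  have hβ0 : 0 < β := by positivity
  have hβ1 : β ≤ 1 := by rw [hβ, div_le_iff₀ (by positivity)]; linarith
  have hβα : 2 * α < β := by rw [hβ]; convert hαK using 2; ring
  set Y := δ ^ 2 * e ^ 2 / 1024 with hY
  have hY0 : 0 < Y := by positivity
  obtain ⟨Λ, hΛ1, hΛ1', hΛ⟩ := big_pow (β - 2 * α) (Y / (19200 * K ^ 2 * C ^ 2 * (L0 + 1))) (2 * (L0 + 1)) (by linarith) (by positivity)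
  have hΛ0 : 0 < Λ := by linarith
  refine ⟨min (1 / (2 * Λ)) (Y / (28 * C ^ 2 * Λ ^ 2)), min C (min (δ / 4) (δ * e / (1024 * K * Λ))), by positivity, ?_, by positivity, ?_⟩
  · refine (min_le_left _ _).trans ?_
    rw [div_le_iff₀ (by positivity)]; linarith
  intro ε0 hε0 hε1 J γ γ1 γ2 h τ θ y hτ hτ1 hy hy1
  have hτa : τ ≤ 1 / (2 * Λ) := hτ1.trans (min_le_left _ _)
  have hτb : τ ≤ Y / (28 * C ^ 2 * Λ ^ 2) := hτ1.trans (min_le_right _ _)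
  have ha : ε0 ≤ C := hε1.trans (min_le_left _ _)
  have hb : ε0 ≤ δ / 4 := hε1.trans ((min_le_right _ _).trans (min_le_left _ _))
  have hc : ε0 ≤ δ * e / (1024 * K * Λ) := hε1.trans ((min_le_right _ _).trans (min_le_right _ _))
  rw [le_div_iff₀ (by positivity)] at hτa hτb hc
  by_contra hcon
  have hcon' : δ * τ ^ α < |J.f11 (θ + τ, y) - J.f11 (θ, y)| ∨ δ * τ ^ α < |J.f12 (θ + τ, y) - J.f12 (θ, y)| ∨
      δ * τ ^ α < |J.f22 (θ + τ, y) - J.f22 (θ, y)| := by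
    by_contra h'
    push Not at h'
    exact hcon ⟨h'.1, h'.2.1, h'.2.2⟩
  have he3 : C * e ^ α ≤ δ / 8 := by
    have := mul_le_mul_of_nonneg_left he2 hCp.le
    refine this.trans (le_of_eq ?_)
    field_simp
  have key := h.core hα hK hC hε0 ha δ L0 e Λ τ θ y hδ he he1 he3 hb hL0 hΛ1 hτ (by linarith) hy hy1 hcon'
  have hp : 0 < τ ^ α := Real.rpow_pos_of_pos hτ α
  set T := (τ ^ α) ^ 2 * τ ^ 2 with hT
  have hT0 : 0 < T := by positivity
  have hτle : τ ≤ 1 := by nlinarith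
  have t1 : τ ^ 2 ≤ (τ ^ α) ^ 2 * τ := by
    have : τ ≤ (τ ^ α) ^ 2 := by
      rw [← Real.rpow_natCast, ← Real.rpow_mul hτ.le]
      calc τ = τ ^ (1:ℝ) := (Real.rpow_one τ).symm
        _ ≤ _ := Real.rpow_le_rpow_of_exponent_ge hτ hτle (by push_cast; linarith)
    nlinarith
  have a1 : 28 * C ^ 2 * τ ^ 2 * (Λ * τ) ^ 2 ≤ Y * T := by
    have := mul_le_mul_of_nonneg_left t1 (by positivity : 0 ≤ 28 * C ^ 2 * (Λ * τ) ^ 2)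
    have h2 := mul_le_mul_of_nonneg_left hτb hT0.le
    rw [hT] at h2 ⊢
    nlinarith only [this, h2]
  have a2 : 700 * K ^ 2 * (ε0 * τ ^ α) ^ 2 * (Λ * τ) ^ 2 ≤ Y * T := by
    have := pow_le_pow_left₀ (by positivity) hc 2
    have h2 := mul_le_mul_of_nonneg_right this hT0.le
    have h3 : 0 ≤ ε0 ^ 2 * K ^ 2 * Λ ^ 2 * T := by positivity
    rw [hY]
    have e1 : 700 * K ^ 2 * (ε0 * τ ^ α) ^ 2 * (Λ * τ) ^ 2 = 700 * (ε0 ^ 2 * K ^ 2 * Λ ^ 2 * T) := by rw [hT]; ring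
    rw [e1]
    nlinarith only [h2, h3]
  have a3 : (2 * (L0 + 1) / Λ) ^ β * (12 * (4 * K) ^ 2 * (5 * C * (2 * (Λ * τ)) ^ α * τ) ^ 2) ≤ Y * T := by
    rw [Real.div_rpow (by linarith) hΛ0.le, Real.mul_rpow (x := 2) (y := Λ * τ) (by norm_num) (by positivity), Real.mul_rpow hΛ0.le hτ.le]
    have b1 : (2 * (L0 + 1)) ^ β ≤ 2 * (L0 + 1) := by
      calc _ ≤ (2 * (L0 + 1)) ^ (1:ℝ) := Real.rpow_le_rpow_of_exponent_le (by linarith) hβ1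
        _ = _ := Real.rpow_one _
    have b2 : ((2:ℝ) ^ α) ^ 2 ≤ 2 := by
      rw [← Real.rpow_natCast, ← Real.rpow_mul (by norm_num)]
      calc (2:ℝ) ^ (α * (2:ℕ)) ≤ (2:ℝ) ^ (1:ℝ) := Real.rpow_le_rpow_of_exponent_le (by norm_num) (by push_cast; linarith)
        _ = 2 := Real.rpow_one _
    have b3 : (Λ ^ α) ^ 2 / Λ ^ β = Λ ^ (-(β - 2 * α)) := by
      rw [sq, ← Real.rpow_add hΛ0, ← Real.rpow_sub hΛ0]; congr 1; ring
    have e1 : (2 * (L0 + 1)) ^ β / Λ ^ β * (12 * (4 * K) ^ 2 * (5 * C * (2 ^ α * (Λ ^ α * τ ^ α)) * τ) ^ 2) =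
      4800 * K ^ 2 * C ^ 2 * ((2 * (L0 + 1)) ^ β * (((2:ℝ) ^ α) ^ 2 * ((Λ ^ α) ^ 2 / Λ ^ β))) * T := by rw [hT]; ring
    rw [e1, b3]
    calc _ ≤ 4800 * K ^ 2 * C ^ 2 * ((2 * (L0 + 1)) * (2 * (Y / (19200 * K ^ 2 * C ^ 2 * (L0 + 1))))) * T := by gcongr
      _ = Y * T := by field_simp; ring
  have e0 : δ ^ 2 * (τ ^ α) ^ 2 / 4 * (e * τ) ^ 2 / 32 = 8 * (Y * T) := by rw [hY, hT]; ring
  rw [e0] at key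
  have : 0 < Y * T := by positivity
  nlinarith only [key, a1, a2, a3, this]

lemma HP.lemB' (K C α δ L0 : ℝ) (hα : 0 < α) (hαK : 2 * α < 1 / (16 * K)) 
    (hK : 1 ≤ K) (hC : 1 ≤ C) (hδ : 0 < δ) (hL0 : 1 ≤ L0) : ∃ ρ0 ε1, 0 < ρ0 ∧ ρ0 ≤ 1 ∧ 0 < ε1 ∧ ∀ ε0, 0 < ε0 → ε0 ≤ ε1 → 
      ∀ (J : Jet) (γ γ1 γ2 : ℝ → ℝ), HP J γ γ1 γ2 K C α ε0 → ∀ τ θ θ' y : ℝ, 0 < τ → τ ≤ ρ0 → |θ' - θ| ≤ τ → 0 < y → y ≤ L0 * τ →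
      |J.f11 (θ', y) - J.f11 (θ, y)| ≤ δ * τ ^ α ∧ |J.f12 (θ', y) - J.f12 (θ, y)| ≤ δ * τ ^ α ∧
      |J.f22 (θ', y) - J.f22 (θ, y)| ≤ δ * τ ^ α := by
  have hCp : 0 < C := by linarith
  obtain ⟨e, he, he1, he2⟩ := small_pow α (δ / C) hα (by positivity) 1 (by norm_num)
  obtain ⟨ρ0, ε1, h1, h2, h3, H⟩ := HP.lemB K C α δ (L0 / e) hα hαK hK hC hδ (by rw [le_div_iff₀ he]; linarith)
  refine ⟨ρ0, ε1, h1, h2, h3, ?_⟩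
  intro ε0 hε0 hε1 J γ γ1 γ2 h 
  have main : ∀ τ θ σ y : ℝ, 0 < τ → τ ≤ ρ0 → 0 ≤ σ → σ ≤ τ → 0 < y → y ≤ L0 * τ →
      |J.f11 (θ + σ, y) - J.f11 (θ, y)| ≤ δ * τ ^ α ∧ |J.f12 (θ + σ, y) - J.f12 (θ, y)| ≤ δ * τ ^ α ∧
      |J.f22 (θ + σ, y) - J.f22 (θ, y)| ≤ δ * τ ^ α := by
    intro τ θ σ y hτ hτ1 hσ hστ hy hy1
    rcases lt_or_ge σ (e * τ) with hs | hs
    · have n : ‖((θ + σ, y) : ℝ × ℝ) - (θ, y)‖ = σ := by rw [nrm_h, add_sub_cancel_left, abs_of_nonneg hσ]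
      have b : C * ‖((θ + σ, y) : ℝ × ℝ) - (θ, y)‖ ^ α ≤ δ * τ ^ α := by
        rw [n]
        calc C * σ ^ α ≤ C * (e * τ) ^ α := by gcongr
          _ = C * (e ^ α * τ ^ α) := by rw [Real.mul_rpow he.le hτ.le]
          _ ≤ C * (δ / C * τ ^ α) := by gcongr
          _ = _ := by field_simp
      have n1 : ‖((θ + σ, y) : ℝ × ℝ) - (θ, y)‖ ≤ 1 := by rw [n]; linarith
      exact ⟨(h.hold.h11 (θ + σ, y) hy (θ, y) hy n1).trans b, (h.hold.h12 (θ + σ, y) hy (θ, y) hy n1).trans b,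
        (h.hold.h22 (θ + σ, y) hy (θ, y) hy n1).trans b⟩
    · have hs0 : 0 < σ := lt_of_lt_of_le (by positivity) hs
      have := H ε0 hε0 hε1 J γ γ1 γ2 h σ θ y hs0 (hστ.trans hτ1) hy (by
        rw [div_mul_eq_mul_div, le_div_iff₀ he]
        nlinarith)
      have b : δ * σ ^ α ≤ δ * τ ^ α := by gcongr
      exact ⟨this.1.trans b, this.2.1.trans b, this.2.2.trans b⟩
  intro τ θ θ' y hτ hτ1 hθ hy hy1
  rcases le_total θ θ' with hle | hle
  · have := main τ θ (θ' - θ) y hτ hτ1 (by linarith) ((le_abs_self _).trans hθ) hy hy1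
    rwa [add_sub_cancel] at this
  · have := main τ θ' (θ - θ') y hτ hτ1 (by linarith) (by rw [abs_sub_comm] at hθ; exact (le_abs_self _).trans hθ) hy hy1
    rw [add_sub_cancel] at this
    refine ⟨?_, ?_, ?_⟩
    · rw [abs_sub_comm]; exact this.1
    · rw [abs_sub_comm]; exact this.2.1
    · rw [abs_sub_comm]; exact this.2.2

lemma vert (g g1 g2 : ℝ × ℝ → ℝ) (hg : ∀ z ∈ up, HasG g (g1 z) (g2 z) z) (θ τ y y' n M : ℝ) (hτ : 0 < τ) (hy : 0 < y) (hy' : 0 < y')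
    (hyy : |y - y'| ≤ τ) (hyM : y ≤ M) (hyM' : y' ≤ M)
    (h1 : ∀ s ∈ Icc 0 τ, ∀ y, 0 < y → y ≤ M → |g1 (θ + s, y) - g1 (θ, y)| ≤ n)
    (h2 : ∀ y, 0 < y → y ≤ M → |g2 (θ + τ, y) - g2 (θ, y)| ≤ n) : |g1 (θ, y) - g1 (θ, y')| ≤ 3 * n := by
  have A : ∀ y, 0 < y → y ≤ M → |(g (θ + τ, y) - g (θ, y)) - τ * g1 (θ, y)| ≤ n * τ := by
    intro y hy hyM
    have := mvt (fun s => g (θ + s, y) - s * g1 (θ, y)) (fun s => g1 (θ + s, y) - g1 (θ, y)) τ n hτ.le (by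
      intro s hs
      have a := (hg (θ + s, y) hy).curve (c := fun s => θ + s) (d := fun _ => y) ((hasDerivAt_id s).const_add θ) (hasDerivAt_const s y) rfl
      have b := (hasDerivAt_id s).mul_const (g1 (θ, y))
      refine (a.sub b).congr_deriv (by ring)) (fun s hs => h1 s hs y hy hyM)
    simp only [add_zero, zero_mul, sub_zero] at this
    rw [show (g (θ + τ, y) - g (θ, y)) - τ * g1 (θ, y) = g (θ + τ, y) - τ * g1 (θ, y) - g (θ, y) by ring]
    exact this
  have hn : 0 ≤ n := (abs_nonneg _).trans (h2 y hy hyM)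
  have B := mvt2 (fun y => g (θ + τ, y) - g (θ, y)) (fun y => g2 (θ + τ, y) - g2 (θ, y)) y y' n (by
    intro s hs
    have hs0 : 0 < s := lt_of_lt_of_le (lt_min hy hy') hs.1
    have a := (hg (θ + τ, s) hs0).curve (c := fun _ => θ + τ) (d := fun s => s) (hasDerivAt_const s _) (hasDerivAt_id s) rfl
    have b := (hg (θ, s) hs0).curve (c := fun _ => θ) (d := fun s => s) (hasDerivAt_const s _) (hasDerivAt_id s) rfl
    refine (a.sub b).congr_deriv (by ring)) (by
    intro s hs
    exact h2 s (lt_of_lt_of_le (lt_min hy hy') hs.1) (hs.2.trans (max_le hyM hyM')))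
  have B' : |g (θ + τ, y') - g (θ, y') - (g (θ + τ, y) - g (θ, y))| ≤ n * τ := by
    refine B.trans ?_
    rw [abs_sub_comm]; gcongr
  have a1 := A y hy hyM
  have a2 := A y' hy' hyM'
  have : τ * |g1 (θ, y) - g1 (θ, y')| ≤ τ * (3 * n) := by
    rw [← abs_of_pos hτ, ← abs_mul, abs_of_pos hτ]
    rw [abs_le] at a1 a2 B' ⊢
    constructor <;> linarith [a1.1, a2.1, B'.1, a1.2, a2.2, B'.2]
  exact le_of_mul_le_mul_left this hτ

set_option maxHeartbeats 1000000 in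
lemma HP.fin (K C α δ L0 : ℝ) (hα : 0 < α) (hαK : 2 * α < 1 / (16 * K)) 
    (hK : 1 ≤ K) (hC : 1 ≤ C) (hδ : 0 < δ) (hL0 : 1 ≤ L0) : ∃ ρ0 ε1, 0 < ρ0 ∧ ρ0 ≤ 1 ∧ 0 < ε1 ∧ ∀ ε0, 0 < ε0 → ε0 ≤ ε1 → 
      ∀ (J : Jet) (γ γ1 γ2 : ℝ → ℝ), HP J γ γ1 γ2 K C α ε0 → ∀ (τ : ℝ) (X Y : ℝ × ℝ), 0 < τ → τ ≤ ρ0 → ‖X - Y‖ ≤ τ → 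
      X ∈ up → Y ∈ up → X.2 ≤ L0 * τ → Y.2 ≤ L0 * τ →
      |J.f11 X - J.f11 Y| ≤ δ * τ ^ α ∧ |J.f12 X - J.f12 Y| ≤ δ * τ ^ α ∧ |J.f22 X - J.f22 Y| ≤ δ * τ ^ α := by
  have hCp : 0 < C := by linarith
  have hKp : 0 < K := by linarith
  set d := δ / (8 * K) with hd
  have hd0 : 0 < d := by positivity
  have hdδ : 8 * K * d = δ := by rw [hd]; field_simp
  have hα1 : α < 1 / 2 := by
    have : 1 / (16 * K) ≤ 1 := by rw [div_le_iff₀ (by positivity)]; linarith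
    linarith
  obtain ⟨ρ1, ε1, h1, h2, h3, H⟩ := HP.lemB' K C α d L0 hα hαK hK hC hd0 hL0
  obtain ⟨k, hk0, hk1, hk2⟩ := small_pow (1 - α) (d / (2 * C)) (by linarith) (by positivity) ρ1 h1
  refine ⟨k, ε1, hk0, hk1.trans h2, h3, ?_⟩
  intro ε0 hε0 hε1 J γ γ1 γ2 h τ X Y hτ hτ1 hXY hX hY hX2 hY2
  have HH := H ε0 hε0 hε1 J γ γ1 γ2 h τ
  have hp : 0 < τ ^ α := Real.rpow_pos_of_pos hτ α
  have n1 : |X.1 - Y.1| ≤ τ := (fst_le (X - Y)).trans hXY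
  have n2 : |X.2 - Y.2| ≤ τ := (snd_le (X - Y)).trans hXY
  have hor := HH Y.1 X.1 X.2 hτ (hτ1.trans hk1) n1 hX hX2
  have v12 := vert J.f2 J.f12 J.f22 h.on.d2 Y.1 τ X.2 Y.2 (d * τ ^ α) (L0 * τ) hτ hX hY n2 hX2 hY2
    (fun s hs y hy hyM => (HH Y.1 (Y.1 + s) y hτ (hτ1.trans hk1) (by rw [add_sub_cancel_left, abs_of_nonneg hs.1]; exact hs.2) hy hyM).2.1)
    (fun y hy hyM => (HH Y.1 (Y.1 + τ) y hτ (hτ1.trans hk1) (by rw [add_sub_cancel_left, abs_of_pos hτ]) hy hyM).2.2)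
  have v11 := vert J.f1 J.f11 J.f12 h.on.d1 Y.1 τ X.2 Y.2 (d * τ ^ α) (L0 * τ) hτ hX hY n2 hX2 hY2
    (fun s hs y hy hyM => (HH Y.1 (Y.1 + s) y hτ (hτ1.trans hk1) (by rw [add_sub_cancel_left, abs_of_nonneg hs.1]; exact hs.2) hy hyM).1)
    (fun y hy hyM => (HH Y.1 (Y.1 + τ) y hτ (hτ1.trans hk1) (by rw [add_sub_cancel_left, abs_of_pos hτ]) hy hyM).2.1)
  have τs : 2 * C * τ ≤ d * τ ^ α := by
    have e : τ = τ ^ (1 - α) * τ ^ α := by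
      rw [← Real.rpow_add hτ]; simp
    have : τ ^ (1 - α) ≤ d / (2 * C) := (Real.rpow_le_rpow hτ.le hτ1 (by linarith)).trans hk2
    calc 2 * C * τ = 2 * C * (τ ^ (1 - α) * τ ^ α) := by rw [← e]
      _ ≤ 2 * C * (d / (2 * C) * τ ^ α) := by gcongr
      _ = _ := by field_simp
  have v22 : |J.f22 (Y.1, X.2) - J.f22 (Y.1, Y.2)| ≤ 7 * K * (d * τ ^ α) - d * τ ^ α + d * τ ^ α := by
    have c := h.cone (Y.1, X.2) hX (Y.1, Y.2) hY (by rw [nrm_v]; linarith)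
    rw [nrm_v] at c
    unfold MC.cone at c
    set a := J.f11 (Y.1, X.2) - J.f11 (Y.1, Y.2)
    set b := J.f12 (Y.1, X.2) - J.f12 (Y.1, Y.2)
    set q := J.f22 (Y.1, X.2) - J.f22 (Y.1, Y.2)
    set n := d * τ ^ α
    have hn : 0 < n := by positivity
    have a2 : a ^ 2 ≤ (3 * n) ^ 2 := sq_le_sq' (by linarith [neg_abs_le a]) (by linarith [le_abs_self a])
    have b2 : b ^ 2 ≤ (3 * n) ^ 2 := sq_le_sq' (by linarith [neg_abs_le b]) (by linarith [le_abs_self b])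
    have t2 : C ^ 2 * |X.2 - Y.2| ^ 2 ≤ (n / 2) ^ 2 := by
      rw [← mul_pow]
      refine pow_le_pow_left₀ (by positivity) ?_ 2
      have := mul_le_mul_of_nonneg_left n2 hCp.le
      linarith
    have f1 : -K * (a * q) ≤ q ^ 2 / 2 + K ^ 2 * a ^ 2 / 2 := by nlinarith only [sq_nonneg (q + K * a)]
    have f2 := mul_le_mul_of_nonneg_left a2 (sq_nonneg K)
    have f3 := mul_le_mul_of_nonneg_left b2 hKp.le
    have f4 : K * (3 * n) ^ 2 ≤ K ^ 2 * (3 * n) ^ 2 := by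
      have : K ≤ K ^ 2 := by nlinarith
      gcongr
    have f5 : (n / 2) ^ 2 ≤ K ^ 2 * (n / 2) ^ 2 := by
      have : 1 ≤ K ^ 2 := by nlinarith
      nlinarith only [sq_nonneg (n/2), this]
    have : q ^ 2 ≤ (7 * K * n) ^ 2 := by
      have g1 := sq_nonneg a
      have g2 := sq_nonneg b
      have g3 : 0 ≤ K ^ 2 * n ^ 2 := by positivity
      linarith only [g1, g2, g3, c, f1, f2, f3, f4, f5, t2]
    have := abs_le_of_sq_le_sq this (by positivity)
    linarith
  have tri : ∀ g : ℝ × ℝ → ℝ, g X - g Y = (g (X.1, X.2) - g (Y.1, X.2)) + (g (Y.1, X.2) - g (Y.1, Y.2)) := by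
    intro g; simp
  have hn : 0 < d * τ ^ α := by positivity
  have hn2 : δ * τ ^ α = 8 * K * (d * τ ^ α) := by rw [← hdδ]; ring
  refine ⟨?_, ?_, ?_⟩
  · rw [tri J.f11]
    refine (abs_add_le _ _).trans ((add_le_add hor.1 v11).trans ?_)
    nlinarith
  · rw [tri J.f12]
    refine (abs_add_le _ _).trans ((add_le_add hor.2.1 v12).trans ?_)
    nlinarith
  · rw [tri J.f22]
    refine (abs_add_le _ _).trans ((add_le_add hor.2.2 v22).trans ?_)
    nlinarith

end MC

namespace MC
open intervalIntegral MeasureTheory Filter Topology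

def pa (z : ℝ × ℝ) : ℝ := Real.exp (-z.2) * Real.cos z.1
def pb (z : ℝ × ℝ) : ℝ := Real.exp (-z.2) * Real.sin z.1
def Ph (z : ℝ × ℝ) : ℝ × ℝ := (pa z, pb z)

def Jet.pol (J : Jet) : Jet where
  f z := J.f (Ph z)
  f1 z := -pb z * J.f1 (Ph z) + pa z * J.f2 (Ph z)
  f2 z := -pa z * J.f1 (Ph z) - pb z * J.f2 (Ph z)
  f11 z := pb z ^ 2 * J.f11 (Ph z) - 2 * pa z * pb z * J.f12 (Ph z) + pa z ^ 2 * J.f22 (Ph z) - pa z * J.f1 (Ph z) - pb z * J.f2 (Ph z)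
  f12 z := pa z * pb z * J.f11 (Ph z) + (pb z ^ 2 - pa z ^ 2) * J.f12 (Ph z) - pa z * pb z * J.f22 (Ph z) + pb z * J.f1 (Ph z) - pa z * J.f2 (Ph z)
  f22 z := pa z ^ 2 * J.f11 (Ph z) + 2 * pa z * pb z * J.f12 (Ph z) + pb z ^ 2 * J.f22 (Ph z) + pa z * J.f1 (Ph z) + pb z * J.f2 (Ph z)

lemma HasG.ofSnd {f : ℝ → ℝ} {f' : ℝ} {z : ℝ × ℝ} (h : HasDerivAt f f' z.2) :
    HasG (fun w => f w.2) 0 f' z := by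
  unfold HasG
  have := HasFDerivAt.comp z h.hasFDerivAt (hasFDerivAt_snd (𝕜 := ℝ) (p := z))
  exact this.congr_fderiv (by ext <;> simp)

lemma HasG.congr' {f : ℝ × ℝ → ℝ} {a b a' b' : ℝ} {z : ℝ × ℝ} (h : HasG f a b z) (ha : a = a') (hb : b = b') : HasG f a' b' z := by
  subst ha; subst hb; exact h

lemma pa_d (z : ℝ × ℝ) : HasG pa (-pb z) (-pa z) z := by
  have h1 : HasDerivAt (fun y : ℝ => Real.exp (-y)) (-Real.exp (-z.2)) z.2 := by
    simpa using (hasDerivAt_neg z.2).exp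
  have := (HasG.ofSnd (z := z) h1).mul (HasG.ofFst (z := z) (Real.hasDerivAt_cos z.1))
  exact this.congr' (by simp [pb]) (by simp [pa])

lemma pb_d (z : ℝ × ℝ) : HasG pb (pa z) (-pb z) z := by
  have h1 : HasDerivAt (fun y : ℝ => Real.exp (-y)) (-Real.exp (-z.2)) z.2 := by
    simpa using (hasDerivAt_neg z.2).exp
  have := (HasG.ofSnd (z := z) h1).mul (HasG.ofFst (z := z) (Real.hasDerivAt_sin z.1))
  exact this.congr' (by simp [pa]) (by simp [pb])

lemma HasG.ph {f : ℝ × ℝ → ℝ} {a b : ℝ} {z : ℝ × ℝ} (h : HasG f a b (Ph z)) :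
    HasG (fun w => f (Ph w)) (a * (-pb z) + b * pa z) (a * (-pa z) + b * (-pb z)) z :=
  h.compMap (pa_d z) (pb_d z)

lemma ph_en (z : ℝ × ℝ) : en (Ph z) = Real.exp (-z.2) := by
  have : en (Real.exp (-z.2) * Real.cos z.1, Real.exp (-z.2) * Real.sin z.1) = _ := en_smul (Real.exp (-z.2)) (Real.cos z.1, Real.sin z.1)
  have e3 : en (Real.cos z.1, Real.sin z.1) = 1 := by simp [en]
  rw [e3, mul_one, abs_of_pos (Real.exp_pos _)] at this
  exact this

lemma ph_mem {z : ℝ × ℝ} (hz : z ∈ up) : Ph z ∈ disc := by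
  show en (Ph z) < 1
  rw [ph_en, Real.exp_lt_one_iff]
  have : 0 < z.2 := hz
  linarith

lemma Jet.On.pol {J : Jet} (hJ : J.On disc) : J.pol.On up where
  d z hz := ((hJ.d _ (ph_mem hz)).ph).congr' (by simp [Jet.pol]; ring) (by simp [Jet.pol]; ring)
  d1 z hz := by
    have a1 := ((pb_d z).mul (hJ.d1 _ (ph_mem hz)).ph).smul (-1)
    have a2 := (pa_d z).mul (hJ.d2 _ (ph_mem hz)).ph
    have := (a1.add a2).congr' (a' := J.pol.f11 z) (b' := J.pol.f12 z) (by simp [Jet.pol]; ring) (by simp [Jet.pol]; ring)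
    refine HasFDerivAt.congr_of_eventuallyEq this ?_
    exact Eventually.of_forall (fun w => by simp [Jet.pol])
  d2 z hz := by
    have a1 := ((pa_d z).mul (hJ.d1 _ (ph_mem hz)).ph).smul (-1)
    have a2 := (pb_d z).mul (hJ.d2 _ (ph_mem hz)).ph
    have := (a1.sub a2).congr' (a' := J.pol.f12 z) (b' := J.pol.f22 z) (by simp [Jet.pol]; ring) (by simp [Jet.pol]; ring)
    refine HasFDerivAt.congr_of_eventuallyEq this ?_
    exact Eventually.of_forall (fun w => by simp [Jet.pol])

lemma pa_le {z : ℝ × ℝ} (hz : z ∈ up) : |pa z| ≤ 1 :=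
  (fst_le (Ph z)).trans ((norm_le_en _).trans (le_of_lt (ph_mem hz)))
lemma pb_le {z : ℝ × ℝ} (hz : z ∈ up) : |pb z| ≤ 1 :=
  (snd_le (Ph z)).trans ((norm_le_en _).trans (le_of_lt (ph_mem hz)))

/-- Lipschitz bound along segments in a convex set -/
lemma lip (Ω : Set (ℝ × ℝ)) (hΩ : Convex ℝ Ω) (g g1 g2 : ℝ × ℝ → ℝ) (hg : ∀ z ∈ Ω, HasG g (g1 z) (g2 z) z) (c : ℝ)
    (h1 : ∀ z ∈ Ω, |g1 z| ≤ c) (h2 : ∀ z ∈ Ω, |g2 z| ≤ c) (z w : ℝ × ℝ) (hz : z ∈ Ω) (hw : w ∈ Ω) : |g z - g w| ≤ 2 * c * ‖z - w‖ := by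
  have mem : ∀ s ∈ Icc (0:ℝ) 1, (w.1 + s * (z - w).1, w.2 + s * (z - w).2) ∈ Ω := by
    intro s hs
    have := hΩ.add_smul_sub_mem hw hz hs
    exact this
  have := mvt (fun s => g (w.1 + s * (z - w).1, w.2 + s * (z - w).2)) _ 1 (2 * c * ‖z - w‖) zero_le_one
    (fun s hs => (hg _ (mem s hs)).line) (by
      intro s hs
      refine (abs_add_le _ _).trans ?_
      rw [abs_mul, abs_mul]
      have i1 := mul_le_mul (h1 _ (mem s hs)) (fst_le (z - w)) (abs_nonneg _) ((abs_nonneg _).trans (h1 _ hz))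
      have i2 := mul_le_mul (h2 _ (mem s hs)) (snd_le (z - w)) (abs_nonneg _) ((abs_nonneg _).trans (h1 _ hz))
      linarith)
  simpa using this

lemma up_convex : Convex ℝ up := by
  have : up = {z : ℝ × ℝ | 0 < (LinearMap.snd ℝ ℝ ℝ) z} := rfl
  rw [this]
  exact convex_halfSpace_gt (LinearMap.isLinear _) 0

lemma disc_convex : Convex ℝ disc := by
  intro z hz w hw a b ha hb hab
  show en (a • z + b • w) < 1
  have h1 := en_add (a • z) (b • w)
  have h2 : en (a • z) = |a| * en z := en_smul a z
  have h3 : en (b • w) = |b| * en w := en_smul b w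
  rw [h2, h3, abs_of_nonneg ha, abs_of_nonneg hb] at h1
  have hz' : en z < 1 := hz
  have hw' : en w < 1 := hw
  refine lt_of_le_of_lt h1 ?_
  rcases ha.eq_or_lt with rfl | ha
  · have : b = 1 := by linarith
    subst this; linarith
  · nlinarith

lemma ph_lip {z w : ℝ × ℝ} (hz : z ∈ up) (hw : w ∈ up) : |pa z - pa w| ≤ 2 * ‖z - w‖ ∧ |pb z - pb w| ≤ 2 * ‖z - w‖ := by
  constructor
  · have := lip up up_convex pa (fun z => -pb z) (fun z => -pa z) (fun z _ => pa_d z) 1 (fun z hz => by rw [abs_neg]; exact pb_le hz)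
      (fun z hz => by rw [abs_neg]; exact pa_le hz) z w hz hw
    linarith
  · have := lip up up_convex pb (fun z => pa z) (fun z => -pb z) (fun z _ => pb_d z) 1 (fun z hz => pa_le hz)
      (fun z hz => by rw [abs_neg]; exact pb_le hz) z w hz hw
    linarith

lemma prod_diff (x y x' y' A B n m : ℝ) (hx : |x - x'| ≤ n) (hy : |y - y'| ≤ m) (hA : |y| ≤ A) (hB : |x'| ≤ B) :
    |x * y - x' * y'| ≤ n * A + B * m := by
  have : x * y - x' * y' = (x - x') * y + x' * (y - y') := by ring
  rw [this]
  refine (abs_add_le _ _).trans ?_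
  rw [abs_mul, abs_mul]
  have i1 := mul_le_mul hx hA (abs_nonneg _) ((abs_nonneg _).trans hx)
  have i2 := mul_le_mul hB hy (abs_nonneg _) ((abs_nonneg _).trans hB)
  linarith

structure Jet.Bd (J : Jet) (Ω : Set (ℝ × ℝ)) (c : ℝ) : Prop where
  b1 : ∀ z ∈ Ω, |J.f1 z| ≤ c
  b2 : ∀ z ∈ Ω, |J.f2 z| ≤ c
  b11 : ∀ z ∈ Ω, |J.f11 z| ≤ c
  b12 : ∀ z ∈ Ω, |J.f12 z| ≤ c
  b22 : ∀ z ∈ Ω, |J.f22 z| ≤ c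

/-- transformation of a symmetric matrix -/
def t11 (a b x y z : ℝ) : ℝ := b ^ 2 * x - 2 * a * b * y + a ^ 2 * z
def t12 (a b x y z : ℝ) : ℝ := a * b * x + (b ^ 2 - a ^ 2) * y - a * b * z
def t22 (a b x y z : ℝ) : ℝ := a ^ 2 * x + 2 * a * b * y + b ^ 2 * z

lemma t_sq (a b x y z : ℝ) : t11 a b x y z ^ 2 + 2 * t12 a b x y z ^ 2 + t22 a b x y z ^ 2 = (a ^ 2 + b ^ 2) ^ 2 * (x ^ 2 + 2 * y ^ 2 + z ^ 2) := by
  unfold t11 t12 t22; ring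

lemma t_det (a b x y z : ℝ) : t11 a b x y z * t22 a b x y z - t12 a b x y z ^ 2 = (a ^ 2 + b ^ 2) ^ 2 * (x * z - y ^ 2) := by
  unfold t11 t12 t22; ring

lemma t_cone (K a b x y z : ℝ) (h : cone K 0 x y z) : cone K 0 (t11 a b x y z) (t12 a b x y z) (t22 a b x y z) := by
  unfold cone at *
  rw [t_sq, t_det]
  have := mul_le_mul_of_nonneg_left h (sq_nonneg (a ^ 2 + b ^ 2))
  linarith

lemma pol_N {J : Jet} (hJ : J.On disc) (hb : J.Bd disc 1) (z w : ℝ × ℝ) (hz : z ∈ up) (hw : w ∈ up) :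
    let x := J.f11 (Ph z) - J.f11 (Ph w)
    let y := J.f12 (Ph z) - J.f12 (Ph w)
    let v := J.f22 (Ph z) - J.f22 (Ph w)
    |J.pol.f11 z - J.pol.f11 w - t11 (pa z) (pb z) x y v| ≤ 28 * ‖z - w‖ ∧
    |J.pol.f12 z - J.pol.f12 w - t12 (pa z) (pb z) x y v| ≤ 28 * ‖z - w‖ ∧
    |J.pol.f22 z - J.pol.f22 w - t22 (pa z) (pb z) x y v| ≤ 28 * ‖z - w‖ := by
  intro x y v
  obtain ⟨la, lb⟩ := ph_lip hz hw
  set n := ‖z - w‖ with hn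
  have hn0 : 0 ≤ n := norm_nonneg _
  have mz := ph_mem hz
  have mw := ph_mem hw
  have nΦ : ‖Ph z - Ph w‖ ≤ 2 * n := nrm_le la lb
  have l1 : |J.f1 (Ph z) - J.f1 (Ph w)| ≤ 4 * n := by
    have := lip disc disc_convex J.f1 J.f11 J.f12 hJ.d1 1 hb.b11 hb.b12 _ _ mz mw
    linarith
  have l2 : |J.f2 (Ph z) - J.f2 (Ph w)| ≤ 4 * n := by
    have := lip disc disc_convex J.f2 J.f12 J.f22 hJ.d2 1 hb.b12 hb.b22 _ _ mz mw
    linarith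
  have az := pa_le hz
  have aw := pa_le hw
  have bz := pb_le hz
  have bw := pb_le hw
  have paa := prod_diff _ _ _ _ 1 1 _ _ la la az aw
  have pab := prod_diff _ _ _ _ 1 1 _ _ la lb bz aw
  have pbb := prod_diff _ _ _ _ 1 1 _ _ lb lb bz bw
  have a1 := prod_diff _ _ _ _ 1 1 _ _ la l1 (hb.b1 _ mz) aw
  have a2 := prod_diff _ _ _ _ 1 1 _ _ la l2 (hb.b2 _ mz) aw
  have b1 := prod_diff _ _ _ _ 1 1 _ _ lb l1 (hb.b1 _ mz) bw
  have b2 := prod_diff _ _ _ _ 1 1 _ _ lb l2 (hb.b2 _ mz) bw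
  have M1 := hb.b11 _ mw
  have M2 := hb.b12 _ mw
  have M3 := hb.b22 _ mw
  have tr : ∀ p q c : ℝ, |p - q| ≤ 2 * n * 1 + 1 * (2 * n) → |c| ≤ 1 → |(p - q) * c| ≤ 4 * n := by
    intro p q c h h'
    rw [abs_mul]
    have := mul_le_mul h h' (abs_nonneg _) ((abs_nonneg _).trans h)
    linarith
  have q11 := fun c hc => tr _ _ c paa hc
  have q12 := fun c hc => tr _ _ c pab hc
  have q22 := fun c hc => tr _ _ c pbb hc
  simp only [Jet.pol, t11, t12, t22, x, y, v]
  set F1 := J.f1 (Ph z)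
  set F2 := J.f2 (Ph z)
  set G1 := J.f1 (Ph w)
  set G2 := J.f2 (Ph w)
  set A := J.f11 (Ph w)
  set B := J.f12 (Ph w)
  set D := J.f22 (Ph w)
  have u1 := q11 A M1
  have u2 := q11 B M2
  have u3 := q11 D M3
  have u4 := q12 A M1
  have u5 := q12 B M2
  have u6 := q12 D M3
  have u7 := q22 A M1
  have u8 := q22 B M2
  have u9 := q22 D M3
  rw [abs_le] at a1 a2 b1 b2 u1 u2 u3 u4 u5 u6 u7 u8 u9
  refine ⟨?_, ?_, ?_⟩
  · rw [abs_le]; constructor <;> linarith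
  · rw [abs_le]; constructor <;> linarith
  · rw [abs_le]; constructor <;> linarith

lemma pol_HP {J : Jet} {γ γ1 γ2 : ℝ → ℝ} {K α ε0 : ℝ} (hJ : J.On disc) (hb : J.Bd disc 1) (hK : 1 ≤ K) (hα : 0 < α) (hα1 : α ≤ 1)
    (hcone : ∀ z ∈ disc, ∀ w ∈ disc, cone K 0 (J.f11 z - J.f11 w) (J.f12 z - J.f12 w) (J.f22 z - J.f22 w))
    (hH : J.Hold disc 1 α 2) (hc : ContinuousOn J.f cdisc) (hγ : ∀ θ, J.f (Real.cos θ, Real.sin θ) = γ θ)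
    (hg1 : ∀ θ, HasDerivAt γ (γ1 θ) θ) (hg2 : ∀ θ, HasDerivAt γ1 (γ2 θ) θ) (hgh : ∀ s t, |γ2 s - γ2 t| ≤ ε0 * |s - t| ^ α) :
    HP J.pol γ γ1 γ2 (4 * K) (280 * K) α ε0 := by
  have main : ∀ z ∈ up, ∀ w ∈ up, ‖z - w‖ ≤ 1 → |J.pol.f11 z - J.pol.f11 w| ≤ 280 * K * ‖z - w‖ ^ α ∧
      |J.pol.f12 z - J.pol.f12 w| ≤ 280 * K * ‖z - w‖ ^ α ∧ |J.pol.f22 z - J.pol.f22 w| ≤ 280 * K * ‖z - w‖ ^ α := by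
    intro z hz w hw hzw
    obtain ⟨n1, n2, n3⟩ := pol_N hJ hb z w hz hw
    obtain ⟨la, lb⟩ := ph_lip hz hw
    have mz := ph_mem hz
    have mw := ph_mem hw
    have nΦ : ‖Ph z - Ph w‖ ≤ 2 * ‖z - w‖ := nrm_le la lb
    have np : ‖Ph z - Ph w‖ ^ α ≤ 2 * ‖z - w‖ ^ α := by
      refine (Real.rpow_le_rpow (norm_nonneg _) nΦ hα.le).trans ?_
      rw [Real.mul_rpow (by norm_num) (norm_nonneg _)]
      gcongr
      calc (2:ℝ) ^ α ≤ 2 ^ (1:ℝ) := Real.rpow_le_rpow_of_exponent_le (by norm_num) hα1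
        _ = 2 := Real.rpow_one _
    have nl : ‖z - w‖ ≤ ‖z - w‖ ^ α := by
      rcases eq_or_lt_of_le (norm_nonneg (z - w)) with h0 | h0
      · rw [← h0]; rw [Real.zero_rpow hα.ne']
      · calc ‖z - w‖ = ‖z - w‖ ^ (1:ℝ) := (Real.rpow_one _).symm
          _ ≤ _ := Real.rpow_le_rpow_of_exponent_ge h0 hzw hα1
    set n := ‖z - w‖ ^ α with hn
    have hn0 : 0 ≤ n := Real.rpow_nonneg (norm_nonneg _) α
    have m1 := (hH.h11 _ mz _ mw (disc_norm mz mw)).trans (by linarith : _ ≤ 2 * n)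
    have m2 := (hH.h12 _ mz _ mw (disc_norm mz mw)).trans (by linarith : _ ≤ 2 * n)
    have m3 := (hH.h22 _ mz _ mw (disc_norm mz mw)).trans (by linarith : _ ≤ 2 * n)
    have aa : |pa z * pa z| ≤ 1 := by rw [abs_mul]; exact mul_le_one₀ (pa_le hz) (abs_nonneg _) (pa_le hz)
    have ab : |pa z * pb z| ≤ 1 := by rw [abs_mul]; exact mul_le_one₀ (pa_le hz) (abs_nonneg _) (pb_le hz)
    have bb : |pb z * pb z| ≤ 1 := by rw [abs_mul]; exact mul_le_one₀ (pb_le hz) (abs_nonneg _) (pb_le hz)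
    have tr : ∀ p q : ℝ, |p| ≤ 1 → |q| ≤ 2 * n → |p * q| ≤ 2 * n := by
      intro p q h h'
      rw [abs_mul]
      have := mul_le_mul h h' (abs_nonneg _) zero_le_one
      linarith
    have u1 := tr _ _ aa m1
    have u2 := tr _ _ aa m2
    have u3 := tr _ _ aa m3
    have u4 := tr _ _ ab m1
    have u5 := tr _ _ ab m2
    have u6 := tr _ _ ab m3
    have u7 := tr _ _ bb m1
    have u8 := tr _ _ bb m2
    have u9 := tr _ _ bb m3
    simp only [t11, t12, t22] at n1 n2 n3
    rw [abs_le] at u1 u2 u3 u4 u5 u6 u7 u8 u9 n1 n2 n3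
    have hKn : 280 * n ≤ 280 * K * n := by nlinarith
    refine ⟨?_, ?_, ?_⟩
    · rw [abs_le]; constructor <;> linarith
    · rw [abs_le]; constructor <;> linarith
    · rw [abs_le]; constructor <;> linarith
  refine ⟨hJ.pol, ⟨fun z hz w hw h => (main z hz w hw h).1, fun z hz w hw h => (main z hz w hw h).2.1, fun z hz w hw h => (main z hz w hw h).2.2⟩, ?_, ?_, hg1, hg2, hgh⟩
  · intro z hz w hw hzw
    obtain ⟨n1, n2, n3⟩ := pol_N hJ hb z w hz hw
    have c0 := t_cone K (pa z) (pb z) _ _ _ (hcone _ (ph_mem hz) _ (ph_mem hw))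
    have := conePert K 0 _ _ _ _ _ _ _ hK c0 n1 n2 n3
    convert this using 1
    ring
  · intro θ
    have cc : ContinuousWithinAt (fun y => J.f (Ph (θ, y))) (Ici 0) 0 := by
      have h1 : Ph (θ, 0) ∈ cdisc := by
        show en _ ≤ 1
        rw [ph_en]; simp
      refine (hc _ h1).comp (t := cdisc) ?_ ?_
      · have : Continuous (fun y : ℝ => Ph (θ, y)) := by unfold Ph pa pb; fun_prop
        exact this.continuousWithinAt
      · intro y hy
        show en _ ≤ 1
        rw [ph_en, Real.exp_le_one_iff]
        have : 0 ≤ y := hy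
        simp only; linarith
    have := cc.mono Ioi_subset_Ici_self
    have e : J.f (Ph (θ, 0)) = γ θ := by rw [← hγ]; simp [Ph, pa, pb]
    rw [← e]
    exact this

end MC

namespace MC
open intervalIntegral MeasureTheory Filter Topology

lemma ph_exp (c : ℂ) : Ph (c.im, -c.re) = ((Complex.exp c).re, (Complex.exp c).im) := by
  simp [Ph, pa, pb, Complex.exp_re, Complex.exp_im]

lemma ph_height {X : ℝ × ℝ} {s u : ℝ} (h : en (Ph X) = s) (hs : 1 / 2 ≤ s) (hs1 : s < 1) (hu : 1 - u ≤ s) :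
    0 < X.2 ∧ X.2 ≤ 2 * u := by
  rw [ph_en] at h
  have hl : X.2 = - Real.log s := by rw [← h, Real.log_exp]; ring
  have h0 : 0 < s := by linarith
  constructor
  · rw [hl]; linarith [Real.log_neg h0 hs1]
  · have h1 := Real.one_sub_inv_le_log_of_pos h0
    have h2 : s⁻¹ - 1 ≤ 2 * u := by
      have : s⁻¹ - 1 = (1 - s) * s⁻¹ := by field_simp
      rw [this]
      have h3 : s⁻¹ ≤ 2 := by rw [inv_le_comm₀ h0 (by norm_num)]; linarith
      nlinarith
    rw [hl]; linarith

lemma polar_pts (z w : ℝ × ℝ) (Λ : ℝ) (hz : z ∈ disc) (hw : w ∈ disc) (hΛ : 1 ≤ Λ)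
    (h1 : 1 ≤ en w + 4 * Λ * ‖z - w‖) (h2 : 12 * Λ * ‖z - w‖ ≤ 1) :
    1 / 2 ≤ en z ∧ ∃ X Y : ℝ × ℝ, X ∈ up ∧ Y ∈ up ∧ Ph X = z ∧ Ph Y = w ∧ ‖X - Y‖ ≤ 6 * ‖z - w‖ ∧
      X.2 ≤ 12 * Λ * ‖z - w‖ ∧ Y.2 ≤ 12 * Λ * ‖z - w‖ := by
  set h := ‖z - w‖ with hh
  have h0 : 0 ≤ h := norm_nonneg _
  have hle : h ≤ Λ * h := by nlinarith
  have ew : 2 / 3 ≤ en w := by linarith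
  have ez : 1 - 6 * Λ * h ≤ en z := by
    have := en_sub_le w z
    rw [norm_sub_rev, ← hh] at this
    linarith
  have ez2 : 1 / 2 ≤ en z := by linarith
  refine ⟨ez2, ?_⟩
  set Z : ℂ := ⟨z.1, z.2⟩ with hZ
  set W : ℂ := ⟨w.1, w.2⟩ with hW
  have nW : ‖W‖ = en w := (en_eq w).symm
  have nZ : ‖Z‖ = en z := (en_eq z).symm
  have W0 : W ≠ 0 := by intro h; rw [h] at nW; simp at nW; linarith
  have Z0 : Z ≠ 0 := by intro h; rw [h] at nZ; simp at nZ; linarith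
  have nD : ‖Z - W‖ ≤ 2 * h := by
    have := en_le (z - w)
    rw [en_eq] at this
    exact this
  have nq : ‖(Z - W) / W‖ ≤ 4 * h := by
    rw [norm_div, div_le_iff₀ (by rw [nW]; linarith), nW]
    nlinarith
  have hl := Complex.norm_log_one_add_half_le_self (z := (Z - W) / W) (by linarith)
  set l := Complex.log (1 + (Z - W) / W) with hldef
  have el : Complex.exp l = Z / W := by
    have : 1 + (Z - W) / W = Z / W := by field_simp; ring
    rw [hldef, this, Complex.exp_log (div_ne_zero Z0 W0)]
  set c := Complex.log W with hc
  have ec : Complex.exp c = W := Complex.exp_log W0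
  have eX : Ph ((c + l).im, -(c + l).re) = z := by
    rw [ph_exp, Complex.exp_add, ec, el, mul_div_cancel₀ _ W0]
  have eY : Ph (c.im, -c.re) = w := by
    rw [ph_exp, ec]
  have HX := ph_height (X := ((c + l).im, -(c + l).re)) (s := en z) (u := 6 * Λ * h) (by rw [eX]) ez2 hz ez
  have HY := ph_height (X := (c.im, -c.re)) (s := en w) (u := 6 * Λ * h) (by rw [eY]) (by linarith) hw (by linarith)
  refine ⟨_, _, HX.1, HY.1, eX, eY, ?_, HX.2.trans (by linarith), HY.2.trans (by linarith)⟩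
  have a1 := Complex.abs_re_le_norm l
  have a2 := Complex.abs_im_le_norm l
  apply nrm_le
  · simp; linarith
  · simp; linarith

lemma t_inv (a b x y z e : ℝ) (hab : 1 / 4 ≤ a ^ 2 + b ^ 2) (he : 0 ≤ e) (h1 : |t11 a b x y z| ≤ e) (h2 : |t12 a b x y z| ≤ e)
    (h3 : |t22 a b x y z| ≤ e) : |x| ≤ 8 * e ∧ |y| ≤ 8 * e ∧ |z| ≤ 8 * e := by
  have hs := t_sq a b x y z
  have q1 := (sq_le_sq' (neg_le_of_abs_le h1) (le_of_abs_le h1))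
  have q2 := (sq_le_sq' (neg_le_of_abs_le h2) (le_of_abs_le h2))
  have q3 := (sq_le_sq' (neg_le_of_abs_le h3) (le_of_abs_le h3))
  have h4 : (1:ℝ) / 16 ≤ (a ^ 2 + b ^ 2) ^ 2 := by nlinarith
  have hq : 0 ≤ x ^ 2 + 2 * y ^ 2 + z ^ 2 := by positivity
  have h5 : 1 / 16 * (x ^ 2 + 2 * y ^ 2 + z ^ 2) ≤ 4 * e ^ 2 := by
    have := mul_le_mul_of_nonneg_right h4 hq
    linarith
  have h6 : x ^ 2 + 2 * y ^ 2 + z ^ 2 ≤ (8 * e) ^ 2 := by linarith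
  refine ⟨abs_le_of_sq_le_sq (by nlinarith [sq_nonneg y, sq_nonneg z]) (by linarith),
    abs_le_of_sq_le_sq (by nlinarith [sq_nonneg x, sq_nonneg z, sq_nonneg y]) (by linarith),
    abs_le_of_sq_le_sq (by nlinarith [sq_nonneg y, sq_nonneg x]) (by linarith)⟩

set_option maxHeartbeats 1000000 in
lemma improve (K α : ℝ) (hK : 1 ≤ K) (hα : 0 < α) (hα1 : α < 1) (hαK : 2 * α < 1 / (64 * K)) :
    ∃ ε0, 0 < ε0 ∧ ∀ (J : Jet) (γ γ1 γ2 : ℝ → ℝ), J.On disc →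
    (∀ z ∈ disc, ∀ w ∈ disc, cone K 0 (J.f11 z - J.f11 w) (J.f12 z - J.f12 w) (J.f22 z - J.f22 w)) →
    J.Hold disc 1 α 2 → ContinuousOn J.f cdisc → (∀ z ∈ disc, |J.f z| ≤ ε0) →
    (∀ θ, J.f (Real.cos θ, Real.sin θ) = γ θ) → (∀ θ, HasDerivAt γ (γ1 θ) θ) → (∀ θ, HasDerivAt γ1 (γ2 θ) θ) →
    (∀ s t, |γ2 s - γ2 t| ≤ ε0 * |s - t| ^ α) → J.Hold disc (1/2) α 2 := by
  have hK4 : 2 * α < 1 / (4 * K) := hαK.trans_le (by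
    apply one_div_le_one_div_of_le <;> linarith)
  obtain ⟨Λ, hΛ, hinn⟩ := interior K α (1/2) hK hα hK4 (by norm_num)
  obtain ⟨ρ0, ε1, hρ0, hρ01, hε1, hfin⟩ := HP.fin (4 * K) (280 * K) α (1/192) (2 * Λ) hα
    (by rw [show 16 * (4 * K) = 64 * K by ring]; exact hαK) (by linarith) (by linarith) (by norm_num) (by linarith)
  obtain ⟨k, hk, hk1, hkp⟩ := small_pow (1 - α) (1/5376) (by linarith) (by norm_num) 1 one_pos
  set ρ := min (ρ0 / 6) (min (1 / (12 * Λ)) k) with hρ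
  have hρp : 0 < ρ := by
    apply lt_min (by linarith) (lt_min (by positivity) hk)
  have r1 : ρ ≤ ρ0 / 6 := min_le_left _ _
  have r2 : ρ ≤ 1 / (12 * Λ) := (min_le_right _ _).trans (min_le_left _ _)
  have r3 : ρ ≤ k := (min_le_right _ _).trans (min_le_right _ _)
  obtain ⟨ε2, hε2, hinterp⟩ := interp α (min 1 (ρ ^ α / 4)) hα hα1 (lt_min one_pos (by positivity))
  refine ⟨min ε1 ε2, lt_min hε1 hε2, ?_⟩
  intro J γ γ1 γ2 hJ hcone hH hc hf hγ hg1 hg2 hgh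
  have hI := hinterp J hJ hH (fun z hz => (hf z hz).trans (min_le_right _ _))
  have hb : J.Bd disc 1 :=
    ⟨fun z hz => (hI z hz).2.2.2.1.trans (min_le_left _ _), fun z hz => (hI z hz).2.2.2.2.trans (min_le_left _ _),
     fun z hz => (hI z hz).1.trans (min_le_left _ _), fun z hz => (hI z hz).2.1.trans (min_le_left _ _),
     fun z hz => (hI z hz).2.2.1.trans (min_le_left _ _)⟩
  have hHP := pol_HP hJ hb hK hα hα1.le hcone hH hc hγ hg1 hg2 hgh
  have main : ∀ z ∈ disc, ∀ w ∈ disc, |J.f11 z - J.f11 w| ≤ 1/2 * ‖z - w‖ ^ α ∧ |J.f12 z - J.f12 w| ≤ 1/2 * ‖z - w‖ ^ α ∧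
      |J.f22 z - J.f22 w| ≤ 1/2 * ‖z - w‖ ^ α := by
    intro z hz w hw
    by_cases c1 : en w + 4 * Λ * ‖z - w‖ < 1
    · have := hinn J hJ hcone hH w (z - w) c1
      simpa using this
    by_cases c2 : ρ ≤ ‖z - w‖
    · have hp : ρ ^ α ≤ ‖z - w‖ ^ α := Real.rpow_le_rpow hρp.le c2 hα.le
      have iz := hI z hz
      have iw := hI w hw
      have hm : min 1 (ρ ^ α / 4) ≤ ρ ^ α / 4 := min_le_right _ _
      refine ⟨(abs_sub _ _).trans ?_, (abs_sub _ _).trans ?_, (abs_sub _ _).trans ?_⟩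
      · linarith [iz.1, iw.1]
      · linarith [iz.2.1, iw.2.1]
      · linarith [iz.2.2.1, iw.2.2.1]
    push Not at c1 c2
    by_cases hzw : z = w
    · subst hzw
      simp [hα.ne']
    have hp : 0 < ‖z - w‖ := norm_pos_iff.2 (sub_ne_zero.2 hzw)
    have c3 : 12 * Λ * ‖z - w‖ ≤ 1 := by
      have := c2.le.trans r2
      rw [le_div_iff₀ (by linarith)] at this
      linarith
    obtain ⟨ez, X, Y, hX, hY, eX, eY, hXY, hX2, hY2⟩ := polar_pts z w Λ hz hw hΛ c1 c3
    have key := hfin (min ε1 ε2) (lt_min hε1 hε2) (min_le_left _ _) J.pol γ γ1 γ2 hHP (6 * ‖z - w‖) X Y (by linarith) (by linarith) hXY hX hY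
      (by linarith) (by linarith)
    have hN := pol_N hJ hb X Y hX hY
    rw [eX, eY] at hN
    have h6 : (6 * ‖z - w‖) ^ α ≤ 6 * ‖z - w‖ ^ α := by
      rw [Real.mul_rpow (by norm_num) hp.le]
      have : (6:ℝ) ^ α ≤ 6 := by
        calc (6:ℝ) ^ α ≤ 6 ^ (1:ℝ) := Real.rpow_le_rpow_of_exponent_le (by norm_num) hα1.le
          _ = 6 := Real.rpow_one _
      exact mul_le_mul_of_nonneg_right this (by positivity)
    have h7 : ‖z - w‖ ≤ 1/5376 * ‖z - w‖ ^ α := by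
      have e : ‖z - w‖ = ‖z - w‖ ^ (1 - α) * ‖z - w‖ ^ α := by
        rw [← Real.rpow_add hp]; simp
      have : ‖z - w‖ ^ (1 - α) ≤ 1/5376 := (Real.rpow_le_rpow hp.le (c2.le.trans r3) (by linarith)).trans hkp
      calc ‖z - w‖ = ‖z - w‖ ^ (1 - α) * ‖z - w‖ ^ α := e
        _ ≤ _ := mul_le_mul_of_nonneg_right this (by positivity)
    set e := 1/16 * ‖z - w‖ ^ α with he
    have tri : ∀ a b : ℝ, |a| ≤ 1/192 * (6 * ‖z - w‖) ^ α → |a - b| ≤ 28 * ‖X - Y‖ → |b| ≤ e := by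
      intro a b ha hab
      have : |b| ≤ |a| + |a - b| := by
        have := abs_sub a (a - b); rwa [sub_sub_cancel] at this
      linarith
    have ab : 1 / 4 ≤ pa X ^ 2 + pb X ^ 2 := by
      have h1 : en z = √(pa X ^ 2 + pb X ^ 2) := by rw [← eX]; rfl
      have h2 : en z ^ 2 = pa X ^ 2 + pb X ^ 2 := by rw [h1, Real.sq_sqrt (by positivity)]
      nlinarith
    have fin := t_inv (pa X) (pb X) _ _ _ e ab (by positivity) (tri _ _ key.1 hN.1) (tri _ _ key.2.1 hN.2.1) (tri _ _ key.2.2 hN.2.2)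
    have ee : 8 * e = 1/2 * ‖z - w‖ ^ α := by rw [he]; ring
    rw [ee] at fin
    exact fin
  exact ⟨fun z hz w hw _ => (main z hz w hw).1, fun z hz w hw _ => (main z hz w hw).2.1, fun z hz w hw _ => (main z hz w hw).2.2⟩

def Jet.scale (J : Jet) (c : ℝ) : Jet where
  f z := c * J.f z
  f1 z := c * J.f1 z
  f2 z := c * J.f2 z
  f11 z := c * J.f11 z
  f12 z := c * J.f12 z
  f22 z := c * J.f22 z

lemma Jet.On.scale {J : Jet} {Ω : Set (ℝ × ℝ)} (hJ : J.On Ω) (c : ℝ) : (J.scale c).On Ω :=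
  ⟨fun z hz => (hJ.d z hz).smul c, fun z hz => (hJ.d1 z hz).smul c, fun z hz => (hJ.d2 z hz).smul c⟩

lemma Jet.Hold.scale {J : Jet} {Ω : Set (ℝ × ℝ)} {C α d : ℝ} (hJ : J.Hold Ω C α d) (c : ℝ) (hc : 0 ≤ c) : (J.scale c).Hold Ω (c * C) α d := by
  have : ∀ a b n : ℝ, |a - b| ≤ C * n → |c * a - c * b| ≤ c * C * n := by
    intro a b n h
    rw [← mul_sub, abs_mul, abs_of_nonneg hc, mul_assoc]
    exact mul_le_mul_of_nonneg_left h hc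
  exact ⟨fun z hz w hw h => this _ _ _ (hJ.h11 z hz w hw h), fun z hz w hw h => this _ _ _ (hJ.h12 z hz w hw h),
    fun z hz w hw h => this _ _ _ (hJ.h22 z hz w hw h)⟩

lemma cone_scale {K a b c : ℝ} (h : cone K 0 a b c) (k : ℝ) : cone K 0 (k * a) (k * b) (k * c) := by
  unfold cone at *
  nlinarith [mul_le_mul_of_nonneg_left h (sq_nonneg k)]

lemma Jet.Hold.mono {J : Jet} {Ω : Set (ℝ × ℝ)} {C C' α d : ℝ} (hJ : J.Hold Ω C α d) (h : C ≤ C') : J.Hold Ω C' α d := by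
  have : ∀ (a : ℝ) (z : ℝ × ℝ), a ≤ C * ‖z‖ ^ α → a ≤ C' * ‖z‖ ^ α := fun a z ha =>
    ha.trans (mul_le_mul_of_nonneg_right h (by positivity))
  exact ⟨fun z hz w hw h => this _ _ (hJ.h11 z hz w hw h), fun z hz w hw h => this _ _ (hJ.h12 z hz w hw h),
    fun z hz w hw h => this _ _ (hJ.h22 z hz w hw h)⟩

set_option maxHeartbeats 1000000 in
lemma apriori (K α : ℝ) (hK : 1 ≤ K) (hα : 0 < α) (hα1 : α < 1) (hαK : 2 * α < 1 / (64 * K)) (M G : ℝ) (hM : 0 ≤ M) (hG : 0 ≤ G) :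
    ∃ C0, 0 < C0 ∧ ∀ (J : Jet) (γ γ1 γ2 : ℝ → ℝ), J.On disc →
    (∀ z ∈ disc, ∀ w ∈ disc, cone K 0 (J.f11 z - J.f11 w) (J.f12 z - J.f12 w) (J.f22 z - J.f22 w)) →
    (∃ H, J.Hold disc H α 2) → ContinuousOn J.f cdisc → (∀ z ∈ disc, |J.f z| ≤ M) →
    (∀ θ, J.f (Real.cos θ, Real.sin θ) = γ θ) → (∀ θ, HasDerivAt γ (γ1 θ) θ) → (∀ θ, HasDerivAt γ1 (γ2 θ) θ) →
    (∀ s t, |γ2 s - γ2 t| ≤ G * |s - t| ^ α) → J.Hold disc C0 α 2 := by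
  obtain ⟨ε0, hε, himp⟩ := improve K α hK hα hα1 hαK
  have hMG : 0 ≤ max M G := le_max_of_le_left hM
  refine ⟨max M G / ε0 + 1, by positivity, ?_⟩
  intro J γ γ1 γ2 hJ hcone hHold hc hf hγ hg1 hg2 hgh
  obtain ⟨H, hH⟩ := hHold
  set C0 := max M G / ε0 + 1 with hC0
  have C0p : 0 < C0 := by positivity
  have hC : max M G ≤ ε0 * C0 := by
    rw [hC0, mul_add, mul_div_cancel₀ _ hε.ne']; linarith
  have step : ∀ H, C0 ≤ H → J.Hold disc H α 2 → J.Hold disc (H / 2) α 2 := by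
    intro H hCH hH
    have Hp : 0 < H := C0p.trans_le hCH
    have hMH : max M G ≤ ε0 * H := hC.trans (mul_le_mul_of_nonneg_left hCH hε.le)
    have hMH' : H⁻¹ * max M G ≤ ε0 := by
      rw [inv_mul_le_iff₀ Hp]; linarith
    have h := himp (J.scale H⁻¹) (fun t => H⁻¹ * γ t) (fun t => H⁻¹ * γ1 t) (fun t => H⁻¹ * γ2 t) (hJ.scale _)
      (fun z hz w hw => by
        have := cone_scale (hcone z hz w hw) H⁻¹
        simpa only [Jet.scale, mul_sub] using this)
      (by have := hH.scale H⁻¹ (by positivity); rwa [inv_mul_cancel₀ Hp.ne'] at this)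
      (continuousOn_const.mul hc)
      (fun z hz => by
        show |H⁻¹ * J.f z| ≤ ε0
        rw [abs_mul, abs_of_pos (by positivity)]
        exact (mul_le_mul_of_nonneg_left ((hf z hz).trans (le_max_left M G)) (by positivity)).trans hMH')
      (fun θ => by show H⁻¹ * J.f _ = _; rw [hγ]) (fun θ => (hg1 θ).const_mul _) (fun θ => (hg2 θ).const_mul _)
      (fun s t => by
        rw [← mul_sub, abs_mul, abs_of_pos (show 0 < H⁻¹ by positivity)]
        have i1 : |γ2 s - γ2 t| ≤ max M G * |s - t| ^ α := (hgh s t).trans (mul_le_mul_of_nonneg_right (le_max_right _ _) (by positivity))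
        calc _ ≤ H⁻¹ * (max M G * |s - t| ^ α) := mul_le_mul_of_nonneg_left i1 (by positivity)
          _ = (H⁻¹ * max M G) * |s - t| ^ α := by ring
          _ ≤ _ := mul_le_mul_of_nonneg_right hMH' (by positivity))
    have h2 := h.scale H Hp.le
    have e : (J.scale H⁻¹).scale H = J := by
      simp [Jet.scale, Hp.ne']
    rw [e] at h2
    convert h2 using 1; ring
  have ind : ∀ n : ℕ, J.Hold disc (max C0 (H / 2 ^ n)) α 2 := by
    intro n
    induction n with
    | zero => simpa using hH.mono (le_max_right C0 H)
    | succ n ih =>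
      have := step _ (le_max_left _ _) ih
      refine this.mono ?_
      rw [div_le_iff₀ (by norm_num)]
      apply max_le
      · have := le_max_left C0 (H / 2 ^ (n + 1)); linarith
      · have := le_max_right C0 (H / 2 ^ (n + 1))
        have e : H / 2 ^ n = H / 2 ^ (n + 1) * 2 := by rw [pow_succ]; field_simp
        rw [e]; linarith
  obtain ⟨n, hn⟩ := pow_unbounded_of_one_lt (H / C0) (one_lt_two)
  refine (ind n).mono (max_le le_rfl ?_)
  rw [div_lt_iff₀ C0p] at hn
  rw [div_le_iff₀ (by positivity)]; linarith

end MC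

namespace MC
open intervalIntegral MeasureTheory Filter Topology

lemma Jet.Bd.scale_inv {J : Jet} {Ω : Set (ℝ × ℝ)} {c k : ℝ} (hk : 0 < k) (h : (J.scale k⁻¹).Bd Ω c) : J.Bd Ω (k * c) := by
  have : ∀ a : ℝ, |k⁻¹ * a| ≤ c → |a| ≤ k * c := by
    intro a ha
    rw [abs_mul, abs_of_pos (by positivity), inv_mul_le_iff₀ hk] at ha
    exact ha
  exact ⟨fun z hz => this _ (h.b1 z hz), fun z hz => this _ (h.b2 z hz), fun z hz => this _ (h.b11 z hz),
    fun z hz => this _ (h.b12 z hz), fun z hz => this _ (h.b22 z hz)⟩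

lemma interp_s (α C δ : ℝ) (hα : 0 < α) (hα1 : α < 1) (hC : 0 < C) (hδ : 0 < δ) : ∃ ε, 0 < ε ∧ ∀ J : Jet, J.On disc →
    J.Hold disc C α 2 → (∀ z ∈ disc, |J.f z| ≤ ε) → J.Bd disc δ := by
  obtain ⟨ε0, h0, h⟩ := interp α (δ / C) hα hα1 (by positivity)
  refine ⟨C * ε0, by positivity, ?_⟩
  intro J hJ hH hf
  have := h (J.scale C⁻¹) (hJ.scale _) (by
    have := hH.scale C⁻¹ (by positivity)
    rwa [inv_mul_cancel₀ hC.ne'] at this) (fun z hz => by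
      show |C⁻¹ * J.f z| ≤ ε0
      rw [abs_mul, abs_of_pos (by positivity), inv_mul_le_iff₀ hC]
      exact hf z hz)
  have hb : (J.scale C⁻¹).Bd disc (δ / C) :=
    ⟨fun z hz => (this z hz).2.2.2.1, fun z hz => (this z hz).2.2.2.2, fun z hz => (this z hz).1,
      fun z hz => (this z hz).2.1, fun z hz => (this z hz).2.2.1⟩
  have := hb.scale_inv hC
  rwa [mul_div_cancel₀ _ hC.ne'] at this

lemma bd_of (α C M : ℝ) (hα : 0 < α) (hα1 : α < 1) (hC : 0 < C) (hM : 0 ≤ M) : ∃ B, 0 < B ∧ ∀ J : Jet, J.On disc →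
    J.Hold disc C α 2 → (∀ z ∈ disc, |J.f z| ≤ M) → J.Bd disc B := by
  obtain ⟨ε, hε, h⟩ := interp_s α C 1 hα hα1 hC one_pos
  set k := M / ε + 1 with hk
  have kp : 0 < k := by positivity
  refine ⟨k * 1, by linarith, ?_⟩
  intro J hJ hH hf
  apply Jet.Bd.scale_inv kp
  apply h _ (hJ.scale _)
  · refine (hH.scale k⁻¹ (by positivity)).mono ?_
    have : k⁻¹ ≤ 1 := inv_le_one_of_one_le₀ (by rw [hk]; linarith [div_nonneg hM hε.le])
    nlinarith
  · intro z hz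
    show |k⁻¹ * J.f z| ≤ ε
    rw [abs_mul, abs_of_pos (by positivity), inv_mul_le_iff₀ kp]
    refine (hf z hz).trans ?_
    rw [hk, add_mul, div_mul_cancel₀ _ hε.ne']; linarith

lemma cdisc_eq : closure disc = cdisc := by
  apply Subset.antisymm
  · exact closure_minimal (fun z hz => dsub hz) (isClosed_le en_cont continuous_const)
  · intro z hz
    have hz' : en z ≤ 1 := hz
    have ht : Tendsto (fun r : ℝ => (r * z.1, r * z.2)) (𝓝[<] 1) (𝓝 z) := by
      have : Continuous (fun r : ℝ => (r * z.1, r * z.2)) := by fun_prop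
      have := this.tendsto 1
      simp only [one_mul] at this
      exact this.mono_left nhdsWithin_le_nhds
    refine mem_closure_of_tendsto ht ?_
    have : Ioo (0:ℝ) 1 ∈ 𝓝[<] (1:ℝ) := Ioo_mem_nhdsLT (by norm_num)
    filter_upwards [this] with r hr
    show en (r * z.1, r * z.2) < 1
    rw [en_smul, abs_of_pos hr.1]
    nlinarith [hr.1, hr.2, en_nonneg z]

lemma cdisc_convex : Convex ℝ cdisc := by rw [← cdisc_eq]; exact disc_convex.closure

lemma cdisc_unique : UniqueDiffOn ℝ cdisc := by
  apply uniqueDiffOn_convex cdisc_convex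
  refine ⟨0, ?_⟩
  have : disc ⊆ _root_.interior cdisc := interior_maximal (fun z hz => dsub hz) disc_open
  apply this
  show en 0 < 1
  simp [en]

lemma ext_hold (φ : ℝ × ℝ → ℝ) (C α : ℝ) (hα : 0 < α) (hC : 0 ≤ C)
    (h : ∀ z ∈ disc, ∀ w ∈ disc, |φ z - φ w| ≤ C * ‖z - w‖ ^ α) : ∃ φe : ℝ × ℝ → ℝ, ContinuousOn φe cdisc ∧ ∀ z ∈ disc, φe z = φ z := by
  have lim : ∀ x ∈ cdisc, ∃ y, Tendsto φ (𝓝[disc] x) (𝓝 y) := by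
    intro x hx
    rw [← cdisc_eq] at hx
    have : (𝓝[disc] x).NeBot := mem_closure_iff_nhdsWithin_neBot.1 hx
    have hca : Cauchy (map φ (𝓝[disc] x)) := by
      rw [Metric.cauchy_iff]
      refine ⟨inferInstance, ?_⟩
      intro ε hε
      obtain ⟨k, hk, -, hkp⟩ := small_pow α (ε / (2 * (C + 1))) hα (by positivity) 1 one_pos
      refine ⟨φ '' (disc ∩ ball x (k / 2)), image_mem_map ?_, ?_⟩
      · exact inter_mem_nhdsWithin _ (ball_mem_nhds _ (by positivity))
      · rintro _ ⟨z, ⟨hz, hzx⟩, rfl⟩ _ ⟨w, ⟨hw, hwx⟩, rfl⟩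
        have hd : ‖z - w‖ ≤ k := by
          rw [← dist_eq_norm]
          have := dist_triangle_right z w x
          rw [mem_ball] at hzx hwx
          linarith
        have h1 : ‖z - w‖ ^ α ≤ ε / (2 * (C + 1)) := (Real.rpow_le_rpow (norm_nonneg _) hd hα.le).trans hkp
        rw [Real.dist_eq]
        calc _ ≤ C * ‖z - w‖ ^ α := h z hz w hw
          _ ≤ C * (ε / (2 * (C + 1))) := mul_le_mul_of_nonneg_left h1 hC
          _ < ε := by
            rw [← mul_div_assoc, div_lt_iff₀ (by positivity)]; nlinarith
    exact CompleteSpace.complete hca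
  refine ⟨extendFrom disc φ, continuousOn_extendFrom cdisc_eq.ge lim, ?_⟩
  apply extendFrom_extends
  intro x hx
  obtain ⟨y, hy⟩ := lim x (dsub hx)
  have hh := h
  have := hold_cont φ disc C α 2 hα (by norm_num) (fun z hz w hw _ => h z hz w hw)
  exact this x hx

abbrev fs (a b : ℝ) : ℝ × ℝ →L[ℝ] ℝ := a • ContinuousLinearMap.fst ℝ ℝ ℝ + b • ContinuousLinearMap.snd ℝ ℝ ℝ

lemma bdry (f a b : ℝ × ℝ → ℝ) (hf : ContinuousOn f cdisc) (ha : ContinuousOn a cdisc) (hb : ContinuousOn b cdisc)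
    (h : ∀ z ∈ disc, HasG f (a z) (b z) z) : ∀ z ∈ cdisc, HasFDerivWithinAt f (fs (a z) (b z)) cdisc z := by
  intro z hz
  have := hasFDerivWithinAt_closure_of_tendsto_fderiv (f := f) (s := disc) (x := z) (f' := fs (a z) (b z))
    (fun w hw => (h w hw).differentiableAt.differentiableWithinAt) disc_convex disc_open
    (fun y hy => by
      rw [cdisc_eq] at hy
      exact (hf y hy).mono (fun z hz => dsub hz)) (by
      have hc : ContinuousOn (fun w => fs (a w) (b w)) cdisc := (ha.smul continuousOn_const).add (hb.smul continuousOn_const)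
      have h1 : Tendsto (fun w => fs (a w) (b w)) (𝓝[disc] z) (𝓝 (fs (a z) (b z))) :=
        (hc z hz).mono (fun z hz => dsub hz)
      refine h1.congr' ?_
      filter_upwards [self_mem_nhdsWithin] with w hw
      exact (h w hw).fderiv.symm)
  rwa [cdisc_eq] at this

lemma c1_ext (f a b : ℝ × ℝ → ℝ) (n : ℕ) (hf : ContinuousOn f cdisc) (ha : ContDiffOn ℝ n a cdisc) (hb : ContDiffOn ℝ n b cdisc)
    (h : ∀ z ∈ disc, HasG f (a z) (b z) z) : ContDiffOn ℝ (n + 1 : ℕ) f cdisc := by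
  push_cast
  rw [contDiffOn_succ_iff_hasFDerivWithinAt_of_uniqueDiffOn cdisc_unique]
  refine ⟨fun h => by simp at h, fun z => fs (a z) (b z), ?_, bdry f a b hf ha.continuousOn hb.continuousOn h⟩
  exact (ha.smul contDiffOn_const).add (hb.smul contDiffOn_const)

lemma HasG.congrOn {f g : ℝ × ℝ → ℝ} {a b a' b' : ℝ} {z : ℝ × ℝ} (hz : z ∈ disc) (h : HasG f a b z) (hg : ∀ z ∈ disc, g z = f z)
    (ha : a' = a) (hb : b' = b) : HasG g a' b' z := by
  subst ha hb
  refine HasFDerivAt.congr_of_eventuallyEq h ?_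
  filter_upwards [disc_open.mem_nhds hz] with w hw using hg w hw

lemma c2_ext (J : Jet) (C B α : ℝ) (hα : 0 < α) (hC : 0 ≤ C) (hJ : J.On disc) (hH : J.Hold disc C α 2) (hB : J.Bd disc B)
    (hf : ContinuousOn J.f cdisc) : ContDiffOn ℝ 2 J.f cdisc := by
  have B0 : 0 ≤ B := (abs_nonneg _).trans (hB.b1 0 (by show en 0 < 1; simp [en]))
  obtain ⟨e11, c11, q11⟩ := ext_hold J.f11 C α hα hC (fun z hz w hw => hH.h11 z hz w hw (disc_norm hz hw))
  obtain ⟨e12, c12, q12⟩ := ext_hold J.f12 C α hα hC (fun z hz w hw => hH.h12 z hz w hw (disc_norm hz hw))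
  obtain ⟨e22, c22, q22⟩ := ext_hold J.f22 C α hα hC (fun z hz w hw => hH.h22 z hz w hw (disc_norm hz hw))
  obtain ⟨e1, c1, q1⟩ := ext_hold J.f1 (2 * B) 1 one_pos (by linarith) (fun z hz w hw => by
    rw [Real.rpow_one]; exact lip disc disc_convex _ _ _ hJ.d1 B hB.b11 hB.b12 z w hz hw)
  obtain ⟨e2, c2, q2⟩ := ext_hold J.f2 (2 * B) 1 one_pos (by linarith) (fun z hz w hw => by
    rw [Real.rpow_one]; exact lip disc disc_convex _ _ _ hJ.d2 B hB.b12 hB.b22 z w hz hw)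
  have z0 : ∀ f : ℝ × ℝ → ℝ, ContinuousOn f cdisc → ContDiffOn ℝ (0:ℕ) f cdisc := fun f hf => by simpa using hf
  have k1 := c1_ext e1 e11 e12 0 c1 (z0 _ c11) (z0 _ c12) (fun z hz => (hJ.d1 z hz).congrOn hz q1 (q11 z hz) (q12 z hz))
  have k2 := c1_ext e2 e12 e22 0 c2 (z0 _ c12) (z0 _ c22) (fun z hz => (hJ.d2 z hz).congrOn hz q2 (q12 z hz) (q22 z hz))
  have := c1_ext J.f e1 e2 1 hf k1 k2 (fun z hz => (hJ.d z hz).congrOn hz (fun _ _ => rfl) (q1 z hz) (q2 z hz))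
  exact_mod_cast this

end MC

namespace MC
open intervalIntegral MeasureTheory Filter Topology

def Jet.sub (J L : Jet) : Jet where
  f z := J.f z - L.f z
  f1 z := J.f1 z - L.f1 z
  f2 z := J.f2 z - L.f2 z
  f11 z := J.f11 z - L.f11 z
  f12 z := J.f12 z - L.f12 z
  f22 z := J.f22 z - L.f22 z

lemma Jet.On.sub {J L : Jet} {Ω : Set (ℝ × ℝ)} (hJ : J.On Ω) (hL : L.On Ω) : (J.sub L).On Ω :=
  ⟨fun z hz => (hJ.d z hz).sub (hL.d z hz), fun z hz => (hJ.d1 z hz).sub (hL.d1 z hz), fun z hz => (hJ.d2 z hz).sub (hL.d2 z hz)⟩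

lemma Jet.Hold.sub {J L : Jet} {Ω : Set (ℝ × ℝ)} {C α d : ℝ} (hJ : J.Hold Ω C α d) (hL : L.Hold Ω C α d) : (J.sub L).Hold Ω (2 * C) α d := by
  have : ∀ a b c e n : ℝ, |a - b| ≤ C * n → |c - e| ≤ C * n → |(a - c) - (b - e)| ≤ 2 * C * n := by
    intro a b c e n h1 h2
    have e1 : (a - c) - (b - e) = (a - b) - (c - e) := by ring
    rw [e1]
    have := abs_sub (a - b) (c - e)
    linarith
  exact ⟨fun z hz w hw h => this _ _ _ _ _ (hJ.h11 z hz w hw h) (hL.h11 z hz w hw h),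
    fun z hz w hw h => this _ _ _ _ _ (hJ.h12 z hz w hw h) (hL.h12 z hz w hw h),
    fun z hz w hw h => this _ _ _ _ _ (hJ.h22 z hz w hw h) (hL.h22 z hz w hw h)⟩

/-- uniformly Cauchy real sequences have uniform limits -/
lemma ucauchy (φ : ℕ → ℝ × ℝ → ℝ) (h : ∀ δ > 0, ∃ N, ∀ m ≥ N, ∀ n ≥ N, ∀ z ∈ disc, |φ m z - φ n z| ≤ δ) :
    ∃ ψ : ℝ × ℝ → ℝ, TendstoUniformlyOn φ ψ atTop disc := by
  have hu : UniformCauchySeqOn φ atTop disc := by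
    rw [Metric.uniformCauchySeqOn_iff]
    intro ε hε
    obtain ⟨N, hN⟩ := h (ε / 2) (by linarith)
    refine ⟨N, fun m hm n hn z hz => ?_⟩
    rw [Real.dist_eq]
    linarith [hN m hm n hn z hz]
  have hl : ∀ z, ∃ y, z ∈ disc → Tendsto (fun n => φ n z) atTop (𝓝 y) := by
    intro z
    by_cases hz : z ∈ disc
    · obtain ⟨y, hy⟩ := cauchySeq_tendsto_of_complete (hu.cauchySeq hz)
      exact ⟨y, fun _ => hy⟩
    · exact ⟨0, fun h => absurd h hz⟩
  choose ψ hψ using hl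
  exact ⟨ψ, hu.tendstoUniformlyOn_of_tendsto hψ⟩

lemma unif_fs (a b : ℕ → ℝ × ℝ → ℝ) (A B : ℝ × ℝ → ℝ) (ha : TendstoUniformlyOn a A atTop disc) (hb : TendstoUniformlyOn b B atTop disc) :
    TendstoUniformlyOn (fun n z => fs (a n z) (b n z)) (fun z => fs (A z) (B z)) atTop disc := by
  rw [Metric.tendstoUniformlyOn_iff] at *
  intro ε hε
  filter_upwards [ha (ε / 3) (by linarith), hb (ε / 3) (by linarith)] with n h1 h2 z hz
  rw [dist_eq_norm]
  have e : fs (A z) (B z) - fs (a n z) (b n z) = fs (A z - a n z) (B z - b n z) := by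
    ext <;> simp [fs]
  rw [e]
  have h1 := h1 z hz
  have h2 := h2 z hz
  rw [Real.dist_eq] at h1 h2
  have : ‖fs (A z - a n z) (B z - b n z)‖ ≤ 2 * (ε / 3) := by
    refine ContinuousLinearMap.opNorm_le_bound _ (by linarith) (fun v => ?_)
    simp only [fs, ContinuousLinearMap.add_apply, ContinuousLinearMap.smul_apply, ContinuousLinearMap.coe_fst', ContinuousLinearMap.coe_snd', smul_eq_mul, Real.norm_eq_abs]
    refine (abs_add_le _ _).trans ?_
    rw [abs_mul, abs_mul]
    have i1 := mul_le_mul h1.le (fst_le v) (abs_nonneg _) (by linarith)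
    have i2 := mul_le_mul h2.le (snd_le v) (abs_nonneg _) (by linarith)
    linarith
  linarith

lemma lim_hasG (f a b : ℕ → ℝ × ℝ → ℝ) (F A B : ℝ × ℝ → ℝ) (hf : ∀ z ∈ disc, Tendsto (fun n => f n z) atTop (𝓝 (F z)))
    (ha : TendstoUniformlyOn a A atTop disc) (hb : TendstoUniformlyOn b B atTop disc)
    (h : ∀ n, ∀ z ∈ disc, HasG (f n) (a n z) (b n z) z) : ∀ z ∈ disc, HasG F (A z) (B z) z := fun z hz =>
  hasFDerivAt_of_tendstoUniformlyOn disc_open (unif_fs a b A B ha hb) h hf hz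

lemma lim_abs {φ : ℕ → ℝ × ℝ → ℝ} {ψ : ℝ × ℝ → ℝ} {c : ℝ} {z w : ℝ × ℝ} (hz : Tendsto (fun n => φ n z) atTop (𝓝 (ψ z)))
    (hw : Tendsto (fun n => φ n w) atTop (𝓝 (ψ w))) (h : ∀ n, |φ n z - φ n w| ≤ c) : |ψ z - ψ w| ≤ c :=
  le_of_tendsto (hz.sub hw).abs (Eventually.of_forall h)

/-- Arzela-Ascoli for Lipschitz functions on the closed disc -/
lemma aa (f : ℕ → ℝ × ℝ → ℝ) (B M : ℝ) (hB : 0 ≤ B) (hc : ∀ n, ContinuousOn (f n) cdisc) (hM : ∀ n, ∀ z ∈ disc, |f n z| ≤ M)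
    (hL : ∀ n, ∀ z ∈ disc, ∀ w ∈ disc, |f n z - f n w| ≤ B * ‖z - w‖) : ∃ (F : ℝ × ℝ → ℝ) (φ : ℕ → ℕ), StrictMono φ ∧
      ContinuousOn F cdisc ∧ TendstoUniformlyOn (fun n => f (φ n)) F atTop cdisc := by
  have : CompactSpace cdisc := isCompact_iff_compactSpace.1 cdisc_compact
  have hLc : ∀ n, LipschitzOnWith (Real.toNNReal B) (f n) cdisc := by
    intro n
    rw [← cdisc_eq]
    refine LipschitzOnWith.closure (by rw [cdisc_eq]; exact hc n) ?_
    refine LipschitzOnWith.of_dist_le_mul (fun z hz w hw => ?_)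
    rw [Real.dist_eq, dist_eq_norm, Real.coe_toNNReal _ hB]
    exact hL n z hz w hw
  have hMc : ∀ n, ∀ z ∈ cdisc, |f n z| ≤ M := by
    intro n z hz
    have hz' := hz
    rw [← cdisc_eq] at hz'
    have : (𝓝[disc] z).NeBot := mem_closure_iff_nhdsWithin_neBot.1 hz'
    refine le_of_tendsto (((hc n z hz).mono (fun z hz => dsub hz)).tendsto.abs) ?_
    filter_upwards [self_mem_nhdsWithin] with w hw using hM n w hw
  let g : ℕ → BoundedContinuousFunction cdisc ℝ := fun n =>
    BoundedContinuousFunction.mkOfCompact ⟨cdisc.domRestrict (f n), continuousOn_iff_continuous_domRestrict.1 (hc n)⟩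
  have hg : ∀ n (z : cdisc), g n z = f n z := fun n z => rfl
  have hcomp := BoundedContinuousFunction.arzela_ascoli (Icc (-M) M) isCompact_Icc (range g) (by
    rintro _ x ⟨n, rfl⟩
    exact abs_le.1 (hMc n x x.2)) (by
    apply Metric.equicontinuous_of_continuity_modulus (fun t => B * t)
    · have : Continuous (fun t : ℝ => B * t) := by fun_prop
      simpa using this.tendsto 0
    · rintro x y ⟨_, ⟨n, rfl⟩⟩
      have := (hLc n).dist_le_mul x x.2 y y.2
      rw [Real.coe_toNNReal _ hB] at this
      exact this)
  obtain ⟨G, -, φ, hφ, hG⟩ := hcomp.tendsto_subseq (x := g) (fun n => subset_closure ⟨n, rfl⟩)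
  rw [BoundedContinuousFunction.tendsto_iff_tendstoUniformly] at hG
  let F : ℝ × ℝ → ℝ := fun z => if h : z ∈ cdisc then G ⟨z, h⟩ else 0
  have hF : cdisc.domRestrict F = G := by
    funext z
    exact dif_pos z.2
  refine ⟨F, φ, hφ, ?_, ?_⟩
  · rw [continuousOn_iff_continuous_domRestrict, hF]; exact G.continuous
  · rw [tendstoUniformlyOn_iff_tendstoUniformly_comp_coe]
    have e : F ∘ ((↑) : cdisc → ℝ × ℝ) = G := hF
    rw [e]
    exact hG

set_option maxHeartbeats 1000000 in
lemma compact (J : ℕ → Jet) (C M α : ℝ) (hα : 0 < α) (hα1 : α < 1) (hC : 0 < C) (hM : 0 ≤ M) (hJ : ∀ n, (J n).On disc)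
    (hH : ∀ n, (J n).Hold disc C α 2) (hc : ∀ n, ContinuousOn (J n).f cdisc) (hf : ∀ n, ∀ z ∈ disc, |(J n).f z| ≤ M) :
    ∃ (L : Jet) (φ : ℕ → ℕ), StrictMono φ ∧ L.On disc ∧ L.Hold disc C α 2 ∧ ContDiffOn ℝ 2 L.f cdisc ∧
      (∀ z ∈ cdisc, Tendsto (fun n => (J (φ n)).f z) atTop (𝓝 (L.f z))) ∧
      (∀ z ∈ disc, Tendsto (fun n => (J (φ n)).f11 z) atTop (𝓝 (L.f11 z))) ∧
      (∀ z ∈ disc, Tendsto (fun n => (J (φ n)).f12 z) atTop (𝓝 (L.f12 z))) ∧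
      (∀ z ∈ disc, Tendsto (fun n => (J (φ n)).f22 z) atTop (𝓝 (L.f22 z))) := by
  obtain ⟨B, hB, hbd⟩ := bd_of α C M hα hα1 hC hM
  have hBd := fun n => hbd (J n) (hJ n) (hH n) (hf n)
  obtain ⟨F, φ, hφ, hFc, hF⟩ := aa (fun n => (J n).f) (2 * B) M (by linarith) hc hf
    (fun n z hz w hw => lip disc disc_convex _ _ _ (hJ n).d B (hBd n).b1 (hBd n).b2 z w hz hw)
  have cau : ∀ δ > 0, ∃ N, ∀ m ≥ N, ∀ n ≥ N, ((J (φ m)).sub (J (φ n))).Bd disc δ := by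
    intro δ hδ
    obtain ⟨ε, hε, h⟩ := interp_s α (2 * C) δ hα hα1 (by linarith) hδ
    rw [Metric.tendstoUniformlyOn_iff] at hF
    obtain ⟨N, hN⟩ := eventually_atTop.1 (hF (ε / 2) (by linarith))
    refine ⟨N, fun m hm n hn => h _ ((hJ _).sub (hJ _)) ((hH _).sub (hH _)) (fun z hz => ?_)⟩
    have h1 := hN m hm z (dsub hz)
    have h2 := hN n hn z (dsub hz)
    have := dist_triangle_left ((J (φ m)).f z) ((J (φ n)).f z) (F z)
    rw [Real.dist_eq ((J (φ m)).f z)] at this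
    show |(J (φ m)).f z - (J (φ n)).f z| ≤ ε
    linarith
  obtain ⟨l1, h1⟩ := ucauchy (fun n => (J (φ n)).f1) (fun δ hδ => by
    obtain ⟨N, hN⟩ := cau δ hδ
    exact ⟨N, fun m hm n hn => (hN m hm n hn).b1⟩)
  obtain ⟨l2, h2⟩ := ucauchy (fun n => (J (φ n)).f2) (fun δ hδ => by
    obtain ⟨N, hN⟩ := cau δ hδ
    exact ⟨N, fun m hm n hn => (hN m hm n hn).b2⟩)
  obtain ⟨l11, h11⟩ := ucauchy (fun n => (J (φ n)).f11) (fun δ hδ => by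
    obtain ⟨N, hN⟩ := cau δ hδ
    exact ⟨N, fun m hm n hn => (hN m hm n hn).b11⟩)
  obtain ⟨l12, h12⟩ := ucauchy (fun n => (J (φ n)).f12) (fun δ hδ => by
    obtain ⟨N, hN⟩ := cau δ hδ
    exact ⟨N, fun m hm n hn => (hN m hm n hn).b12⟩)
  obtain ⟨l22, h22⟩ := ucauchy (fun n => (J (φ n)).f22) (fun δ hδ => by
    obtain ⟨N, hN⟩ := cau δ hδ
    exact ⟨N, fun m hm n hn => (hN m hm n hn).b22⟩)
  have on : (⟨F, l1, l2, l11, l12, l22⟩ : Jet).On disc :=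
    ⟨lim_hasG _ _ _ _ _ _ (fun z hz => hF.tendsto_at (dsub hz)) h1 h2 (fun n => (hJ (φ n)).d),
     lim_hasG _ _ _ _ _ _ (fun z hz => h1.tendsto_at hz) h11 h12 (fun n => (hJ (φ n)).d1),
     lim_hasG _ _ _ _ _ _ (fun z hz => h2.tendsto_at hz) h12 h22 (fun n => (hJ (φ n)).d2)⟩
  have ho : (⟨F, l1, l2, l11, l12, l22⟩ : Jet).Hold disc C α 2 :=
    ⟨fun z hz w hw h => lim_abs (h11.tendsto_at hz) (h11.tendsto_at hw) (fun n => (hH (φ n)).h11 z hz w hw h),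
     fun z hz w hw h => lim_abs (h12.tendsto_at hz) (h12.tendsto_at hw) (fun n => (hH (φ n)).h12 z hz w hw h),
     fun z hz w hw h => lim_abs (h22.tendsto_at hz) (h22.tendsto_at hw) (fun n => (hH (φ n)).h22 z hz w hw h)⟩
  have hFM : ∀ z ∈ disc, |F z| ≤ M := fun z hz => le_of_tendsto (hF.tendsto_at (dsub hz)).abs (Eventually.of_forall (fun n => hf (φ n) z hz))
  have bd := hbd _ on ho hFM
  exact ⟨_, φ, hφ, on, ho, c2_ext _ C B α hα hC.le on ho bd hFc, fun z hz => hF.tendsto_at hz, fun z hz => h11.tendsto_at hz,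
    fun z hz => h12.tendsto_at hz, fun z hz => h22.tendsto_at hz⟩

end MC

namespace MC
open intervalIntegral MeasureTheory Filter Topology

def T : E2 ≃L[ℝ] ℝ × ℝ := (EuclideanSpace.equiv (Fin 2) ℝ).trans (ContinuousLinearEquiv.finTwoArrow ℝ ℝ)

lemma T_apply (x : E2) : T x = (x 0, x 1) := rfl
lemma Ts_circ (t : ℝ) : T.symm (Real.cos t, Real.sin t) = circPt t := rfl

lemma T_norm (x : E2) : ‖x‖ = en (T x) := by
  rw [EuclideanSpace.norm_eq, Fin.sum_univ_two, T_apply, en]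
  simp

lemma Ts_norm (z : ℝ × ℝ) : ‖T.symm z‖ = en z := by rw [T_norm, ContinuousLinearEquiv.apply_symm_apply]

abbrev ev (i : Fin 2) : E2 := EuclideanSpace.single i 1

lemma Ts_split (v : ℝ × ℝ) : T.symm v = v.1 • ev 0 + v.2 • ev 1 := by
  apply T.injective
  rw [ContinuousLinearEquiv.apply_symm_apply]
  simp [T_apply]

lemma hasG_T {v : E2 → ℝ} {v' : E2 →L[ℝ] ℝ} {z : ℝ × ℝ} (h : HasFDerivAt v v' (T.symm z)) :
    HasG (fun w => v (T.symm w)) (v' (ev 0)) (v' (ev 1)) z := by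
  have := HasFDerivAt.comp z h T.symm.hasFDerivAt
  refine HasFDerivAt.congr_fderiv this ?_
  refine ContinuousLinearMap.ext (fun w => ?_)
  show v' (T.symm w) = _
  rw [Ts_split]
  simp [mul_comm]

def jetOf (u : E2 → ℝ) : Jet where
  f z := u (T.symm z)
  f1 z := fderiv ℝ u (T.symm z) (ev 0)
  f2 z := fderiv ℝ u (T.symm z) (ev 1)
  f11 z := hess u (T.symm z) 0 0
  f12 z := hess u (T.symm z) 0 1
  f22 z := hess u (T.symm z) 1 1

lemma Ts_ball {z : ℝ × ℝ} (hz : z ∈ disc) : T.symm z ∈ ball (0 : E2) 1 := by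
  rw [mem_ball_zero_iff, Ts_norm]; exact hz
lemma T_disc {x : E2} (hx : x ∈ ball (0 : E2) 1) : T x ∈ disc := by
  rw [mem_ball_zero_iff, T_norm] at hx; exact hx

lemma cda {u : E2 → ℝ} (hu : ContDiffOn ℝ 2 u (closedBall (0 : E2) 1)) {x : E2} (hx : x ∈ ball (0 : E2) 1) : ContDiffAt ℝ 2 u x :=
  hu.contDiffAt (mem_of_superset (isOpen_ball.mem_nhds hx) ball_subset_closedBall)

lemma cda1 {u : E2 → ℝ} (hu : ContDiffOn ℝ 2 u (closedBall (0 : E2) 1)) {x : E2} (hx : x ∈ ball (0 : E2) 1) :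
    DifferentiableAt ℝ (fderiv ℝ u) x :=
  ((cda hu hx).fderiv_right (m := 1) (by norm_num)).differentiableAt (by norm_num)

lemma hess_eq {u : E2 → ℝ} (hu : ContDiffOn ℝ 2 u (closedBall (0 : E2) 1)) {x : E2} (hx : x ∈ ball (0 : E2) 1) (i j : Fin 2) :
    hess u x i j = fderiv ℝ (fderiv ℝ u) x (ev i) (ev j) := by
  show fderiv ℝ (fun y => fderiv ℝ u y (ev j)) x (ev i) = _
  rw [fderiv_clm_apply (cda1 hu hx) (differentiableAt_const _)]
  simp

lemma hess_symm {u : E2 → ℝ} (hu : ContDiffOn ℝ 2 u (closedBall (0 : E2) 1)) {x : E2} (hx : x ∈ ball (0 : E2) 1) (i j : Fin 2) :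
    hess u x i j = hess u x j i := by
  rw [hess_eq hu hx, hess_eq hu hx]
  exact ((cda hu hx).isSymmSndFDerivAt (by simp)).eq _ _

lemma hess_d {u : E2 → ℝ} (hu : ContDiffOn ℝ 2 u (closedBall (0 : E2) 1)) {z : ℝ × ℝ} (hz : z ∈ disc) (j : Fin 2) :
    HasG (fun w => fderiv ℝ u (T.symm w) (ev j)) (hess u (T.symm z) 0 j) (hess u (T.symm z) 1 j) z :=
  hasG_T (v := fun y => fderiv ℝ u y (ev j)) ((cda1 hu (Ts_ball hz)).clm_apply (differentiableAt_const _)).hasFDerivAt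

lemma jetOf_on {u : E2 → ℝ} (hu : ContDiffOn ℝ 2 u (closedBall (0 : E2) 1)) : (jetOf u).On disc where
  d z hz := hasG_T ((cda hu (Ts_ball hz)).differentiableAt (by norm_num)).hasFDerivAt
  d1 z hz := (hess_d hu hz 0).congr' rfl (hess_symm hu (Ts_ball hz) 1 0)
  d2 z hz := hess_d hu hz 1

lemma jetOf_cont {u : E2 → ℝ} (hu : ContDiffOn ℝ 2 u (closedBall (0 : E2) 1)) : ContinuousOn (jetOf u).f cdisc := by
  refine hu.continuousOn.comp T.symm.continuous.continuousOn (fun z hz => ?_)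
  rw [mem_closedBall_zero_iff, Ts_norm]; exact hz

lemma entry_le (A : Mat2) (i j : Fin 2) : |A i j| ≤ matNorm A := by
  unfold matNorm
  calc |A i j| ≤ ∑ j, |A i j| := Finset.single_le_sum (f := fun j => |A i j|) (fun _ _ => abs_nonneg _) (Finset.mem_univ j)
    _ ≤ _ := Finset.single_le_sum (f := fun i => ∑ j, |A i j|) (fun _ _ => Finset.sum_nonneg (fun _ _ => abs_nonneg _)) (Finset.mem_univ i)

lemma jetOf_hold {u : E2 → ℝ} {H α : ℝ} (hα : 0 < α) (h : ∀ x ∈ ball (0 : E2) 1, ∀ y ∈ ball (0 : E2) 1,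
      matNorm (hess u x - hess u y) ≤ H * ‖x - y‖ ^ α) : (jetOf u).Hold disc (|H| * 2 ^ α) α 2 := by
  have key : ∀ i j, ∀ z ∈ disc, ∀ w ∈ disc, |hess u (T.symm z) i j - hess u (T.symm w) i j| ≤ |H| * 2 ^ α * ‖z - w‖ ^ α := by
    intro i j z hz w hw
    have h1 := (entry_le (hess u (T.symm z) - hess u (T.symm w)) i j).trans (h _ (Ts_ball hz) _ (Ts_ball hw))
    rw [← map_sub, Ts_norm] at h1
    refine h1.trans ?_
    rw [mul_assoc, ← Real.mul_rpow (by norm_num) (norm_nonneg _)]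
    refine mul_le_mul (le_abs_self _) (Real.rpow_le_rpow (en_nonneg _) (en_le _) hα.le) (Real.rpow_nonneg (en_nonneg _) _) (abs_nonneg _)
  exact ⟨fun z hz w hw _ => key 0 0 z hz w hw, fun z hz w hw _ => key 0 1 z hz w hw, fun z hz w hw _ => key 1 1 z hz w hw⟩

lemma pn (A : Mat2) (hA : A.IsHermitian) : ∃ x y : ℝ, x + y = A 0 0 + A 1 1 ∧ x * y = A 0 0 * A 1 1 - A 0 1 ^ 2 ∧
    posNorm A = max x 0 + max y 0 ∧ negNorm A = max (-x) 0 + max (-y) 0 := by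
  refine ⟨hA.eigenvalues 0, hA.eigenvalues 1, ?_, ?_, ?_, ?_⟩
  · have := hA.trace_eq_sum_eigenvalues
    simp [Fin.sum_univ_two, Matrix.trace] at this
    exact this.symm
  · have := hA.det_eq_prod_eigenvalues
    simp [Fin.prod_univ_two, Matrix.det_fin_two] at this
    have h10 : A 1 0 = A 0 1 := by have := hA.apply 0 1; simpa using this
    rw [← this, h10]; ring
  · rw [posNorm, dif_pos hA, Fin.sum_univ_two]
  · rw [negNorm, dif_pos hA, Fin.sum_univ_two]

lemma pn_neg (A : Mat2) (hA : A.IsHermitian) : posNorm (-A) = negNorm A ∧ negNorm (-A) = posNorm A := by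
  obtain ⟨x, y, h1, h2, h3, h4⟩ := pn A hA
  obtain ⟨x', y', k1, k2, k3, k4⟩ := pn (-A) hA.neg
  simp at k1 k2
  have e : (x' + x) * (x' + y) = 0 := by
    have : x' + y' = -(x + y) := by linarith
    have h5 : x' * y' = x * y := by linarith
    have : y' = -(x + y) - x' := by linarith
    rw [this] at h5
    linarith
  rw [h3, h4, k3, k4]
  rcases mul_eq_zero.1 e with h | h
  · have a : x' = -x := by linarith
    have b : y' = -y := by linarith
    rw [a, b]; simp
  · have a : x' = -y := by linarith
    have b : y' = -x := by linarith
    rw [a, b]; simp [add_comm]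

lemma pn_cone (A : Mat2) (hA : A.IsHermitian) (l L : ℝ) (hl : 0 < l) (hL : l ≤ L) (h1 : l * negNorm A ≤ L * posNorm A)
    (h2 : l * posNorm A ≤ L * negNorm A) : cone (2 * L / l) 0 (A 0 0) (A 0 1) (A 1 1) := by
  obtain ⟨x, y, s, p, hp, hn⟩ := pn A hA
  rw [hp, hn] at h1 h2
  have goal : x ^ 2 + y ^ 2 ≤ -(2 * L / l) * (x * y) := by
    have e : -(2 * L / l) * (x * y) = (-(2 * L) * (x * y)) / l := by field_simp
    rw [e, le_div_iff₀ hl]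
    rcases le_total 0 x with hx | hx <;> rcases le_total 0 y with hy | hy
    · rw [max_eq_left hx, max_eq_left hy, max_eq_right (by linarith : -x ≤ 0), max_eq_right (by linarith : -y ≤ 0)] at h1 h2
      have : x + y ≤ 0 := by nlinarith
      have a : x = 0 := by linarith
      have b : y = 0 := by linarith
      simp [a, b]
    · rw [max_eq_left hx, max_eq_right hy, max_eq_right (by linarith : -x ≤ 0), max_eq_left (by linarith : 0 ≤ -y)] at h1 h2
      nlinarith
    · rw [max_eq_right hx, max_eq_left hy, max_eq_left (by linarith : 0 ≤ -x), max_eq_right (by linarith : -y ≤ 0)] at h1 h2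
      nlinarith
    · rw [max_eq_right hx, max_eq_right hy, max_eq_left (by linarith : 0 ≤ -x), max_eq_left (by linarith : 0 ≤ -y)] at h1 h2
      have : -x + -y ≤ 0 := by nlinarith
      have a : x = 0 := by linarith
      have b : y = 0 := by linarith
      simp [a, b]
  unfold cone
  have e1 : A 0 0 ^ 2 + 2 * A 0 1 ^ 2 + A 1 1 ^ 2 = x ^ 2 + y ^ 2 := by
    have : (x + y) ^ 2 = (A 0 0 + A 1 1) ^ 2 := by rw [s]
    linarith
  rw [e1, ← p]; linarith

lemma pn_half (F : Mat2 → ℝ) (lam Lam t : ℝ) (ht : t ∈ Icc (0:ℝ) 1) (hF : UniformlyElliptic lam Lam F) (M N : Mat2)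
    (hM : M.IsHermitian) (hN : N.IsHermitian) (eM : t * F M + (1 - t) * (M 0 0 + M 1 1) = 0)
    (eN : t * F N + (1 - t) * (N 0 0 + N 1 1) = 0) : min lam 1 * negNorm (M - N) ≤ max Lam 1 * posNorm (M - N) := by
  have h := hF M N hM hN
  obtain ⟨x, y, s, p, hp, hn⟩ := pn (M - N) (hM.sub hN)
  have tr : x + y = posNorm (M - N) - negNorm (M - N) := by
    rw [hp, hn]
    have : ∀ x : ℝ, max x 0 - max (-x) 0 = x := fun x => by
      rcases le_total 0 x with h | h
      · rw [max_eq_left h, max_eq_right (by linarith)]; ring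
      · rw [max_eq_right h, max_eq_left (by linarith)]; ring
    linarith [this x, this y]
  have P0 : 0 ≤ posNorm (M - N) := by rw [hp]; positivity
  have N0 : 0 ≤ negNorm (M - N) := by rw [hn]; positivity
  simp only [Matrix.sub_apply] at s
  set P := posNorm (M - N)
  set Q := negNorm (M - N)
  have h1 : 0 ≤ t * (Lam * P - lam * Q) + (1 - t) * (P - Q) := by
    have := mul_le_mul_of_nonneg_left h ht.1
    have e : (1 - t) * (P - Q) = (1 - t) * (M 0 0 + M 1 1) - (1 - t) * (N 0 0 + N 1 1) := by rw [← tr, s]; ring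
    rw [e]; linarith
  have m1 := min_le_left lam 1
  have m2 := min_le_right lam 1
  have m3 := le_max_left Lam 1
  have m4 := le_max_right Lam 1
  have i1 : Lam * P - lam * Q ≤ max Lam 1 * P - min lam 1 * Q := by nlinarith
  have i2 : P - Q ≤ max Lam 1 * P - min lam 1 * Q := by nlinarith
  have i3 := mul_le_mul_of_nonneg_left i1 ht.1
  have i4 := mul_le_mul_of_nonneg_left i2 (by linarith [ht.2] : 0 ≤ 1 - t)
  linarith

lemma sol_cone (F : Mat2 → ℝ) (lam Lam t : ℝ) (hlam : 0 < lam) (ht : t ∈ Icc (0:ℝ) 1) (hF : UniformlyElliptic lam Lam F) (M N : Mat2)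
    (hM : M.IsHermitian) (hN : N.IsHermitian) (eM : t * F M + (1 - t) * (M 0 0 + M 1 1) = 0)
    (eN : t * F N + (1 - t) * (N 0 0 + N 1 1) = 0) :
    cone (2 * max Lam 1 / min lam 1) 0 (M 0 0 - N 0 0) (M 0 1 - N 0 1) (M 1 1 - N 1 1) := by
  have h1 := pn_half F lam Lam t ht hF M N hM hN eM eN
  have h2 := pn_half F lam Lam t ht hF N M hN hM eN eM
  have e := pn_neg (M - N) (hM.sub hN)
  rw [neg_sub] at e
  rw [e.1, e.2] at h2
  exact pn_cone (M - N) (hM.sub hN) _ _ (lt_min hlam one_pos) ((min_le_right _ _).trans (le_max_right _ _)) h1 h2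

end MC

namespace MC
open intervalIntegral MeasureTheory Filter Topology

lemma fd_T {f : ℝ × ℝ → ℝ} {a b : ℝ} {x : E2} (h : HasG f a b (T x)) :
    HasFDerivAt (fun y => f (T y)) ((fs a b).comp (T : E2 →L[ℝ] ℝ × ℝ)) x :=
  HasFDerivAt.comp x h T.hasFDerivAt

lemma fs_ev (a b : ℝ) : ((fs a b).comp (T : E2 →L[ℝ] ℝ × ℝ)) (ev 0) = a ∧ ((fs a b).comp (T : E2 →L[ℝ] ℝ × ℝ)) (ev 1) = b := by
  constructor <;> simp [fs, T_apply]

lemma hess_of {L : Jet} (hL : L.On disc) {x : E2} (hx : x ∈ ball (0 : E2) 1) :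
    hess (fun y => L.f (T y)) x = !![L.f11 (T x), L.f12 (T x); L.f12 (T x), L.f22 (T x)] := by
  have e0 : (fun y => fderiv ℝ (fun y => L.f (T y)) y (ev 0)) =ᶠ[𝓝 x] fun y => L.f1 (T y) := by
    filter_upwards [isOpen_ball.mem_nhds hx] with y hy
    rw [(fd_T (hL.d _ (T_disc hy))).fderiv]; exact (fs_ev _ _).1
  have e1 : (fun y => fderiv ℝ (fun y => L.f (T y)) y (ev 1)) =ᶠ[𝓝 x] fun y => L.f2 (T y) := by
    filter_upwards [isOpen_ball.mem_nhds hx] with y hy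
    rw [(fd_T (hL.d _ (T_disc hy))).fderiv]; exact (fs_ev _ _).2
  have d0 := e0.fderiv_eq.trans (fd_T (hL.d1 _ (T_disc hx))).fderiv
  have d1 := e1.fderiv_eq.trans (fd_T (hL.d2 _ (T_disc hx))).fderiv
  ext i j
  fin_cases i <;> fin_cases j
  · show fderiv ℝ (fun y => fderiv ℝ (fun y => L.f (T y)) y (ev 0)) x (ev 0) = _
    rw [d0]; exact (fs_ev _ _).1
  · show fderiv ℝ (fun y => fderiv ℝ (fun y => L.f (T y)) y (ev 1)) x (ev 0) = _
    rw [d1]; exact (fs_ev _ _).1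
  · show fderiv ℝ (fun y => fderiv ℝ (fun y => L.f (T y)) y (ev 0)) x (ev 1) = _
    rw [d0]; exact (fs_ev _ _).2
  · show fderiv ℝ (fun y => fderiv ℝ (fun y => L.f (T y)) y (ev 1)) x (ev 1) = _
    rw [d1]; exact (fs_ev _ _).2

lemma hess_jet {u : E2 → ℝ} (hu : ContDiffOn ℝ 2 u (closedBall (0 : E2) 1)) {z : ℝ × ℝ} (hz : z ∈ disc) :
    hess u (T.symm z) = !![(jetOf u).f11 z, (jetOf u).f12 z; (jetOf u).f12 z, (jetOf u).f22 z] := by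
  ext i j
  fin_cases i <;> fin_cases j
  · rfl
  · rfl
  · exact hess_symm hu (Ts_ball hz) 1 0
  · rfl

lemma lapl_eq (u : E2 → ℝ) (x : E2) : lapl u x = hess u x 0 0 + hess u x 1 1 := by
  rw [lapl, Fin.sum_univ_two]

lemma mk_herm (a b c : ℝ) : (!![a, b; b, c] : Mat2).IsHermitian := by
  ext i j
  fin_cases i <;> fin_cases j <;> simp

lemma gam_bd (γ : ℝ → ℝ) (hc : Continuous γ) (hp : ∀ t, γ (t + 2 * π) = γ t) : ∃ M, 0 ≤ M ∧ ∀ t, |γ t| ≤ M := by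
  have hper : Function.Periodic γ (2 * π) := hp
  have := hper.compact_of_continuous (by positivity) hc
  obtain ⟨M, hM⟩ := this.isBounded.exists_norm_le
  exact ⟨M, (norm_nonneg _).trans (hM (γ 0) ⟨0, rfl⟩), fun t => hM _ ⟨t, rfl⟩⟩

lemma sphere_param {z : ℝ × ℝ} (hz : en z = 1) (f : ℝ × ℝ → ℝ) (γ : ℝ → ℝ) (M : ℝ) (h : ∀ θ, f (Real.cos θ, Real.sin θ) = γ θ)
    (hM : ∀ t, |γ t| ≤ M) : |f z| ≤ M := by
  obtain ⟨θ, rfl⟩ := circle_param z hz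
  rw [h]; exact hM θ

lemma sup_bd (J : Jet) (K α M : ℝ) (γ : ℝ → ℝ) (hK : 0 < K) (hα : 0 < α) (hJ : J.On disc) (hc : ContinuousOn J.f cdisc)
    (hcone : ∀ z ∈ disc, cone K 0 (J.f11 z) (J.f12 z) (J.f22 z)) (hH : ∃ H, J.Hold disc H α 2)
    (h : ∀ θ, J.f (Real.cos θ, Real.sin θ) = γ θ) (hM : ∀ t, |γ t| ≤ M) : ∀ z ∈ disc, |J.f z| ≤ M := by
  obtain ⟨H, hH⟩ := hH
  have c11 := hold_cont J.f11 disc H α 2 hα (by norm_num) hH.h11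
  have c12 := hold_cont J.f12 disc H α 2 hα (by norm_num) hH.h12
  have c22 := hold_cont J.f22 disc H α 2 hα (by norm_num) hH.h22
  have up := maxp J hJ K M hK hc hcone c11 c12 c22 (fun z hz => (le_abs_self _).trans (sphere_param hz J.f γ M h hM))
  have dn := maxp (J.scale (-1)) (hJ.scale _) K M hK (continuousOn_const.mul hc) (fun z hz => cone_scale (hcone z hz) (-1))
    (continuousOn_const.mul c11) (continuousOn_const.mul c12) (continuousOn_const.mul c22) (fun z hz => by
      show -1 * J.f z ≤ M
      linarith [neg_le_abs (J.f z), sphere_param hz J.f γ M h hM])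
  intro z hz
  have a := up z hz
  have b : -1 * J.f z ≤ M := dn z hz
  rw [abs_le]; constructor <;> linarith

end MC

set_option maxHeartbeats 1000000 in
open MC Filter Topology in
theorem method_of_continuity_closed (lam Lam : ℝ) (hlam : 0 < lam) (hLam : lam ≤ Lam) :
    ∃ α : ℝ, α ∈ Set.Ioo (0 : ℝ) 1 ∧
      ∀ (F : Mat2 → ℝ) (g : E2 → ℝ),
        ContDiff ℝ 2 (fun A : Fin 2 → Fin 2 → ℝ => F (Matrix.of A)) →
        UniformlyElliptic lam Lam F → F 0 = 0 →
        MemHolderCircle α g →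
        ∀ tseq : ℕ → ℝ, (∀ m, tseq m ∈ Icc (0 : ℝ) 1 ∧ SolvesAt α F g (tseq m)) →
          ∀ tbar ∈ Icc (0 : ℝ) 1, Filter.Tendsto tseq Filter.atTop (nhds tbar) →
            SolvesAt α F g tbar := by
  set K := 2 * max Lam 1 / min lam 1 with hKdef
  have hmin : 0 < min lam 1 := lt_min hlam one_pos
  have hK : 1 ≤ K := by
    rw [hKdef, le_div_iff₀ hmin]
    linarith [min_le_right lam 1, le_max_right Lam 1]
  have hα : 0 < 1 / (256 * K) := by positivity
  have hα1 : 1 / (256 * K) < 1 := by rw [div_lt_one (by positivity)]; linarith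
  have hαK : 2 * (1 / (256 * K)) < 1 / (64 * K) := by
    rw [mul_one_div, div_lt_div_iff₀ (by positivity) (by positivity)]; linarith
  refine ⟨1 / (256 * K), ⟨hα, hα1⟩, ?_⟩
  generalize 1 / (256 * K) = α at hα hα1 hαK
  intro F g hFc hFe hF0 hg tseq hseq tbar htbar hlim
  obtain ⟨hg2, G, hG⟩ := hg
  set γ := onCircle g with hγdef
  have hgd : ∀ θ, HasDerivAt γ (deriv γ θ) θ := fun θ => (hg2.differentiable (by norm_num) θ).hasDerivAt
  have hg1 : ContDiff ℝ 1 (deriv γ) := by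
    have : ContDiff ℝ (1 + 1) γ := by norm_num; exact hg2
    exact (contDiff_succ_iff_deriv.1 this).2.2
  have hgdd : ∀ θ, HasDerivAt (deriv γ) (deriv (deriv γ) θ) θ := fun θ => (hg1.differentiable (by norm_num) θ).hasDerivAt
  have hGm : ∀ s t, |deriv (deriv γ) s - deriv (deriv γ) t| ≤ |G| * |s - t| ^ α := fun s t =>
    (hG s t).trans (mul_le_mul_of_nonneg_right (le_abs_self _) (Real.rpow_nonneg (abs_nonneg _) _))
  obtain ⟨M, hM0, hM⟩ := gam_bd γ hg2.continuous (fun t => by simp [hγdef, onCircle, circPt])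
  obtain ⟨C, hC, hap⟩ := apriori K α hK hα hα1 hαK M |G| hM0 (abs_nonneg _)
  choose u hu hhold heq hbd using fun m => (hseq m).2
  have hN : ∀ m, ∀ z ∈ disc, tseq m * F !![(jetOf (u m)).f11 z, (jetOf (u m)).f12 z; (jetOf (u m)).f12 z, (jetOf (u m)).f22 z]
      + (1 - tseq m) * ((jetOf (u m)).f11 z + (jetOf (u m)).f22 z) = 0 := by
    intro m z hz
    have := heq m _ (Ts_ball hz)
    rw [lapl_eq, hess_jet (hu m) hz] at this
    simpa using this
  have hcone : ∀ m, ∀ z ∈ disc, ∀ w ∈ disc, cone K 0 ((jetOf (u m)).f11 z - (jetOf (u m)).f11 w)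
      ((jetOf (u m)).f12 z - (jetOf (u m)).f12 w) ((jetOf (u m)).f22 z - (jetOf (u m)).f22 w) := by
    intro m z hz w hw
    have := sol_cone F lam Lam (tseq m) hlam (hseq m).1 hFe _ _ (mk_herm _ _ _) (mk_herm _ _ _) (by simpa using hN m z hz)
      (by simpa using hN m w hw)
    simpa using this
  have hcone0 : ∀ m, ∀ z ∈ disc, cone K 0 ((jetOf (u m)).f11 z) ((jetOf (u m)).f12 z) ((jetOf (u m)).f22 z) := by
    intro m z hz
    have := sol_cone F lam Lam (tseq m) hlam (hseq m).1 hFe _ 0 (mk_herm _ _ _) Matrix.isHermitian_zero (by simpa using hN m z hz)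
      (by simp [hF0])
    simpa using this
  have hH : ∀ m, ∃ H, (jetOf (u m)).Hold disc H α 2 := fun m => by
    obtain ⟨H, h⟩ := hhold m
    exact ⟨_, jetOf_hold hα h⟩
  have hcirc : ∀ m θ, (jetOf (u m)).f (Real.cos θ, Real.sin θ) = γ θ := by
    intro m θ
    show u m (T.symm _) = g (circPt θ)
    rw [hbd m _ (by rw [mem_sphere_zero_iff_norm, Ts_norm]; simp [en]), Ts_circ]
  have hsup := fun m => sup_bd (jetOf (u m)) K α M γ (by linarith) hα (jetOf_on (hu m)) (jetOf_cont (hu m)) (hcone0 m) (hH m) (hcirc m) hM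
  have hunif := fun m => hap (jetOf (u m)) γ (deriv γ) (deriv (deriv γ)) (jetOf_on (hu m)) (hcone m) (hH m) (jetOf_cont (hu m))
    (hsup m) (hcirc m) hgd hgdd hGm
  obtain ⟨L, φ, hφ, hLon, hLh, hL2, hL0, hL11, hL12, hL22⟩ := compact (fun m => jetOf (u m)) C M α hα hα1 hC hM0
    (fun m => jetOf_on (hu m)) hunif (fun m => jetOf_cont (hu m)) hsup
  refine ⟨fun x => L.f (T x), ?_, ⟨4 * C, ?_⟩, ?_, ?_⟩
  · refine hL2.comp T.contDiff.contDiffOn (fun x hx => ?_)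
    rw [mem_closedBall_zero_iff, T_norm] at hx
    exact hx
  · intro x hx y hy
    have hz := T_disc hx
    have hw := T_disc hy
    rw [hess_of hLon hx, hess_of hLon hy]
    have nn : ‖T x - T y‖ ≤ ‖x - y‖ := by
      rw [T_norm, map_sub]; exact norm_le_en _
    have np : ‖T x - T y‖ ^ α ≤ ‖x - y‖ ^ α := Real.rpow_le_rpow (norm_nonneg _) nn hα.le
    have a := hLh.h11 _ hz _ hw (disc_norm hz hw)
    have b := hLh.h12 _ hz _ hw (disc_norm hz hw)
    have c := hLh.h22 _ hz _ hw (disc_norm hz hw)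
    have np' := mul_le_mul_of_nonneg_left np hC.le
    simp [matNorm, Fin.sum_univ_two]
    linarith
  · intro x hx
    have hz := T_disc hx
    rw [lapl_eq, hess_of hLon hx]
    have hFcont : Continuous (fun A : Fin 2 → Fin 2 → ℝ => F (Matrix.of A)) := hFc.continuous
    have hmat : Tendsto (fun n => (![![(jetOf (u (φ n))).f11 (T x), (jetOf (u (φ n))).f12 (T x)],
        ![(jetOf (u (φ n))).f12 (T x), (jetOf (u (φ n))).f22 (T x)]] : Fin 2 → Fin 2 → ℝ)) atTop
        (𝓝 ![![L.f11 (T x), L.f12 (T x)], ![L.f12 (T x), L.f22 (T x)]]) := by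
      rw [tendsto_pi_nhds]
      intro i
      rw [tendsto_pi_nhds]
      intro j
      fin_cases i <;> fin_cases j
      · exact hL11 _ hz
      · exact hL12 _ hz
      · exact hL12 _ hz
      · exact hL22 _ hz
    have h1 := (hFcont.tendsto _).comp hmat
    have ht := hlim.comp hφ.tendsto_atTop
    have h2 := (ht.mul h1).add ((ht.const_sub 1).mul ((hL11 _ hz).add (hL22 _ hz)))
    have h3 : Tendsto (fun _ : ℕ => (0:ℝ)) atTop (𝓝 (tbar * F !![L.f11 (T x), L.f12 (T x); L.f12 (T x), L.f22 (T x)]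
        + (1 - tbar) * (L.f11 (T x) + L.f22 (T x)))) := by
      refine h2.congr (fun n => ?_)
      exact hN (φ n) _ hz
    have := tendsto_nhds_unique h3 tendsto_const_nhds
    simpa using this
  · intro x hx
    rw [mem_sphere_zero_iff_norm, T_norm] at hx
    obtain ⟨θ, hθ⟩ := circle_param _ hx
    have h1 := hL0 (T x) (show en (T x) ≤ 1 from hx.le)
    have h2 : ∀ n, (jetOf (u (φ n))).f (T x) = g x := by
      intro n
      rw [hθ, hcirc]
      show g (circPt θ) = g x
      rw [← Ts_circ, ← hθ, ContinuousLinearEquiv.symm_apply_apply]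
    simp only [h2] at h1
    exact (tendsto_nhds_unique h1 tendsto_const_nhds)
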